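/- arXiv:1701.01208 — 4 statements merged into one kernel-verified Lean document; each statement's English description precedes it below -/
import Mathlib

section
/- Let n ≥ 7 be an integer, and let G be the graph obtained from the circulant graph C_n(1,3) by deleting the vertex 0 (since C_n(1,3) is vertex-transitive, this is the decompletion). Then the number of points x ∈ 𝔽₂^{E(G)} with Ψ_G(x) = 0 is congruent to 4n modulo 8; equivalently, c₂^{(2)}(G) ≡ n (mod 2). -/
open SimpleGraph
open scoped Classical

/-- The circulant graph `C_n(s)` on `ZMod n`: distinct `i, j` are adjacent iff
`i - j ≡ a` or `j - i ≡ a (mod n)` for some `a ∈ s`. -/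
def circulant (n : ℕ) (s : Set ℤ) : SimpleGraph (ZMod n) :=
  SimpleGraph.fromRel (fun i j => ∃ a ∈ s, i - j = (a : ZMod n))

/-- `T` is (the edge set of) a spanning tree of `G`. -/
def IsSpanningTree {V : Type} (G : SimpleGraph V) (T : Set (Sym2 V)) : Prop :=
  T ⊆ G.edgeSet ∧ (SimpleGraph.fromEdgeSet T).Connected ∧
    (SimpleGraph.fromEdgeSet T).IsAcyclic

/-- The Kirchhoff polynomial `Ψ_G = Σ_T ∏_{e ∉ T} α_e`, summed over spanning trees. -/
noncomputable def kirchhoff {V : Type} [Fintype V] (G : SimpleGraph V) :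
    MvPolynomial G.edgeSet ℤ :=
  ∑ T ∈ G.edgeFinset.powerset.filter
      (fun T : Finset (Sym2 V) => IsSpanningTree G (T : Set (Sym2 V))),
    ∏ e : G.edgeSet, if (e : Sym2 V) ∈ T then 1 else MvPolynomial.X e

/-- `[Ψ_G]_p`: the number of points `x ∈ 𝔽_p^{E(G)}` with `Ψ_G(x) = 0`. -/
noncomputable def zeroCount {V : Type} [Fintype V] (G : SimpleGraph V) (p : ℕ) : ℕ :=
  Nat.card {x : G.edgeSet → ZMod p //
    MvPolynomial.eval x (MvPolynomial.map (Int.castRingHom (ZMod p)) (kirchhoff G)) = 0}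

/-! ### Sums over forests and over weights -/

/-- Identify the label of `v` with the label of `u`. -/
noncomputable def mergeLabel {V L : Type*} (f : V → L) (u v : V) : V → L :=
  fun w => if f w = f v then f u else f w

/-- The sum over all acyclic sets `T` of the listed edges, taken on the quotient of `V` by the
labelling `f`, of `φ` of the final partition times the product of the weights outside `T`. -/
noncomputable def forestSum {V L : Type*} (φ : (V → V → Prop) → ZMod 2) :
    List (V × V) → List (ZMod 2) → (V → L) → ZMod 2
  | [], _, f => φ (fun a b => f a = f b)
  | _ :: _, [], _ => 0
  | e :: es, y :: ys, f => y * forestSum φ es ys f +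
      if f e.1 = f e.2 then 0 else forestSum φ es ys (mergeLabel f e.1 e.2)

theorem mergeLabel_eq_iff {V L : Type*} (f : V → L) (u v a b : V) :
    mergeLabel f u v a = mergeLabel f u v b ↔
      f a = f b ∨ (f a = f u ∧ f b = f v) ∨ (f a = f v ∧ f b = f u) := by
  unfold mergeLabel
  split_ifs <;> grind

theorem mergeLabel_comp {V W L : Type*} (f : V → L) (g : W → V) (u v : W) :
    mergeLabel f (g u) (g v) ∘ g = mergeLabel (f ∘ g) u v := rfl

/-- Pulling a forest sum back along a map of vertices, as long as an invariant `I` of the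
labellings that occur lets us compare the final weights. -/
theorem forestSum_map_of_invariant {V W L : Type*} (g : W → V) (φ : (V → V → Prop) → ZMod 2)
    (ψ : (W → W → Prop) → ZMod 2) (I : (V → L) → Prop)
    (hφ : ∀ f, I f → φ (fun a b => f a = f b) = ψ (fun a b => f (g a) = f (g b)))
    (es : List (W × W))
    (hI : ∀ f, I f → ∀ e ∈ es, I (mergeLabel f (g e.1) (g e.2)))
    (ys : List (ZMod 2)) (f : V → L) (hf : I f) :
    forestSum φ (es.map (Prod.map g g)) ys f = forestSum ψ es ys (f ∘ g) := by
  induction es generalizing ys f with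
  | nil => simpa [forestSum] using hφ f hf
  | cons e es ih =>
    cases ys with
    | nil => simp [forestSum]
    | cons y ys =>
      have ih' := ih (fun f hf e he => hI f hf e (List.mem_cons_of_mem _ he))
      simp only [List.map_cons, forestSum, Prod.map_fst, Prod.map_snd, Function.comp_apply]
      rw [ih' _ _ hf, ih' _ _ (hI f hf e List.mem_cons_self), mergeLabel_comp]

theorem forestSum_congr_of_invariant {V L : Type*} (φ ψ : (V → V → Prop) → ZMod 2)
    (I : (V → L) → Prop)
    (hφ : ∀ f, I f → φ (fun a b => f a = f b) = ψ (fun a b => f a = f b))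
    (es : List (V × V)) (hI : ∀ f, I f → ∀ e ∈ es, I (mergeLabel f e.1 e.2))
    (ys : List (ZMod 2)) (f : V → L) (hf : I f) :
    forestSum φ es ys f = forestSum ψ es ys f := by
  simpa using forestSum_map_of_invariant id φ ψ I hφ es hI ys f hf

theorem forestSum_congr_label {V L L' : Type*} (φ : (V → V → Prop) → ZMod 2)
    (es : List (V × V)) (ys : List (ZMod 2)) (f : V → L) (f' : V → L')
    (h : ∀ a b, f a = f b ↔ f' a = f' b) :
    forestSum φ es ys f = forestSum φ es ys f' := by
  induction es generalizing ys f f' with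
  | nil => simp [forestSum, h]
  | cons e es ih =>
    cases ys with
    | nil => simp [forestSum]
    | cons y ys =>
      simp only [forestSum, h]
      rw [ih ys f f' h, ih ys (mergeLabel f e.1 e.2) (mergeLabel f' e.1 e.2)
        (by simp [mergeLabel_eq_iff, h])]

theorem forestSum_add {V L : Type*} (φ ψ : (V → V → Prop) → ZMod 2)
    (es : List (V × V)) (ys : List (ZMod 2)) (f : V → L) :
    forestSum (φ + ψ) es ys f = forestSum φ es ys f + forestSum ψ es ys f := by
  induction es generalizing ys f with
  | nil => simp [forestSum]
  | cons e es ih =>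
    cases ys with
    | nil => simp [forestSum]
    | cons y ys =>
      simp only [forestSum, ih]
      split_ifs <;> ring

theorem forestSum_smul {V L : Type*} (c : ZMod 2) (φ : (V → V → Prop) → ZMod 2)
    (es : List (V × V)) (ys : List (ZMod 2)) (f : V → L) :
    forestSum (c • φ) es ys f = c * forestSum φ es ys f := by
  induction es generalizing ys f with
  | nil => simp [forestSum]
  | cons e es ih =>
    cases ys with
    | nil => simp [forestSum]
    | cons y ys =>
      simp only [forestSum, ih]
      split_ifs <;> ring

theorem forestSum_append {V L : Type*} (φ : (V → V → Prop) → ZMod 2)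
    (es es' : List (V × V)) (ys ys' : List (ZMod 2)) (hl : ys.length = es.length) (f : V → L) :
    forestSum φ (es ++ es') (ys ++ ys') f =
      forestSum (fun r => forestSum φ es' ys' r) es ys f := by
  induction es generalizing ys f with
  | nil =>
    obtain rfl : ys = [] := by simpa using hl
    refine forestSum_congr_label _ _ _ _ _ fun a b => ?_
    simp only [funext_iff, eq_iff_iff]
    exact ⟨fun h c => by rw [h], fun h => ((h b).2 rfl)⟩
  | cons e es ih =>
    cases ys with
    | nil => simp at hl
    | cons y ys =>
      simp only [List.cons_append, forestSum]
      rw [ih ys (by simpa using hl), ih ys (by simpa using hl)]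

/-- The sum of `g` over all 0-1 vectors of length `m`. -/
def cubeSum {M : Type*} [AddCommMonoid M] : ℕ → (List (ZMod 2) → M) → M
  | 0, g => g []
  | m + 1, g => cubeSum m (fun ys => g (0 :: ys)) + cubeSum m (fun ys => g (1 :: ys))

theorem cubeSum_congr {M : Type*} [AddCommMonoid M] (m : ℕ) (g g' : List (ZMod 2) → M)
    (h : ∀ ys, ys.length = m → g ys = g' ys) : cubeSum m g = cubeSum m g' := by
  induction m generalizing g g' with
  | zero => exact h [] rfl
  | succ m ih =>
    simp only [cubeSum]
    rw [ih _ _ fun ys hy => h (0 :: ys) (by simp [hy]),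
      ih _ _ fun ys hy => h (1 :: ys) (by simp [hy])]

theorem cubeSum_append {M : Type*} [AddCommMonoid M] (m k : ℕ) (g : List (ZMod 2) → M) :
    cubeSum (m + k) g = cubeSum m fun ys => cubeSum k fun zs => g (ys ++ zs) := by
  induction m generalizing g with
  | zero => simp [cubeSum]
  | succ m ih => rw [Nat.succ_add]; simp [cubeSum, ih]

theorem cubeSum_add {M : Type*} [AddCommMonoid M] (m : ℕ) (g g' : List (ZMod 2) → M) :
    (cubeSum m fun ys => g ys + g' ys) = cubeSum m g + cubeSum m g' := by
  induction m generalizing g g' with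
  | zero => rfl
  | succ m ih => simp only [cubeSum, ih]; abel

theorem map_cubeSum {M N F : Type*} [AddCommMonoid M] [AddCommMonoid N] [FunLike F M N]
    [AddMonoidHomClass F M N] (c : F) (m : ℕ) (g : List (ZMod 2) → M) :
    c (cubeSum m g) = cubeSum m fun ys => c (g ys) := by
  induction m generalizing g with
  | zero => rfl
  | succ m ih => simp [cubeSum, ih, map_add]

theorem cubeSum_ofFn {M : Type*} [AddCommMonoid M] (m : ℕ) (g : List (ZMod 2) → M) :
    cubeSum m g = ∑ z : Fin m → ZMod 2, g (List.ofFn z) := by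
  induction m generalizing g with
  | zero => simp [cubeSum]
  | succ m ih =>
    rw [← (Fin.consEquiv fun _ => ZMod 2).sum_comp, Fintype.sum_prod_type]
    have h2 : ∀ k : ZMod 2 → M, ∑ a, k a = k 0 + k 1 := fun k => Fin.sum_univ_two k
    rw [h2]
    simp [cubeSum, ih, Fin.consEquiv]

/-- Summing out all the edge weights leaves only the term with no edges chosen. -/
theorem cubeSum_forestSum {V L : Type*} (φ : (V → V → Prop) → ZMod 2)
    (es : List (V × V)) (f : V → L) :
    (cubeSum es.length fun ys => forestSum φ es ys f) = φ fun a b => f a = f b := by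
  induction es generalizing f with
  | nil => rfl
  | cons e es ih =>
    simp only [List.length_cons, cubeSum, forestSum, zero_mul, one_mul, zero_add]
    rw [cubeSum_add, ih, add_comm, add_assoc, CharTwo.add_self_eq_zero, add_zero]

/-! ### Pairs of forests -/

/-- The sum over all weights of a product of two forest sums. -/
noncomputable def forestPairSum {V L L' : Type*} (φ φ' : (V → V → Prop) → ZMod 2)
    (es : List (V × V)) (f : V → L) (f' : V → L') : ZMod 2 :=
  cubeSum es.length fun ys => forestSum φ es ys f * forestSum φ' es ys f'

theorem forestPairSum_cons {V L L' : Type*} (φ φ' : (V → V → Prop) → ZMod 2)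
    (e : V × V) (es : List (V × V)) (f : V → L) (f' : V → L') :
    forestPairSum φ φ' (e :: es) f f' = forestPairSum φ φ' es f f' +
      ((if f e.1 = f e.2 then 0 else forestPairSum φ φ' es (mergeLabel f e.1 e.2) f') +
        if f' e.1 = f' e.2 then 0 else forestPairSum φ φ' es f (mergeLabel f' e.1 e.2)) := by
  have h2 : (2 : ZMod 2) = 0 := rfl
  unfold forestPairSum
  simp only [List.length_cons, cubeSum, forestSum, zero_mul, one_mul, zero_add]
  rw [← cubeSum_add]
  split_ifs <;> (try simp only [add_zero, zero_add, mul_zero, zero_mul]) <;>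
    (try rw [← cubeSum_add]) <;> (try rw [← cubeSum_add]) <;>
    refine cubeSum_congr _ _ _ fun ys _ => ?_ <;>
    first
    | ring1
    | linear_combination
        (forestSum φ es ys (mergeLabel f e.1 e.2) * forestSum φ' es ys (mergeLabel f' e.1 e.2)) * h2

/-- The labellings `f` and `f'` have together at least `k` classes on `S`. -/
def ManyClasses {V L L' : Type*} (S : Finset V) (k : ℕ) (f : V → L) (f' : V → L') : Prop :=
  ∃ A ⊆ S, ∃ A' ⊆ S, Set.InjOn f A ∧ Set.InjOn f' A' ∧ k ≤ A.card + A'.card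

theorem exists_injOn_mergeLabel {V L : Type*} (f : V → L) (u v : V) (A : Finset V)
    (hA : Set.InjOn f A) :
    ∃ B ⊆ A, Set.InjOn (mergeLabel f u v) B ∧ A.card ≤ B.card + 1 := by
  by_cases h : ∃ a ∈ A, f a = f v
  · obtain ⟨a, ha, hav⟩ := h
    refine ⟨A.erase a, Finset.erase_subset _ _, ?_, by rw [Finset.card_erase_of_mem ha]; omega⟩
    intro b hb c hc hbc
    simp only [Finset.coe_erase, Set.mem_sdiff, Finset.mem_coe, Set.mem_singleton_iff] at hb hc
    rcases (mergeLabel_eq_iff f u v b c).1 hbc with h | h | h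
    · exact hA hb.1 hc.1 h
    · exact absurd (hA hc.1 ha (h.2.trans hav.symm)) hc.2
    · exact absurd (hA hb.1 ha (h.1.trans hav.symm)) hb.2
  · push Not at h
    refine ⟨A, subset_rfl, ?_, by omega⟩
    intro b hb c hc hbc
    rcases (mergeLabel_eq_iff f u v b c).1 hbc with h' | h' | h'
    · exact hA hb hc h'
    · exact absurd h'.2 (h c hc)
    · exact absurd h'.1 (h b hb)

theorem ManyClasses.mergeLabel_left {V L L' : Type*} {S : Finset V} {k : ℕ} {f : V → L}
    {f' : V → L'} (h : ManyClasses S (k + 1) f f') (u v : V) :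
    ManyClasses S k (mergeLabel f u v) f' := by
  obtain ⟨A, hA, A', hA', h1, h2, h3⟩ := h
  obtain ⟨B, hB, h4, h5⟩ := exists_injOn_mergeLabel f u v A h1
  exact ⟨B, hB.trans hA, A', hA', h4, h2, by omega⟩

theorem ManyClasses.mergeLabel_right {V L L' : Type*} {S : Finset V} {k : ℕ} {f : V → L}
    {f' : V → L'} (h : ManyClasses S (k + 1) f f') (u v : V) :
    ManyClasses S k f (mergeLabel f' u v) := by
  obtain ⟨A, hA, A', hA', h1, h2, h3⟩ := h
  obtain ⟨B, hB, h4, h5⟩ := exists_injOn_mergeLabel f' u v A' h2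
  exact ⟨A, hA, B, hB.trans hA', h1, h4, by omega⟩

/-- `φ` vanishes on every labelling with more than `k` classes on `S`. -/
def ClassBound {V : Type*} (S : Finset V) (k : ℕ) (φ : (V → V → Prop) → ZMod 2) : Prop :=
  ∀ {L : Type} (f : V → L), ∀ A ⊆ S, Set.InjOn f A → k < A.card → φ (fun a b => f a = f b) = 0

theorem forestPairSum_eq_zero {V L L' : Type} {φ φ' : (V → V → Prop) → ZMod 2} {S : Finset V}
    (hφ : ClassBound S 1 φ) (hφ' : ClassBound S 2 φ') (es : List (V × V)) (f : V → L)
    (f' : V → L') (h : ManyClasses S (es.length + 4) f f') :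
    forestPairSum φ φ' es f f' = 0 := by
  induction es generalizing f f' with
  | nil =>
    obtain ⟨A, hA, A', hA', h1, h2, h3⟩ := h
    simp only [forestPairSum, List.length_nil, cubeSum, forestSum]
    simp only [List.length_nil] at h3
    rcases lt_or_ge 1 A.card with hc | hc
    · rw [hφ f A hA h1 hc, zero_mul]
    · rw [hφ' f' A' hA' h2 (by omega), mul_zero]
  | cons e es ih =>
    have h' : ManyClasses S (es.length + 4 + 1) f f' := by
      simpa [add_right_comm] using h
    rw [forestPairSum_cons, ih _ _ (h'.mergeLabel_left _ _), ih _ _ (h'.mergeLabel_right _ _), ih]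
    · simp
    · obtain ⟨A, hA, A', hA', h1, h2, h3⟩ := h'
      exact ⟨A, hA, A', hA', h1, h2, by omega⟩

/-- If there are as many classes as there can be, every edge is used by exactly one forest. -/
theorem forestPairSum_cons_of_manyClasses {V L L' : Type} {φ φ' : (V → V → Prop) → ZMod 2}
    {S : Finset V} (hφ : ClassBound S 1 φ) (hφ' : ClassBound S 2 φ') (e : V × V)
    (es : List (V × V)) (f : V → L) (f' : V → L')
    (h : ManyClasses S (es.length + 4) f f') :
    forestPairSum φ φ' (e :: es) f f' =
      (if f e.1 = f e.2 then 0 else forestPairSum φ φ' es (mergeLabel f e.1 e.2) f') +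
        if f' e.1 = f' e.2 then 0 else forestPairSum φ φ' es f (mergeLabel f' e.1 e.2) := by
  rw [forestPairSum_cons, forestPairSum_eq_zero hφ hφ' es f f' h, zero_add]

/-- The labelling of `ℕ` given by a list, extended by `i ↦ i`. -/
def listLabel (t : List ℕ) (i : ℕ) : ℕ := t.getD i i

/-- `mergeLabel` for labellings given by lists. -/
def mergeList (t : List ℕ) (i j : ℕ) : List ℕ :=
  t.map fun x => if x = listLabel t j then listLabel t i else x

/-- The list has length `l` and entries below `l`. -/
def IsLabelList (l : ℕ) (t : List ℕ) : Prop := t.length = l ∧ ∀ x ∈ t, x < l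

theorem IsLabelList.listLabel_lt {l : ℕ} {t : List ℕ} (h : IsLabelList l t) {i : ℕ} (hi : i < l) :
    listLabel t i < l := by
  have hi' : i < t.length := h.1 ▸ hi
  rw [listLabel, List.getD_eq_getElem _ _ hi']
  exact h.2 _ (List.getElem_mem hi')

theorem IsLabelList.listLabel_of_le {l : ℕ} {t : List ℕ} (h : IsLabelList l t) {i : ℕ}
    (hi : l ≤ i) : listLabel t i = i := by
  simp [listLabel, h.1, hi]

theorem IsLabelList.mergeList {l : ℕ} {t : List ℕ} (h : IsLabelList l t) {i j : ℕ} (hi : i < l) :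
    IsLabelList l (mergeList t i j) := by
  refine ⟨by simp [_root_.mergeList, h.1], ?_⟩
  simp only [_root_.mergeList, List.mem_map, forall_exists_index, and_imp, forall_apply_eq_imp_iff₂]
  intro x hx
  split_ifs
  · exact h.listLabel_lt hi
  · exact h.2 x hx

theorem mergeLabel_listLabel {l : ℕ} {t : List ℕ} (h : IsLabelList l t) {i j : ℕ} (hj : j < l) :
    mergeLabel (listLabel t) i j = listLabel (mergeList t i j) := by
  funext w
  rcases lt_or_ge w l with hw | hw
  · have hw' : w < t.length := h.1 ▸ hw
    have h1 : listLabel t w = t[w] := by simp [listLabel, hw']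
    have h2 : listLabel (mergeList t i j) w =
        if t[w] = listLabel t j then listLabel t i else t[w] := by
      rw [listLabel, List.getD_eq_getElem _ _ (by simpa [mergeList] using hw')]
      simp [mergeList]
    rw [mergeLabel, h1, h2]
    split_ifs <;> rfl
  · have h1 : listLabel t w ≠ listLabel t j := by
      rw [h.listLabel_of_le hw]
      exact (h.listLabel_lt hj |>.trans_le hw).ne'
    rw [mergeLabel, if_neg h1, h.listLabel_of_le hw, listLabel, mergeList,
      List.getD_eq_default _ _ (by simpa [h.1] using hw)]

/-- Give an edge to one of the two forests, in all possible ways. -/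
def edgeStep (e : ℕ × ℕ) (p : List ℕ × List ℕ) : List (List ℕ × List ℕ) :=
  (if listLabel p.1 e.1 = listLabel p.1 e.2 then [] else [(mergeList p.1 e.1 e.2, p.2)]) ++
    if listLabel p.2 e.1 = listLabel p.2 e.2 then [] else [(p.1, mergeList p.2 e.1 e.2)]

/-- Distribute a list of edges over the two forests, in all possible ways. -/
def edgesStep : List (ℕ × ℕ) → List ℕ × List ℕ → List (List ℕ × List ℕ)
  | [], p => [p]
  | e :: es, p => (edgeStep e p).flatMap (edgesStep es)

theorem List.sum_map_flatMap {α β M : Type*} [AddCommMonoid M] (l : List α) (g : α → List β)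
    (F : β → M) : ((l.flatMap g).map F).sum = (l.map fun a => ((g a).map F).sum).sum := by
  induction l with
  | nil => rfl
  | cons a l ih => simp [ih]

theorem edgeStep_spec {l : ℕ} {φ φ' : (ℕ → ℕ → Prop) → ZMod 2} {S : Finset ℕ}
    (hφ : ClassBound S 1 φ) (hφ' : ClassBound S 2 φ') (e : ℕ × ℕ) (he : e.1 < l ∧ e.2 < l)
    (es : List (ℕ × ℕ)) (p : List ℕ × List ℕ) (h1 : IsLabelList l p.1) (h2 : IsLabelList l p.2)
    (h : ManyClasses S (es.length + 4) (listLabel p.1) (listLabel p.2)) :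
    forestPairSum φ φ' (e :: es) (listLabel p.1) (listLabel p.2) =
      ((edgeStep e p).map fun q => forestPairSum φ φ' es (listLabel q.1) (listLabel q.2)).sum ∧
    ∀ q ∈ edgeStep e p, IsLabelList l q.1 ∧ IsLabelList l q.2 ∧
      ManyClasses S (es.length + 3) (listLabel q.1) (listLabel q.2) := by
  have a1 := mergeLabel_listLabel h1 (i := e.1) he.2
  have a2 := mergeLabel_listLabel h2 (i := e.1) he.2
  have b1 := h.mergeLabel_left e.1 e.2
  have b2 := h.mergeLabel_right e.1 e.2
  rw [a1] at b1
  rw [a2] at b2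
  rw [forestPairSum_cons_of_manyClasses hφ hφ' e es _ _ h, a1, a2]
  constructor
  · unfold edgeStep
    split_ifs <;> simp
  · intro q hq
    rw [edgeStep, List.mem_append] at hq
    rcases hq with hq | hq
    · split_ifs at hq
      · simp at hq
      · obtain rfl := List.mem_singleton.1 hq
        exact ⟨h1.mergeList he.1, h2, b1⟩
    · split_ifs at hq
      · simp at hq
      · obtain rfl := List.mem_singleton.1 hq
        exact ⟨h1, h2.mergeList he.1, b2⟩

theorem edgesStep_spec {l : ℕ} {φ φ' : (ℕ → ℕ → Prop) → ZMod 2} {S : Finset ℕ}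
    (hφ : ClassBound S 1 φ) (hφ' : ClassBound S 2 φ') (es es' : List (ℕ × ℕ))
    (hes : ∀ e ∈ es, e.1 < l ∧ e.2 < l)
    (p : List ℕ × List ℕ) (h1 : IsLabelList l p.1) (h2 : IsLabelList l p.2)
    (h : ManyClasses S (es.length + es'.length + 3) (listLabel p.1) (listLabel p.2)) :
    forestPairSum φ φ' (es ++ es') (listLabel p.1) (listLabel p.2) =
      ((edgesStep es p).map fun q =>
        forestPairSum φ φ' es' (listLabel q.1) (listLabel q.2)).sum ∧
    ∀ q ∈ edgesStep es p, IsLabelList l q.1 ∧ IsLabelList l q.2 := by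
  induction es generalizing p with
  | nil => simp [edgesStep, h1, h2]
  | cons e es ih =>
    have hs := edgeStep_spec hφ hφ' e (hes e List.mem_cons_self) (es ++ es') p h1 h2
      (by convert h using 1; simp; omega)
    have ih' := fun q hq => ih (fun e he => hes e (List.mem_cons_of_mem _ he)) q
      (hs.2 q hq).1 (hs.2 q hq).2.1 (by simpa using (hs.2 q hq).2.2)
    constructor
    · rw [List.cons_append, hs.1, edgesStep, List.sum_map_flatMap]
      congr 1
      exact List.map_congr_left fun q hq => (ih' q hq).1
    · intro q hq
      rw [edgesStep, List.mem_flatMap] at hq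
      obtain ⟨q', hq', hq⟩ := hq
      exact (ih' q' hq').2 q hq

/-! ### The ladder -/

/-- Make room for one more vertex at position `3`. -/
def shiftVertex (i : ℕ) : ℕ := if i < 3 then i else i + 1

/-- The edges of the ladder-like graph with rungs `i, i + 1` and `i, i + 3`, closed off at the far
end by the vertex `0`. The vertices `1` and `2` are only markers. -/
def ladderEdges : ℕ → List (ℕ × ℕ)
  | 0 => [(3, 4), (4, 5), (5, 0), (3, 0)]
  | m + 1 => [(3, 4), (3, 6)] ++ (ladderEdges m).map (Prod.map shiftVertex shiftVertex)

/-- All the vertices are in one class. -/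
noncomputable def treeWeight (m : ℕ) (r : ℕ → ℕ → Prop) : ZMod 2 :=
  if ∀ i < m + 6, r i 0 then 1 else 0

/-- There are exactly two classes, and both contain one of `1`, `2`, `m + 5`. -/
noncomputable def twoForestWeight (m : ℕ) (r : ℕ → ℕ → Prop) : ZMod 2 :=
  if (∀ i < m + 6, r i 1 ∨ r i 2 ∨ r i (m + 5)) ∧
    ((r 1 2 ∧ ¬ r 1 (m + 5)) ∨ (r 1 (m + 5) ∧ ¬ r 1 2) ∨ (r 2 (m + 5) ∧ ¬ r 1 (m + 5)))
  then 1 else 0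

theorem length_ladderEdges (m : ℕ) : (ladderEdges m).length = 2 * m + 4 := by
  induction m with
  | zero => rfl
  | succ m ih => simp [ladderEdges, ih]; omega

theorem shiftVertex_lt {i k : ℕ} (h : i < k) : shiftVertex i < k + 1 := by
  unfold shiftVertex; split_ifs <;> omega

theorem lt_of_mem_ladderEdges (m : ℕ) : ∀ e ∈ ladderEdges m, e.1 < m + 6 ∧ e.2 < m + 6 := by
  induction m with
  | zero => decide
  | succ m ih =>
    simp only [ladderEdges, List.cons_append, List.nil_append, List.mem_cons, List.mem_map]
    rintro e (rfl | rfl | ⟨e, he, rfl⟩)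
    · simp
    · simp
    · exact ⟨shiftVertex_lt (ih e he).1, shiftVertex_lt (ih e he).2⟩

theorem classBound_treeWeight (m : ℕ) : ClassBound (Finset.range (m + 6)) 1 (treeWeight m) := by
  intro L f A hA hf hc
  obtain ⟨a, ha, b, hb, hab⟩ := Finset.one_lt_card.1 hc
  refine if_neg fun h => hab (hf ha hb ?_)
  rw [h a (Finset.mem_range.1 (hA ha)), h b (Finset.mem_range.1 (hA hb))]

theorem classBound_twoForestWeight (m : ℕ) :
    ClassBound (Finset.range (m + 6)) 2 (twoForestWeight m) := by
  intro L f A hA hf hc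
  obtain ⟨a, ha, b, hb, c, hcA, hab, hac, hbc⟩ := Finset.two_lt_card.1 hc
  refine if_neg fun h => ?_
  have h1 := h.1 a (Finset.mem_range.1 (hA ha))
  have h2 := h.1 b (Finset.mem_range.1 (hA hb))
  have h3 := h.1 c (Finset.mem_range.1 (hA hcA))
  have h4 : f a ≠ f b := fun h => hab (hf ha hb h)
  have h5 : f a ≠ f c := fun h => hac (hf ha hcA h)
  have h6 : f b ≠ f c := fun h => hbc (hf hb hcA h)
  have h7 := h.2
  grind

theorem forall_lt_shiftVertex (k : ℕ) (hk : 3 ≤ k) (P : ℕ → Prop) :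
    (∀ i < k + 1, P i) ↔ P 3 ∧ ∀ i < k, P (shiftVertex i) := by
  constructor
  · exact fun h => ⟨h 3 (by omega), fun i hi => h _ (shiftVertex_lt hi)⟩
  · rintro ⟨h3, h⟩ i hi
    rcases lt_trichotomy i 3 with h' | rfl | h'
    · have := h i (by omega)
      rwa [shiftVertex, if_pos h'] at this
    · exact h3
    · have := h (i - 1) (by omega)
      rwa [shiftVertex, if_neg (by omega), Nat.sub_add_cancel (by omega)] at this

theorem forestSum_zero {V L : Type*} (es : List (V × V)) (ys : List (ZMod 2)) (f : V → L) :
    forestSum (fun _ => 0) es ys f = 0 := by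
  have := forestSum_smul 0 (fun _ => 0) es ys f
  simp at this
  exact this

/-- Once all edges at vertex `3` are used it can be dropped, provided its class survives. -/
theorem forestSum_shiftVertex {L : Type*} (m : ℕ) (φ ψ : (ℕ → ℕ → Prop) → ZMod 2)
    (hφ : ∀ f : ℕ → L, (∃ j < m + 6, f 3 = f (shiftVertex j)) →
      φ (fun a b => f a = f b) = ψ fun a b => f (shiftVertex a) = f (shiftVertex b))
    (hφ0 : ∀ f : ℕ → L, (∀ j < m + 6, f 3 ≠ f (shiftVertex j)) → φ (fun a b => f a = f b) = 0)
    (ys : List (ZMod 2)) (f : ℕ → L) :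
    forestSum φ ((ladderEdges m).map (Prod.map shiftVertex shiftVertex)) ys f =
      if ∃ j < m + 6, f 3 = f (shiftVertex j) then
        forestSum ψ (ladderEdges m) ys (f ∘ shiftVertex) else 0 := by
  split_ifs with h
  · refine forestSum_map_of_invariant _ φ ψ (fun f => ∃ j < m + 6, f 3 = f (shiftVertex j)) hφ _
      ?_ ys f h
    rintro f ⟨j, hj, h⟩ e -
    exact ⟨j, hj, (mergeLabel_eq_iff _ _ _ _ _).2 (Or.inl h)⟩
  · push Not at h
    rw [forestSum_map_of_invariant _ φ (fun _ => 0)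
      (fun f => ∀ j < m + 6, f 3 ≠ f (shiftVertex j)) hφ0 _ ?_ ys f h, forestSum_zero]
    intro f hf e he j hj h
    have := lt_of_mem_ladderEdges m e he
    rcases (mergeLabel_eq_iff _ _ _ _ _).1 h with h | h | h
    · exact hf j hj h
    · exact hf _ this.1 h.1
    · exact hf _ this.2 h.1

theorem forestSum_treeWeight_shiftVertex {L : Type*} (m : ℕ) (ys : List (ZMod 2)) (f : ℕ → L) :
    forestSum (treeWeight (m + 1)) ((ladderEdges m).map (Prod.map shiftVertex shiftVertex)) ys f =
      if ∃ j < m + 6, f 3 = f (shiftVertex j) then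
        forestSum (treeWeight m) (ladderEdges m) ys (f ∘ shiftVertex) else 0 := by
  refine forestSum_shiftVertex m _ _ ?_ ?_ ys f
  · rintro f ⟨j, hj, h⟩
    have h0 : shiftVertex 0 = 0 := rfl
    simp only [treeWeight, add_right_comm m 1 6, forall_lt_shiftVertex (m + 6) (by omega), h0]
    congr 1
    exact propext ⟨fun h => h.2, fun h' => ⟨h.trans (h' j hj), h'⟩⟩
  · intro f hf
    refine if_neg fun h => hf 0 (by omega) (h 3 (by omega))

theorem forestSum_twoForestWeight_shiftVertex {L : Type*} (m : ℕ) (ys : List (ZMod 2))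
    (f : ℕ → L) :
    forestSum (twoForestWeight (m + 1)) ((ladderEdges m).map (Prod.map shiftVertex shiftVertex))
      ys f = if ∃ j < m + 6, f 3 = f (shiftVertex j) then
        forestSum (twoForestWeight m) (ladderEdges m) ys (f ∘ shiftVertex) else 0 := by
  have h1 : shiftVertex 1 = 1 := rfl
  have h2 : shiftVertex 2 = 2 := rfl
  have h5 : shiftVertex (m + 5) = m + 1 + 5 := by simp [shiftVertex]
  refine forestSum_shiftVertex m _ _ ?_ ?_ ys f
  · rintro f ⟨j, hj, h⟩
    simp only [twoForestWeight, add_right_comm m 1 6, forall_lt_shiftVertex (m + 6) (by omega),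
      h1, h2, h5]
    congr 2
    refine propext ⟨fun h => h.2, fun h' => ⟨?_, h'⟩⟩
    rw [h]
    exact h' j hj
  · intro f hf
    refine if_neg fun h => ?_
    have h' := h.1 3 (by omega)
    have e1 := hf 1 (by omega)
    have e2 := hf 2 (by omega)
    have e5 := hf (m + 5) (by omega)
    rw [h1] at e1
    rw [h2] at e2
    rw [h5] at e5
    tauto

/-- Drop position `3` from a list of labels and rename the labels in a canonical way. -/
def dropLabel (t : List ℕ) : List ℕ := (t.eraseIdx 3).map (t.eraseIdx 3).idxOf

/-- The states that remain when vertex `3` is dropped. -/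
def dropStep (p : List ℕ × List ℕ) : List (List ℕ × List ℕ) :=
  if listLabel p.1 3 ∈ p.1.eraseIdx 3 ∧ listLabel p.2 3 ∈ p.2.eraseIdx 3 then
    [(dropLabel p.1, dropLabel p.2)] else []

theorem listLabel_shiftVertex {t : List ℕ} (ht : IsLabelList 7 t) (i : ℕ) :
    listLabel t (shiftVertex i) = if h : i < (t.eraseIdx 3).length then (t.eraseIdx 3)[i]
      else i + 1 := by
  have hl : (t.eraseIdx 3).length = 6 := by
    rw [List.length_eraseIdx, ht.1]; rfl
  split_ifs with h
  · rw [List.getElem_eraseIdx, shiftVertex]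
    have := ht.1
    split_ifs <;> rw [listLabel, List.getD_eq_getElem]
  · rw [shiftVertex, if_neg (by omega), ht.listLabel_of_le (by omega)]

theorem listLabel_dropLabel {t : List ℕ} (ht : IsLabelList 7 t) (a b : ℕ) :
    (listLabel t ∘ shiftVertex) a = (listLabel t ∘ shiftVertex) b ↔
      listLabel (dropLabel t) a = listLabel (dropLabel t) b := by
  have hl : (t.eraseIdx 3).length = 6 := by
    rw [List.length_eraseIdx, ht.1]; rfl
  have hm : ∀ x ∈ t.eraseIdx 3, x < 7 := fun x hx => ht.2 x (List.mem_of_mem_eraseIdx hx)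
  have key : ∀ i, listLabel (dropLabel t) i = if h : i < (t.eraseIdx 3).length then
      (t.eraseIdx 3).idxOf (t.eraseIdx 3)[i] else i := by
    intro i
    split_ifs with h
    · rw [listLabel, List.getD_eq_getElem _ _ (by simpa [dropLabel] using h)]
      simp [dropLabel]
    · rw [listLabel, List.getD_eq_default _ _ (by simpa [dropLabel] using h)]
  have hidx : ∀ i (h : i < (t.eraseIdx 3).length), (t.eraseIdx 3).idxOf (t.eraseIdx 3)[i] < 6 :=
    fun i h => hl ▸ List.idxOf_lt_length_of_mem (List.getElem_mem h)
  rw [Function.comp_apply, Function.comp_apply, listLabel_shiftVertex ht, listLabel_shiftVertex ht,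
    key, key]
  split_ifs with h1 h2 h2
  · exact (List.idxOf_inj (List.getElem_mem h1)).symm
  · have := hm _ (List.getElem_mem h1)
    have := hidx a h1
    omega
  · have := hm _ (List.getElem_mem h2)
    have := hidx b h2
    omega
  · omega

theorem exists_eq_listLabel_shiftVertex {t : List ℕ} (ht : IsLabelList 7 t) (m : ℕ) :
    (∃ j < m + 6, listLabel t 3 = listLabel t (shiftVertex j)) ↔
      listLabel t 3 ∈ t.eraseIdx 3 := by
  have hl : (t.eraseIdx 3).length = 6 := by
    rw [List.length_eraseIdx, ht.1]; rfl
  have h3 := ht.listLabel_lt (i := 3) (by omega)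
  constructor
  · rintro ⟨j, -, hj⟩
    rw [listLabel_shiftVertex ht] at hj
    split_ifs at hj with h
    · rw [hj]; exact List.getElem_mem h
    · omega
  · intro h
    obtain ⟨j, hj, h⟩ := List.getElem_of_mem h
    refine ⟨j, by omega, ?_⟩
    rw [listLabel_shiftVertex ht, dif_pos hj, h]

theorem dropStep_spec (m : ℕ) (p : List ℕ × List ℕ) (h1 : IsLabelList 7 p.1)
    (h2 : IsLabelList 7 p.2) :
    forestPairSum (treeWeight (m + 1)) (twoForestWeight (m + 1))
      ((ladderEdges m).map (Prod.map shiftVertex shiftVertex)) (listLabel p.1) (listLabel p.2) =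
    ((dropStep p).map fun q => forestPairSum (treeWeight m) (twoForestWeight m) (ladderEdges m)
      (listLabel q.1) (listLabel q.2)).sum := by
  simp only [forestPairSum, List.length_map, forestSum_treeWeight_shiftVertex,
    forestSum_twoForestWeight_shiftVertex, exists_eq_listLabel_shiftVertex h1,
    exists_eq_listLabel_shiftVertex h2]
  simp only [forestSum_congr_label _ _ _ _ _ (listLabel_dropLabel h1),
    forestSum_congr_label _ _ _ _ _ (listLabel_dropLabel h2)]
  unfold dropStep
  have h0 : ∀ k, cubeSum k (fun _ => (0 : ZMod 2)) = 0 := by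
    intro k
    induction k with
    | zero => rfl
    | succ n ih => simp [cubeSum, ih]
  by_cases c1 : listLabel p.1 3 ∈ p.1.eraseIdx 3 <;>
    by_cases c2 : listLabel p.2 3 ∈ p.2.eraseIdx 3 <;> simp [c1, c2, h0]

/-- The number of `i < 6` whose label is `i`. -/
def rootCount (t : List ℕ) : ℕ := ((Finset.range 6).filter fun i => listLabel t i = i).card

theorem manyClasses_listLabel {t t' : List ℕ} (h : IsLabelList 6 t) (h' : IsLabelList 6 t')
    (m k : ℕ) (hk : k ≤ rootCount t + rootCount t' + 2 * m) :
    ManyClasses (Finset.range (m + 6)) k (listLabel t) (listLabel t') := by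
  have key : ∀ t, IsLabelList 6 t → ∃ A ⊆ Finset.range (m + 6),
      Set.InjOn (listLabel t) A ∧ A.card = rootCount t + m := by
    intro t ht
    have hA : ∀ i ∈ ((Finset.range 6).filter fun i => listLabel t i = i) ∪ Finset.Ico 6 (m + 6),
        listLabel t i = i := by
      intro i hi
      rcases Finset.mem_union.1 hi with hi | hi
      · exact (Finset.mem_filter.1 hi).2
      · exact ht.listLabel_of_le (Finset.mem_Ico.1 hi).1
    refine ⟨_, ?_, fun i hi j hj hij => by rwa [hA i hi, hA j hj] at hij, ?_⟩
    · intro i hi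
      simp only [Finset.mem_union, Finset.mem_filter, Finset.mem_range, Finset.mem_Ico] at hi ⊢
      omega
    · rw [Finset.card_union_of_disjoint, Nat.card_Ico, rootCount]
      · omega
      · rw [Finset.disjoint_left]
        intro i hi
        simp only [Finset.mem_filter, Finset.mem_range, Finset.mem_Ico] at hi ⊢
        omega
  obtain ⟨A, hA, h1, h2⟩ := key t h
  obtain ⟨A', hA', h1', h2'⟩ := key t' h'
  exact ⟨A, hA, A', hA', h1, h1', by omega⟩

/-- Two labellings of `0, …, 5` with at least seven classes in total. -/
def GoodState (p : List ℕ × List ℕ) : Prop :=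
  (p.1.length = 6 ∧ ∀ x ∈ p.1, x < 6) ∧ (p.2.length = 6 ∧ ∀ x ∈ p.2, x < 6) ∧
    7 ≤ rootCount p.1 + rootCount p.2

instance : DecidablePred GoodState := fun p => by unfold GoodState; infer_instance

/-- The pair sum of the ladder with `m` rungs left, starting from a given state. -/
noncomputable def stateSum (m : ℕ) (p : List ℕ × List ℕ) : ZMod 2 :=
  forestPairSum (treeWeight m) (twoForestWeight m) (ladderEdges m) (listLabel p.1) (listLabel p.2)

/-- The states obtained by processing one rung. -/
def rungStep (p : List ℕ × List ℕ) : List (List ℕ × List ℕ) :=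
  (edgesStep [(3, 4), (3, 6)] (p.1 ++ [6], p.2 ++ [6])).flatMap dropStep

theorem listLabel_append {t : List ℕ} {l : ℕ} (h : t.length = l) :
    listLabel (t ++ [l]) = listLabel t := by
  funext i
  rcases lt_trichotomy i l with hi | rfl | hi
  · exact List.getD_append _ _ _ _ (h ▸ hi)
  · simp [listLabel, ← h]
  · rw [listLabel, listLabel, List.getD_eq_default _ _ (by simp; omega),
      List.getD_eq_default _ _ (by omega)]

theorem IsLabelList.append {t : List ℕ} {l : ℕ} (h : IsLabelList l t) :
    IsLabelList (l + 1) (t ++ [l]) := by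
  refine ⟨by simp [h.1], fun x hx => ?_⟩
  rcases List.mem_append.1 hx with hx | hx
  · exact (h.2 x hx).trans (Nat.lt_succ_self _)
  · simp at hx; omega

theorem stateSum_succ (m : ℕ) (p : List ℕ × List ℕ) (hp : GoodState p) :
    stateSum (m + 1) p = ((rungStep p).map (stateSum m)).sum := by
  obtain ⟨h1, h2, h3⟩ := hp
  have e1 := listLabel_append h1.1
  have e2 := listLabel_append h2.1
  have hs := edgesStep_spec (classBound_treeWeight (m + 1)) (classBound_twoForestWeight (m + 1))
    [(3, 4), (3, 6)] ((ladderEdges m).map (Prod.map shiftVertex shiftVertex)) (l := 7) (by decide)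
    (p.1 ++ [6], p.2 ++ [6]) (IsLabelList.append h1) (IsLabelList.append h2) (by
      simp only [e1, e2]
      refine manyClasses_listLabel h1 h2 _ _ ?_
      rw [List.length_map, length_ladderEdges, List.length_cons, List.length_singleton]
      omega)
  simp only [e1, e2] at hs
  rw [stateSum, ladderEdges, hs.1, rungStep, List.sum_map_flatMap]
  congr 1
  refine List.map_congr_left fun q hq => ?_
  exact dropStep_spec m q (hs.2 q hq).1 (hs.2 q hq).2

/-- The weight of a final state. -/
def endWeight (p : List ℕ × List ℕ) : ZMod 2 :=
  (if ∀ i < (6 : ℕ), listLabel p.1 i = listLabel p.1 0 then 1 else 0) *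
    if (∀ i < (6 : ℕ), listLabel p.2 i = listLabel p.2 1 ∨ listLabel p.2 i = listLabel p.2 2 ∨
      listLabel p.2 i = listLabel p.2 5) ∧
    ((listLabel p.2 1 = listLabel p.2 2 ∧ ¬ listLabel p.2 1 = listLabel p.2 5) ∨
      (listLabel p.2 1 = listLabel p.2 5 ∧ ¬ listLabel p.2 1 = listLabel p.2 2) ∨
      (listLabel p.2 2 = listLabel p.2 5 ∧ ¬ listLabel p.2 1 = listLabel p.2 5)) then 1 else 0

theorem stateSum_zero (p : List ℕ × List ℕ) (hp : GoodState p) :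
    stateSum 0 p = ((edgesStep (ladderEdges 0) p).map endWeight).sum := by
  obtain ⟨h1, h2, h3⟩ := hp
  have hs := edgesStep_spec (classBound_treeWeight 0) (classBound_twoForestWeight 0)
    (ladderEdges 0) [] (l := 6) (by decide) p h1 h2 (by
      refine manyClasses_listLabel h1 h2 _ _ ?_
      rw [length_ladderEdges, List.length_nil]
      omega)
  rw [List.append_nil] at hs
  rw [stateSum, hs.1]
  congr 1
  refine List.map_congr_left fun q hq => ?_
  simp only [forestPairSum, List.length_nil, cubeSum, forestSum, treeWeight, twoForestWeight,
    endWeight, zero_add]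

/-- Add a state to a list of states, or remove it if it is already there. -/
def toggleState (p : List ℕ × List ℕ) (v : List (List ℕ × List ℕ)) : List (List ℕ × List ℕ) :=
  if p ∈ v then v.erase p else p :: v

/-- Cancel equal states in pairs. -/
def cancelStates (v : List (List ℕ × List ℕ)) : List (List ℕ × List ℕ) := v.foldr toggleState []

theorem sum_map_cancelStates (F : List ℕ × List ℕ → ZMod 2) (v : List (List ℕ × List ℕ)) :
    ((cancelStates v).map F).sum = (v.map F).sum := by
  induction v with
  | nil => rfl
  | cons p v ih =>
    rw [List.map_cons, List.sum_cons, ← ih]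
    change ((toggleState p (cancelStates v)).map F).sum = _
    rw [toggleState]
    split_ifs with h
    · rw [← List.sum_map_erase F h, ← add_assoc, CharTwo.add_self_eq_zero, zero_add]
      congr!
    · simp

/-- The states reached from the start after `k` rungs. -/
def ladderStates : ℕ → List (List ℕ × List ℕ)
  | 0 => edgesStep [(0, 3)] ([0, 0, 0, 3, 4, 5], [0, 1, 2, 1, 4, 2])
  | k + 1 => cancelStates ((ladderStates k).flatMap rungStep)

theorem goodState_ladderStates : ∀ k < 7, ∀ p ∈ ladderStates k, GoodState p := by
  decide +kernel

theorem cancelStates_ladderStates : cancelStates (ladderStates 7 ++ ladderStates 3) = [] := by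
  decide +kernel

theorem sum_endWeight_ladderStates : ∀ k < 7,
    ((ladderStates k).map fun p => ((edgesStep (ladderEdges 0) p).map endWeight).sum).sum =
      (k : ZMod 2) := by
  decide +kernel

theorem sum_stateSum_ladderStates (m k : ℕ) (hk : k < 7) :
    ((ladderStates k).map (stateSum m)).sum = m + k := by
  induction m generalizing k with
  | zero =>
    rw [List.map_congr_left fun p hp => stateSum_zero p (goodState_ladderStates k hk p hp),
      sum_endWeight_ladderStates k hk]
    simp
  | succ m ih =>
    have h1 : ((ladderStates k).map (stateSum (m + 1))).sum =
        ((ladderStates (k + 1)).map (stateSum m)).sum := by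
      rw [List.map_congr_left fun p hp => stateSum_succ m p (goodState_ladderStates k hk p hp),
        ladderStates, sum_map_cancelStates, List.sum_map_flatMap]
    rw [h1]
    rcases Nat.lt_succ_iff_lt_or_eq.1 hk with hk | rfl
    · rw [ih (k + 1) (by omega)]
      push_cast
      ring
    · have h2 := sum_map_cancelStates (stateSum m) (ladderStates 7 ++ ladderStates 3)
      rw [cancelStates_ladderStates, List.map_append, List.sum_append, ih 3 (by omega)] at h2
      have h3 : ((3 : ℕ) : ZMod 2) = ((6 + 1 : ℕ) : ZMod 2) := by decide
      rw [List.map_nil, List.sum_nil, eq_comm, CharTwo.add_eq_zero] at h2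
      rw [h2, h3]
      push_cast
      ring

theorem forestPairSum_ladderEdges (m : ℕ) :
    forestPairSum (treeWeight m) (twoForestWeight m) ((0, 3) :: ladderEdges m)
      (listLabel [0, 0, 0, 3, 4, 5]) (listLabel [0, 1, 2, 1, 4, 2]) = m := by
  have h1 : IsLabelList 6 [0, 0, 0, 3, 4, 5] := by constructor <;> decide
  have h2 : IsLabelList 6 [0, 1, 2, 1, 4, 2] := by constructor <;> decide
  have hs := edgesStep_spec (classBound_treeWeight m) (classBound_twoForestWeight m)
    [(0, 3)] (ladderEdges m) (l := 6) (by decide) (_, _) h1 h2 (by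
      refine manyClasses_listLabel h1 h2 _ _ ?_
      have h3 : rootCount [0, 0, 0, 3, 4, 5] + rootCount [0, 1, 2, 1, 4, 2] = 8 := by decide
      rw [h3, length_ladderEdges, List.length_singleton]
      omega)
  have := sum_stateSum_ladderStates m 0 (by omega)
  rw [Nat.cast_zero, add_zero] at this
  rw [← this]
  exact hs.1

/-! ### Forest sums as sums over acyclic edge sets -/

theorem SimpleGraph.reachable_sup_edge_iff {V : Type*} (G : SimpleGraph V) {u v : V} (huv : u ≠ v)
    (a b : V) : (G ⊔ edge u v).Reachable a b ↔
      G.Reachable a b ∨ (G.Reachable a u ∧ G.Reachable b v) ∨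
        (G.Reachable a v ∧ G.Reachable b u) := by
  constructor
  · rintro ⟨p⟩
    induction p with
    | nil => exact Or.inl (Reachable.refl _)
    | @cons a c b h p ih =>
      rw [sup_adj, edge_adj] at h
      rcases h with h | ⟨⟨rfl, rfl⟩ | ⟨rfl, rfl⟩, -⟩
      · have := h.reachable
        rcases ih with ih | ih | ih
        · exact Or.inl (this.trans ih)
        · exact Or.inr (Or.inl ⟨this.trans ih.1, ih.2⟩)
        · exact Or.inr (Or.inr ⟨this.trans ih.1, ih.2⟩)
      · rcases ih with ih | ih | ih
        · exact Or.inr (Or.inl ⟨Reachable.refl _, ih.symm⟩)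
        · exact Or.inr (Or.inl ⟨Reachable.refl _, ih.2⟩)
        · exact Or.inl ih.2.symm
      · rcases ih with ih | ih | ih
        · exact Or.inr (Or.inr ⟨Reachable.refl _, ih.symm⟩)
        · exact Or.inl ih.2.symm
        · exact Or.inr (Or.inr ⟨Reachable.refl _, ih.2⟩)
  · have h1 : ∀ {a b}, G.Reachable a b → (G ⊔ edge u v).Reachable a b :=
      fun h => h.mono le_sup_left
    have h2 : (G ⊔ edge u v).Reachable u v :=
      Adj.reachable (by rw [sup_adj, edge_adj]; exact Or.inr ⟨Or.inl ⟨rfl, rfl⟩, huv⟩)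
    rintro (h | h | h)
    · exact h1 h
    · exact (h1 h.1).trans (h2.trans (h1 h.2).symm)
    · exact (h1 h.1).trans (h2.symm.trans (h1 h.2).symm)

/-- The recursive definition of `forestSum` computes the sum over the sets of edges that together
with a given forest are acyclic. -/
theorem sum_powerset_isAcyclic_eq_forestSum {V L : Type*} (φ : (V → V → Prop) → ZMod 2)
    (es : List (V × V)) (hnd : (es.map fun e => s(e.1, e.2)).Nodup) (hne : ∀ e ∈ es, e.1 ≠ e.2)
    (x : Sym2 V → ZMod 2) (S : Set (Sym2 V)) (hS : (fromEdgeSet S).IsAcyclic)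
    (hdisj : ∀ e ∈ es, s(e.1, e.2) ∉ S) (f : V → L)
    (hf : ∀ a b, f a = f b ↔ (fromEdgeSet S).Reachable a b) :
    ∑ T ∈ (es.map fun e => s(e.1, e.2)).toFinset.powerset,
      (if (fromEdgeSet (S ∪ T)).IsAcyclic then φ (fromEdgeSet (S ∪ T)).Reachable else 0) *
        ∏ e ∈ (es.map fun e => s(e.1, e.2)).toFinset \ T, x e =
      forestSum φ es (es.map fun e => x s(e.1, e.2)) f := by
  induction es generalizing S f with
  | nil =>
    simp only [List.map_nil, List.toFinset_nil, Finset.powerset_empty, Finset.sum_singleton,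
      Finset.coe_empty, Set.union_empty, hS, if_true, Finset.empty_sdiff, Finset.prod_empty,
      mul_one, forestSum, hf]
  | cons e es ih =>
    obtain ⟨u, v⟩ := e
    rw [List.map_cons, List.nodup_cons] at hnd
    have he : s(u, v) ∉ (es.map fun e => s(e.1, e.2)).toFinset := by simpa using hnd.1
    have huv : u ≠ v := hne (u, v) List.mem_cons_self
    have heS : s(u, v) ∉ S := hdisj (u, v) List.mem_cons_self
    have hins : ∀ R : Set (Sym2 V), fromEdgeSet (insert s(u, v) R) = fromEdgeSet R ⊔ edge u v := by
      intro R
      rw [Set.insert_eq, Set.union_comm, fromEdgeSet_union]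
      rfl
    have ih' := ih hnd.2 fun e he => hne e (List.mem_cons_of_mem _ he)
    rw [List.map_cons, List.toFinset_cons, Finset.sum_powerset_insert he]
    rw [List.map_cons, forestSum]
    congr 1
    · rw [← ih' S hS (fun e he => hdisj e (List.mem_cons_of_mem _ he)) f hf, Finset.mul_sum]
      refine Finset.sum_congr rfl fun T hT => ?_
      have heT : s(u, v) ∉ T := fun h => he (Finset.mem_powerset.1 hT h)
      rw [Finset.insert_sdiff_of_notMem _ heT, Finset.prod_insert]
      · ring
      · exact fun h => he (Finset.mem_sdiff.1 h).1
    · have hprod : ∀ T ∈ (es.map fun e => s(e.1, e.2)).toFinset.powerset,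
          insert s(u, v) (es.map fun e => s(e.1, e.2)).toFinset \ insert s(u, v) T =
            (es.map fun e => s(e.1, e.2)).toFinset \ T := by
        intro T hT
        rw [Finset.insert_sdiff_insert, Finset.sdiff_insert_of_notMem he]
      split_ifs with h
      · refine Finset.sum_eq_zero fun T hT => ?_
        rw [if_neg, zero_mul]
        intro hac
        have h1 : (fromEdgeSet (insert s(u, v) S)).IsAcyclic := by
          refine hac.anti (fromEdgeSet_mono ?_)
          rw [Finset.coe_insert]
          grind
        rw [hins, isAcyclic_sup_fromEdgeSet_iff] at h1
        rcases h1.2 ((hf u v).1 h) with h2 | h2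
        · exact huv h2
        · exact heS ((fromEdgeSet_adj _).1 h2).1
      · rw [← ih' (insert s(u, v) S) _ _ (mergeLabel f u v)]
        · refine Finset.sum_congr rfl fun T hT => ?_
          rw [hprod T hT, Finset.coe_insert, Set.insert_union, Set.union_insert]
        · intro a b
          rw [mergeLabel_eq_iff, hins, reachable_sup_edge_iff _ huv, hf, hf, hf, hf, hf]
        · rw [hins]
          exact hS.sup_edge_of_not_reachable fun h' => h ((hf u v).2 h')
        · intro e' he' hmem
          rcases Set.mem_insert_iff.1 hmem with h' | h'
          · exact hnd.1 (List.mem_map.2 ⟨e', he', h'⟩)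
          · exact hdisj e' (List.mem_cons_of_mem _ he') h'

theorem sum_ite_mem_sym2 {V : Type*} [Fintype V] {u v : V} (huv : u ≠ v) (g : V → ZMod 2) :
    (∑ w, if w ∈ s(u, v) then g w else 0) = g u + g v := by
  rw [← Finset.sum_filter, ← Finset.sum_pair huv]
  congr 1
  ext w
  simp

/-! ### Rooted forests and the Dodgson identity -/

/-- Two vertices joined by a walk are the boundary of a chain supported on the edges. -/
theorem exists_boundary_eq_of_reachable {V : Type*} [Fintype V] {S : Set (Sym2 V)} {u v : V}
    (h : (fromEdgeSet S).Reachable u v) :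
    ∃ c : Sym2 V → ZMod 2, (∀ e ∉ S, c e = 0) ∧ ∀ w,
      (∑ e, if w ∈ e then c e else 0) = (if w = u then 1 else 0) + if w = v then 1 else 0 := by
  obtain ⟨p⟩ := h
  induction p with
  | nil => exact ⟨0, by simp, fun w => by simp [CharTwo.add_self_eq_zero]⟩
  | @cons u a v h p ih =>
    obtain ⟨c, hc, hw⟩ := ih
    rw [fromEdgeSet_adj] at h
    refine ⟨fun e => (if e = s(u, a) then 1 else 0) + c e, fun e he => ?_, fun w => ?_⟩
    · dsimp only
      rw [hc e he, if_neg, add_zero]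
      rintro rfl
      exact he h.1
    · have h1 : ∀ e, (if w ∈ e then (if e = s(u, a) then (1 : ZMod 2) else 0) + c e else 0) =
          (if e = s(u, a) then (if w ∈ s(u, a) then 1 else 0) else 0) +
            if w ∈ e then c e else 0 := by
        intro e
        by_cases he : e = s(u, a)
        · subst he; split_ifs <;> simp
        · split_ifs <;> simp
      simp only [h1]
      rw [Finset.sum_add_distrib, hw, Finset.sum_ite_eq' Finset.univ, if_pos (Finset.mem_univ _)]
      have h2 : (if w ∈ s(u, a) then (1 : ZMod 2) else 0) =
          (if w = u then 1 else 0) + if w = a then 1 else 0 := by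
        have := h.2
        simp only [Sym2.mem_iff]
        by_cases h1 : w = u
        · subst h1; simp [this]
        · simp [h1]
      rw [h2, add_assoc, ← add_assoc (if w = a then (1 : ZMod 2) else 0),
        CharTwo.add_self_eq_zero, zero_add]

/-- The linear system attached to a set `T` of edges: potentials are constant along the edges and
vanish at the sinks `σ r`, currents are supported on `T` and are preserved off the sources `r`. -/
def IsNetworkSolution {V : Type*} [Fintype V] (T : Finset (Sym2 V)) (R : Finset V) (σ : V → V)
    (c : Sym2 V → ZMod 2) (p : V → ZMod 2) : Prop :=
  (∀ u v, s(u, v) ∈ T → p u = p v) ∧ (∀ e ∉ T, c e = 0) ∧ (∀ r ∈ R, p (σ r) = 0) ∧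
    ∀ w ∉ R, (∑ e, if w ∈ e then c e else 0) = 0

/-- `T` is a forest whose components each contain exactly one source and some sink. -/
def IsRootedForest {V : Type*} (T : Finset (Sym2 V)) (R : Finset V) (σ : V → V) : Prop :=
  (fromEdgeSet (T : Set (Sym2 V))).IsAcyclic ∧
    (∀ w, ∃ r ∈ R, (fromEdgeSet (T : Set (Sym2 V))).Reachable w (σ r)) ∧
    ∀ r ∈ R, ∀ r' ∈ R, (fromEdgeSet (T : Set (Sym2 V))).Reachable r r' → r = r'

theorem IsRootedForest.eq_zero {V : Type*} [Fintype V] {T : Finset (Sym2 V)} {R : Finset V}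
    {σ : V → V} (hT : ∀ e ∈ T, ¬ e.IsDiag) (h : IsRootedForest T R σ) {c : Sym2 V → ZMod 2}
    {p : V → ZMod 2} (hs : IsNetworkSolution T R σ c p) : c = 0 ∧ p = 0 := by
  obtain ⟨hac, hcov, hsep⟩ := h
  obtain ⟨h1, h2, h3, h4⟩ := hs
  constructor
  · funext e
    by_contra he
    have heT : e ∈ T := by
      by_contra h
      exact he (h2 e h)
    have hbr := (isAcyclic_iff_forall_isBridge.1 hac) (e := e)
      (by rw [edgeSet_fromEdgeSet]; exact ⟨heT, hT e heT⟩)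
    induction e with
    | h u v =>
    rw [isBridge_iff] at hbr
    set G' := (fromEdgeSet (T : Set (Sym2 V))).deleteEdges {s(u, v)} with hG'
    have huv : u ≠ v := hT _ heT
    have key : ∀ z, (G'.Reachable z u ↔ ¬ G'.Reachable z v) → ∃ r ∈ R, G'.Reachable z r := by
      intro z hz
      by_contra hR
      push Not at hR
      have e1 : (∑ w, if G'.Reachable z w then (∑ e, if w ∈ e then c e else 0) else 0) = 0 :=
        Finset.sum_eq_zero fun w _ => by
          split_ifs with h
          · exact h4 w fun hw => hR w hw h
          · rfl
      have e2 : (∑ w, if G'.Reachable z w then (∑ e, if w ∈ e then c e else 0) else 0) =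
          ∑ e, ∑ w, if w ∈ e then (if G'.Reachable z w then c e else 0) else 0 := by
        rw [Finset.sum_comm]
        refine Finset.sum_congr rfl fun w _ => ?_
        split_ifs <;> simp
      rw [e2, Finset.sum_eq_single s(u, v)] at e1
      · rw [sum_ite_mem_sym2 huv] at e1
        apply he
        refine Eq.trans ?_ e1
        by_cases h : G'.Reachable z u
        · simp [h, hz.1 h]
        · have : G'.Reachable z v := by tauto
          simp [h, this]
      · intro e _ hne
        by_cases heT' : e ∈ T
        · induction e with
          | h a b =>
          have hab : a ≠ b := hT _ heT'
          rw [sum_ite_mem_sym2 hab]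
          have hadj : G'.Adj a b := by
            rw [hG', deleteEdges_adj, fromEdgeSet_adj]
            exact ⟨⟨heT', hab⟩, hne⟩
          have : G'.Reachable z a ↔ G'.Reachable z b :=
            ⟨fun h => h.trans hadj.reachable, fun h => h.trans hadj.symm.reachable⟩
          simp only [this, CharTwo.add_self_eq_zero]
        · simp [h2 e heT']
      · simp
    obtain ⟨r, hr, hur⟩ := key u (by simp [hbr])
    obtain ⟨r', hr', hvr⟩ := key v (by
      have : ¬ G'.Reachable v u := fun h => hbr h.symm
      simp [this])
    have hle : G' ≤ fromEdgeSet (T : Set (Sym2 V)) := deleteEdges_le _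
    have hadj : (fromEdgeSet (T : Set (Sym2 V))).Adj u v := (fromEdgeSet_adj _).2 ⟨heT, huv⟩
    have : r = r' := hsep r hr r' hr'
      ((hur.mono hle).symm.trans (hadj.reachable.trans (hvr.mono hle)))
    subst this
    exact hbr (hur.trans hvr.symm)
  · funext w
    obtain ⟨r, hr, hwr⟩ := hcov w
    have hconst : ∀ a b, (fromEdgeSet (T : Set (Sym2 V))).Reachable a b → p a = p b := by
      rintro a b ⟨q⟩
      induction q with
      | nil => rfl
      | cons h q ih => rw [← ih]; exact h1 _ _ ((fromEdgeSet_adj _).1 h).1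
    rw [hconst _ _ hwr, h3 r hr]
    rfl

theorem isRootedForest_of_forall_eq_zero {V : Type*} [Fintype V] {T : Finset (Sym2 V)}
    {R : Finset V} {σ : V → V} (hT : ∀ e ∈ T, ¬ e.IsDiag)
    (h : ∀ c p, IsNetworkSolution T R σ c p → c = 0 ∧ p = 0) : IsRootedForest T R σ := by
  refine ⟨?_, ?_, ?_⟩
  · rw [isAcyclic_iff_forall_isBridge]
    intro e he
    rw [edgeSet_fromEdgeSet] at he
    induction e with
    | h u v =>
    have huv : u ≠ v := he.2
    rw [isBridge_iff]
    intro hr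
    have hdel : (fromEdgeSet (T : Set (Sym2 V))).deleteEdges {s(u, v)} =
        fromEdgeSet ((T : Set (Sym2 V)) \ {s(u, v)}) := by
      ext a b
      simp
    rw [hdel] at hr
    obtain ⟨c, hc, hw⟩ := exists_boundary_eq_of_reachable hr
    have huvc : c s(u, v) = 0 := hc _ (by simp)
    have := h (fun e => (if e = s(u, v) then 1 else 0) + c e) 0
      ⟨fun _ _ _ => rfl, fun e he' => ?_, fun _ _ => rfl, fun w _ => ?_⟩
    · have := congrFun this.1 s(u, v)
      simp [huvc] at this
    · dsimp only
      rw [hc e fun h => he' h.1, if_neg, add_zero]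
      rintro rfl
      exact he' he.1
    · have h1 : ∀ e, (if w ∈ e then (if e = s(u, v) then (1 : ZMod 2) else 0) + c e else 0) =
          (if e = s(u, v) then (if w ∈ s(u, v) then 1 else 0) else 0) +
            if w ∈ e then c e else 0 := by
        intro e
        by_cases he : e = s(u, v)
        · subst he; split_ifs <;> simp
        · split_ifs <;> simp
      simp only [h1]
      rw [Finset.sum_add_distrib, hw, Finset.sum_ite_eq' Finset.univ, if_pos (Finset.mem_univ _)]
      simp only [Sym2.mem_iff]
      by_cases h3 : w = u
      · subst h3; simp [huv, CharTwo.add_self_eq_zero]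
      · by_cases h2 : w = v
        · subst h2; simp [h3, CharTwo.add_self_eq_zero]
        · simp [h3, h2]
  · intro w
    by_contra hw
    push Not at hw
    have := h 0 (fun a => if (fromEdgeSet (T : Set (Sym2 V))).Reachable w a then 1 else 0)
      ⟨fun u v huv => ?_, fun _ _ => rfl, fun r hr => if_neg (hw r hr), fun _ _ => by simp⟩
    · have := congrFun this.2 w
      simp at this
    · have hadj : (fromEdgeSet (T : Set (Sym2 V))).Adj u v :=
        (fromEdgeSet_adj _).2 ⟨huv, hT _ huv⟩
      have : (fromEdgeSet (T : Set (Sym2 V))).Reachable w u ↔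
          (fromEdgeSet (T : Set (Sym2 V))).Reachable w v :=
        ⟨fun h => h.trans hadj.reachable, fun h => h.trans hadj.symm.reachable⟩
      simp only [this]
  · intro r hr r' hr' hrr
    by_contra hne
    obtain ⟨c, hc, hw⟩ := exists_boundary_eq_of_reachable hrr
    have := h c 0 ⟨fun _ _ _ => rfl, hc, fun _ _ => rfl, fun w hwR => ?_⟩
    · have h1 := hw r
      simp [this.1, hne] at h1
    · rw [hw, if_neg, if_neg, add_zero]
      · rintro rfl; exact hwR hr'
      · rintro rfl; exact hwR hr

/-- The adjugate of a singular matrix has rank at most one. -/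
theorem Matrix.adjugate_mul_adjugate_of_det_eq_zero {ι K : Type*} [Fintype ι] [DecidableEq ι]
    [Field K]
    (A : Matrix ι ι K) (hA : A.det = 0) (a b : ι) :
    A.adjugate a a * A.adjugate b b = A.adjugate a b * A.adjugate b a := by
  set w : ι → K := fun k => A.adjugate a b * A.adjugate k a - A.adjugate a a * A.adjugate k b
    with hw
  have hker : A.mulVec w = 0 := by
    have h : ∀ j, A.mulVec (fun k => A.adjugate k j) = 0 := fun j => by
      funext i
      have := congrFun (congrFun A.mul_adjugate i) j
      rw [hA, zero_smul] at this
      exact this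
    have : w = A.adjugate a b • (fun k => A.adjugate k a) -
        A.adjugate a a • (fun k => A.adjugate k b) := rfl
    rw [this, Matrix.mulVec_sub, Matrix.mulVec_smul, Matrix.mulVec_smul, h, h, smul_zero,
      smul_zero, sub_zero]
  have key : ∀ i, A.adjugate a i ≠ 0 → w = 0 := by
    intro i hi
    rw [Matrix.adjugate_apply] at hi
    refine Matrix.eq_zero_of_mulVec_eq_zero hi ?_
    funext k
    by_cases hk : k = i
    · subst hk
      simp [Matrix.mulVec, Matrix.updateRow_self, hw, mul_comm]
    · have := congrFun hker k
      simpa [Matrix.mulVec, Matrix.updateRow_ne hk] using this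
  by_cases h1 : A.adjugate a a = 0
  · by_cases h2 : A.adjugate a b = 0
    · simp [h1, h2]
    · have := congrFun (key b h2) b
      exact (sub_eq_zero.1 this).symm
  · have := congrFun (key a h1) b
    exact (sub_eq_zero.1 this).symm

/-- The rows of the matrices counting rooted forests that correspond to edges. -/
noncomputable def edgeRow {V : Type*} (F : Finset (Sym2 V)) (Q : Finset V) (e : Sym2 V) :
    Sym2 V ⊕ V → ZMod 2 :=
  Sum.elim 0 fun w => if e ∈ F ∧ w ∈ e ∧ w ∉ Q then 1 else 0

/-- The rows of the matrices counting rooted forests that correspond to vertices. -/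
noncomputable def vertexRow {V : Type*} (F : Finset (Sym2 V)) (R : Finset V) (σ : V → V) (w : V) :
    Sym2 V ⊕ V → ZMod 2 :=
  if w ∈ R then Pi.single (Sum.inr (σ w)) 1
  else Sum.elim (fun e => if e ∈ F ∧ w ∈ e then 1 else 0) 0

theorem det_forest_eq {V : Type*} [Fintype V] {F T : Finset (Sym2 V)} (hF : ∀ e ∈ F, ¬ e.IsDiag)
    (hT : T ⊆ F) {Q R : Finset V} (hQ : Q ⊆ R) {σ : V → V} (hσ : ∀ w ∈ Q, σ w = w) :
    (Matrix.of (Sum.elim (fun e => if e ∈ T then edgeRow F Q e else Pi.single (Sum.inl e) 1)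
      (vertexRow F R σ))).det = if IsRootedForest T R σ then 1 else 0 := by
  set A := Matrix.of (Sum.elim (fun e => if e ∈ T then edgeRow F Q e else Pi.single (Sum.inl e) 1)
      (vertexRow F R σ)) with hA
  have hker : ∀ (c : Sym2 V → ZMod 2) (p : V → ZMod 2), A.mulVec (Sum.elim c p) = 0 ↔
      IsNetworkSolution T R σ c p := by
    intro c p
    have h1 : ∀ e ∉ T, A.mulVec (Sum.elim c p) (Sum.inl e) = c e := fun e he => by
      simp [hA, Matrix.mulVec, he]
    have h2 : ∀ r ∈ R, A.mulVec (Sum.elim c p) (Sum.inr r) = p (σ r) := fun r hr => by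
      simp [hA, Matrix.mulVec, vertexRow, hr]
    have h3 : (∀ e ∉ T, c e = 0) → ∀ w ∉ R, A.mulVec (Sum.elim c p) (Sum.inr w) =
        ∑ e, if w ∈ e then c e else 0 := fun hc w hw => by
      simp only [hA, Matrix.mulVec, vertexRow, dotProduct, Matrix.of_apply, Sum.elim_inr, hw,
        if_false, Fintype.sum_sum_type, Sum.elim_inl, Pi.zero_apply, zero_mul,
        Finset.sum_const_zero, add_zero]
      refine Finset.sum_congr rfl fun e _ => ?_
      by_cases he : e ∈ T
      · simp [hT he]
      · simp [hc e he]
    have h4 : (∀ r ∈ R, p (σ r) = 0) → ∀ u v, s(u, v) ∈ T →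
        A.mulVec (Sum.elim c p) (Sum.inl s(u, v)) = p u + p v := fun hp u v he => by
      have huv : u ≠ v := hF _ (hT he)
      rw [← sum_ite_mem_sym2 huv]
      simp only [hA, Matrix.mulVec, dotProduct, Matrix.of_apply, Sum.elim_inl, he, if_true,
        Fintype.sum_sum_type, edgeRow, Pi.zero_apply, zero_mul, Sum.elim_inr,
        Finset.sum_const_zero, zero_add, hT he, true_and]
      refine Finset.sum_congr rfl fun w _ => ?_
      by_cases hw : w ∈ Q
      · have : p w = 0 := by simpa [hσ w hw] using hp w (hQ hw)
        simp [this]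
      · simp [hw]
    constructor
    · intro h
      have hc : ∀ e ∉ T, c e = 0 := fun e he => by rw [← h1 e he, h]; rfl
      have hp : ∀ r ∈ R, p (σ r) = 0 := fun r hr => by rw [← h2 r hr, h]; rfl
      refine ⟨fun u v he => ?_, hc, hp, fun w hw => by rw [← h3 hc w hw, h]; rfl⟩
      have := h4 hp u v he
      rw [h] at this
      exact CharTwo.add_eq_zero.1 this.symm
    · rintro ⟨k1, k2, k3, k4⟩
      funext i
      rcases i with e | w
      · by_cases he : e ∈ T
        · induction e with
          | h u v => rw [h4 k3 u v he, k1 u v he, CharTwo.add_self_eq_zero]; rfl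
        · rw [h1 e he, k2 e he]; rfl
      · by_cases hw : w ∈ R
        · rw [h2 w hw, k3 w hw]; rfl
        · rw [h3 k2 w hw, k4 w hw]; rfl
  have h01 : ∀ z : ZMod 2, z ≠ 0 → z = 1 := by decide
  split_ifs with h
  · refine h01 _ fun h0 => ?_
    obtain ⟨z, hz, hz0⟩ := Matrix.exists_mulVec_eq_zero_iff.2 h0
    rw [← Sum.elim_comp_inl_inr z] at hz hz0
    obtain ⟨k1, k2⟩ := h.eq_zero (fun e he => hF e (hT he)) ((hker _ _).1 hz0)
    rw [k1, k2] at hz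
    exact hz (by funext i; rcases i with e | w <;> rfl)
  · by_contra h0
    refine h (isRootedForest_of_forall_eq_zero (fun e he => hF e (hT he)) fun c p hs => ?_)
    have := Matrix.eq_zero_of_mulVec_eq_zero h0 ((hker c p).2 hs)
    exact ⟨funext fun e => congrFun this (Sum.inl e), funext fun w => congrFun this (Sum.inr w)⟩

/-- The sum over the rooted forests in `F` of the product of the weights outside the forest. -/
noncomputable def rootedForestSum {V : Type*} [Fintype V] (F : Finset (Sym2 V))
    (x : Sym2 V → ZMod 2) (R : Finset V) (σ : V → V) : ZMod 2 :=
  ∑ T ∈ F.powerset, (if IsRootedForest T R σ then 1 else 0) * ∏ e ∈ F \ T, x e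

/-- An expanded Laplacian whose determinant is a sum over rooted forests. -/
noncomputable def networkMatrix {V : Type*} (F : Finset (Sym2 V))
    (x : Sym2 V → ZMod 2) (Q R : Finset V) (σ : V → V) :
    Matrix (Sym2 V ⊕ V) (Sym2 V ⊕ V) (ZMod 2) :=
  Matrix.of (Sum.elim
    (edgeRow F Q + fun e => (if e ∈ F then x e else 1) • Pi.single (Sum.inl e) 1)
    (vertexRow F R σ))

theorem det_networkMatrix {V : Type*} [Fintype V] {F : Finset (Sym2 V)}
    (hF : ∀ e ∈ F, ¬ e.IsDiag) (x : Sym2 V → ZMod 2) {Q R : Finset V} (hQ : Q ⊆ R) {σ : V → V}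
    (hσ : ∀ w ∈ Q, σ w = w) : (networkMatrix F x Q R σ).det = rootedForestSum F x R σ := by
  set D : MultilinearMap (ZMod 2) (fun _ : Sym2 V ⊕ V => Sym2 V ⊕ V → ZMod 2) (ZMod 2) :=
    Matrix.detRowAlternating.toMultilinearMap with hD
  have hdet : ∀ f : Sym2 V → Sym2 V ⊕ V → ZMod 2,
      (Matrix.of (Sum.elim f (vertexRow F R σ))).det = D.currySum f (vertexRow F R σ) := by
    intro f
    rw [MultilinearMap.currySum_apply]
    rfl
  rw [networkMatrix, hdet, MultilinearMap.map_add_univ, _root_.sum_apply, rootedForestSum,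
    ← Finset.sum_subset (Finset.subset_univ F.powerset)]
  · refine Finset.sum_congr rfl fun T hT => ?_
    rw [Finset.mem_powerset] at hT
    rw [← det_forest_eq hF hT hQ hσ, hdet]
    set m : Sym2 V → Sym2 V ⊕ V → ZMod 2 :=
      fun e => if e ∈ T then edgeRow F Q e else Pi.single (Sum.inl e) 1 with hm
    have h1 : (T.piecewise (edgeRow F Q)
        fun e => (if e ∈ F then x e else 1) • Pi.single (Sum.inl e) (1 : ZMod 2)) =
        Tᶜ.piecewise (fun e => (if e ∈ F then x e else 1) • m e) m := by
      funext e
      by_cases he : e ∈ T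
      · rw [Finset.piecewise_eq_of_mem _ _ _ he, Finset.piecewise_eq_of_notMem _ _ _ (by simpa)]
        simp [hm, he]
      · rw [Finset.piecewise_eq_of_notMem _ _ _ he, Finset.piecewise_eq_of_mem _ _ _ (by simpa)]
        simp [hm, he]
    rw [h1, MultilinearMap.map_piecewise_smul, _root_.smul_apply, smul_eq_mul, mul_comm,
      Finset.prod_ite_mem]
    congr 2
    ext e
    simp [and_comm]
  · intro T _ hT
    rw [Finset.mem_powerset, Finset.not_subset] at hT
    obtain ⟨e, he, heF⟩ := hT
    rw [← hdet]
    refine Matrix.det_eq_zero_of_row_eq_zero (Sum.inl e) fun i => ?_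
    rcases i with e' | w <;> simp [he, edgeRow, heF]

theorem networkMatrix_transpose {V : Type*} (F : Finset (Sym2 V)) (x : Sym2 V → ZMod 2)
    (Q : Finset V) : (networkMatrix F x Q Q id).transpose = networkMatrix F x Q Q id := by
  ext i j
  rcases i with e | w <;> rcases j with e' | w' <;>
    simp only [networkMatrix, Matrix.transpose_apply, Matrix.of_apply, Sum.elim_inl,
      Sum.elim_inr, Pi.add_apply, edgeRow, vertexRow, Pi.zero_apply, zero_add, Pi.smul_apply,
      smul_eq_mul, id]
  · by_cases h : e = e'
    · subst h; rfl
    · simp [h, Ne.symm h]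
  · by_cases h : w' ∈ Q <;> simp [h]
  · by_cases h : w ∈ Q <;> simp [h]
  · by_cases h : w ∈ Q <;> by_cases h' : w' ∈ Q
    · by_cases hh : w = w'
      · subst hh; rfl
      · simp [h, h', hh, Ne.symm hh]
    · have : w ≠ w' := fun hh => h' (hh ▸ h)
      simp [h, h', this.symm]
    · have : w ≠ w' := fun hh => h (hh ▸ h')
      simp [h, h', this]
    · simp [h, h']

/-- The Dodgson identity for rooted forests: without rooted forests for the roots `Q`, the sum
over pairs of forests rooted at one more vertex is a square. -/
theorem rootedForestSum_mul_rootedForestSum {V : Type*} [Fintype V] {F : Finset (Sym2 V)}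
    (hF : ∀ e ∈ F, ¬ e.IsDiag) (x : Sym2 V → ZMod 2) {Q : Finset V} {a b : V} (ha : a ∉ Q)
    (hb : b ∉ Q) (h0 : rootedForestSum F x Q id = 0) :
    rootedForestSum F x (insert a Q) id * rootedForestSum F x (insert b Q) id =
      rootedForestSum F x (insert a Q) (Function.update id a b) := by
  set M := networkMatrix F x Q Q id with hM
  have hdet : M.det = 0 := by
    rw [hM, det_networkMatrix hF x subset_rfl (σ := id) fun _ _ => rfl, h0]
  have hsymm : M.transpose = M := networkMatrix_transpose F x Q
  have hadj : ∀ i j, j ∉ Q → M.adjugate (Sum.inr i) (Sum.inr j) =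
      rootedForestSum F x (insert j Q) (Function.update id j i) := by
    intro i j hj
    rw [Matrix.adjugate_apply, ← det_networkMatrix hF x (Finset.subset_insert j Q) fun w hw =>
      Function.update_of_ne (fun h : w = j => hj (h ▸ hw)) i id]
    congr 1
    ext k l
    rcases k with e | w
    · simp [hM, networkMatrix, Matrix.updateRow_apply]
    · by_cases hw : w = j
      · subst hw
        simp [networkMatrix, vertexRow]
      · simp [hM, networkMatrix, Matrix.updateRow_apply, vertexRow, hw]
  have hsq : ∀ z : ZMod 2, z * z = z := by decide
  have hid : ∀ j, Function.update (id : V → V) j j = id := fun j => Function.update_eq_self j id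
  have hab : M.adjugate (Sum.inr a) (Sum.inr b) = M.adjugate (Sum.inr b) (Sum.inr a) := by
    have := congrFun (congrFun M.adjugate_transpose (Sum.inr b)) (Sum.inr a)
    rwa [hsymm] at this
  have := M.adjugate_mul_adjugate_of_det_eq_zero hdet (Sum.inr a) (Sum.inr b)
  rw [hab, hsq, hadj a a ha, hadj b b hb, hadj b a ha, hid, hid] at this
  exact this

/-! ### A vertex of degree three -/

/-- The indicator of the partitions with `R` as a transversal all of whose classes meet `σ R`. -/
noncomputable def rootWeight {V : Type*} (R : Finset V) (σ : V → V) (r : V → V → Prop) : ZMod 2 :=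
  if (∀ w, ∃ z ∈ R, r w (σ z)) ∧ ∀ z ∈ R, ∀ z' ∈ R, r z z' → z = z' then 1 else 0

/-- The indicator of the partition with a single class. -/
noncomputable def connWeight {V : Type*} (r : V → V → Prop) : ZMod 2 :=
  if ∀ w w', r w w' then 1 else 0

/-- The indicator of the partitions with a single class away from `v`. -/
noncomputable def connOffWeight {V : Type*} (v c : V) (r : V → V → Prop) : ZMod 2 :=
  if ∀ w, w ≠ v → r w c then 1 else 0

/-- The indicator of the partitions with two classes away from `v`, separating `a` from `b, c`. -/
noncomputable def splitOffWeight {V : Type*} (v a b c : V) (r : V → V → Prop) : ZMod 2 :=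
  if (∀ w, w ≠ v → r w a ∨ r w b) ∧ ¬ r a b ∧ r b c then 1 else 0

theorem rootWeight_pair {V L : Type*} {v c : V} (hc : c ≠ v) (f : V → L)
    (hf : ∀ w, f w = f v ↔ w = v) :
    rootWeight {c, v} id (fun a b => f a = f b) = connOffWeight v c (fun a b => f a = f b) := by
  have hf' : ∀ w, f v = f w ↔ w = v := fun w => by rw [eq_comm, hf]
  simp only [rootWeight, connOffWeight, Finset.mem_insert, Finset.mem_singleton, forall_eq_or_imp,
    exists_eq_or_imp, forall_eq, exists_eq_left, id, hf, hf', hc]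
  congr 1
  simp only [or_iff_not_imp_right, eq_iff_iff]
  tauto

theorem rootWeight_triple {V L : Type*} {v a b c : V} (ha : a ≠ v) (hb : b ≠ v) (hc : c ≠ v)
    (hac : a ≠ c) (f : V → L) (hf : ∀ w, f w = f v ↔ w = v) :
    rootWeight {a, c, v} id (fun a b => f a = f b) =
      splitOffWeight v a b c (fun a b => f a = f b) +
      splitOffWeight v c a b (fun a b => f a = f b) := by
  have hf' : ∀ w, f v = f w ↔ w = v := fun w => by rw [eq_comm, hf]
  simp only [rootWeight, splitOffWeight, Finset.mem_insert, Finset.mem_singleton, forall_eq_or_imp,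
    exists_eq_or_imp, forall_eq, exists_eq_left, id, hf, hf', hc, ha, hac]
  have h2 : (1 : ZMod 2) + 1 = 0 := rfl
  grind

theorem rootWeight_triple_update {V L : Type*} {v a b c : V} (ha : a ≠ v) (hc : c ≠ v)
    (hac : a ≠ c) (f : V → L) (hf : ∀ w, f w = f v ↔ w = v) :
    rootWeight {a, c, v} (Function.update id a b) (fun a b => f a = f b) =
      splitOffWeight v c a b (fun a b => f a = f b) := by
  have hf' : ∀ w, f v = f w ↔ w = v := fun w => by rw [eq_comm, hf]
  simp only [rootWeight, splitOffWeight, Finset.mem_insert, Finset.mem_singleton, forall_eq_or_imp,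
    exists_eq_or_imp, forall_eq, exists_eq_left, id, hf, hf', hc, ha, hac, ha.symm, hac.symm,
    Function.update_apply, if_false]
  congr 1
  grind

theorem rootedForestSum_eq_forestSum {V : Type*} [Fintype V] (es : List (V × V))
    (hnd : (es.map fun e => s(e.1, e.2)).Nodup) (hne : ∀ e ∈ es, e.1 ≠ e.2)
    (x : Sym2 V → ZMod 2) (R : Finset V) (σ : V → V) :
    rootedForestSum (es.map fun e => s(e.1, e.2)).toFinset x R σ =
      forestSum (rootWeight R σ) es (es.map fun e => x s(e.1, e.2)) id := by
  rw [← sum_powerset_isAcyclic_eq_forestSum _ es hnd hne x ∅ (by simp) (by simp) id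
    (by simp), rootedForestSum]
  refine Finset.sum_congr rfl fun T _ => ?_
  rw [Set.empty_union]
  by_cases h : (fromEdgeSet (T : Set (Sym2 V))).IsAcyclic <;> simp [IsRootedForest, rootWeight, h]

theorem mergeLabel_isolated {V L : Type*} {v : V} {es : List (V × V)}
    (hv : ∀ e ∈ es, e.1 ≠ v ∧ e.2 ≠ v) (f : V → L) (hf : ∀ w, f w = f v → w = v)
    (e : V × V) (he : e ∈ es) (w : V)
    (h : mergeLabel f e.1 e.2 w = mergeLabel f e.1 e.2 v) : w = v := by
  rw [mergeLabel_eq_iff] at h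
  rcases h with h | h | h
  · exact hf _ h
  · exact absurd (hf _ h.2.symm) (hv e he).2
  · exact absurd (hf _ h.2.symm) (hv e he).1

theorem exists_map_eq_of_nodup {α β : Type*} [Inhabited β] {l : List α} (hl : l.Nodup)
    (ys : List β) (h : ys.length = l.length) : ∃ x : α → β, l.map x = ys := by
  induction l generalizing ys with
  | nil => exact ⟨fun _ => default, (List.length_eq_zero_iff.1 h).symm⟩
  | cons a l ih =>
    cases ys with
    | nil => simp at h
    | cons y ys =>
      rw [List.nodup_cons] at hl
      obtain ⟨x, hx⟩ := ih hl.2 ys (by simpa using h)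
      refine ⟨Function.update x a y, ?_⟩
      rw [List.map_cons, Function.update_self, ← hx]
      congr 1
      exact List.map_congr_left fun z hz =>
        Function.update_of_ne (fun hza : z = a => hl.1 (hza ▸ hz)) _ _

theorem forestSum_splitOffWeight_mul {V : Type*} [Fintype V] {v a b c : V}
    (hd : [v, a, b, c].Nodup) (es : List (V × V)) (hv : ∀ e ∈ es, e.1 ≠ v ∧ e.2 ≠ v)
    (hnd : (es.map fun e => s(e.1, e.2)).Nodup) (hne : ∀ e ∈ es, e.1 ≠ e.2) (ys : List (ZMod 2))
    (hys : ys.length = es.length) (h0 : forestSum (connOffWeight v c) es ys id = 0) :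
    (forestSum (splitOffWeight v a b c) es ys id + forestSum (splitOffWeight v c a b) es ys id) *
      (forestSum (splitOffWeight v b a c) es ys id + forestSum (splitOffWeight v c a b) es ys id) =
      forestSum (splitOffWeight v c a b) es ys id := by
  obtain ⟨⟨hva, hvb, hvc⟩, ⟨hab, hac⟩, hbc⟩ :
      (v ≠ a ∧ v ≠ b ∧ v ≠ c) ∧ (a ≠ b ∧ a ≠ c) ∧ b ≠ c := by simpa using hd
  obtain ⟨x, hx⟩ := exists_map_eq_of_nodup hnd ys (by simpa using hys)
  rw [List.map_map] at hx
  replace hx : (es.map fun e => x s(e.1, e.2)) = ys := hx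
  have hF : ∀ e ∈ (es.map fun e => s(e.1, e.2)).toFinset, ¬ e.IsDiag := by
    intro e he
    rw [List.mem_toFinset, List.mem_map] at he
    obtain ⟨e, he, rfl⟩ := he
    simpa using hne e he
  have key := rootedForestSum_mul_rootedForestSum hF x (Q := {c, v}) (a := a) (b := b)
    (by simp [hac, hva.symm]) (by simp [hbc, hvb.symm])
  simp only [rootedForestSum_eq_forestSum es hnd hne, hx] at key
  have conv : ∀ φ ψ : (V → V → Prop) → ZMod 2, (∀ f : V → V, (∀ w, f w = f v ↔ w = v) →
      φ (fun a b => f a = f b) = ψ (fun a b => f a = f b)) →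
      forestSum φ es ys id = forestSum ψ es ys id := fun φ ψ h =>
    forestSum_congr_of_invariant φ ψ _ (fun f hf => h f fun w => ⟨hf w, fun h => h ▸ rfl⟩) es
      (fun f hf e he => mergeLabel_isolated hv f hf e he) ys id (by simp)
  have e0 : forestSum (rootWeight {c, v} id) es ys id = forestSum (connOffWeight v c) es ys id :=
    conv _ _ (rootWeight_pair hvc.symm)
  have e1 : forestSum (rootWeight {a, c, v} id) es ys id =
      forestSum (splitOffWeight v a b c) es ys id +
      forestSum (splitOffWeight v c a b) es ys id := by
    rw [← forestSum_add]
    exact conv _ _ (rootWeight_triple hva.symm hvb.symm hvc.symm hac)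
  have e2 : forestSum (rootWeight {b, c, v} id) es ys id =
      forestSum (splitOffWeight v b a c) es ys id +
      forestSum (splitOffWeight v c a b) es ys id := by
    rw [← forestSum_add]
    refine conv _ _ fun f hf => ?_
    rw [rootWeight_triple hvb.symm hva.symm hvc.symm hbc f hf]
    simp only [splitOffWeight, Pi.add_apply]
    congr 2
    grind
  have e3 : forestSum (rootWeight {a, c, v} (Function.update id a b)) es ys id =
      forestSum (splitOffWeight v c a b) es ys id :=
    conv _ _ (rootWeight_triple_update hva.symm hvc.symm hac)
  rw [e0, e1, e2, e3] at key
  exact key h0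

/-- The indicator of the partitions with three classes away from `v`, separating `a`, `b`, `c`. -/
noncomputable def splitOffThreeWeight {V : Type*} (v a b c : V) (r : V → V → Prop) : ZMod 2 :=
  if (∀ w, w ≠ v → r w a ∨ r w b ∨ r w c) ∧ ¬ r a b ∧ ¬ r a c ∧ ¬ r b c then 1 else 0

theorem forestSum_star {V L : Type*} {v a b c : V} (hd : [v, a, b, c].Nodup) (α β γ : ZMod 2)
    (f : V → L) (hf : ∀ w, f w = f v ↔ w = v) :
    forestSum connWeight [(v, a), (v, b), (v, c)] [α, β, γ] f =
      (α * β + α * γ + β * γ) * connOffWeight v c (fun a b => f a = f b) +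
      (β + γ) * splitOffWeight v a b c (fun a b => f a = f b) +
      (α + γ) * splitOffWeight v b a c (fun a b => f a = f b) +
      (α + β) * splitOffWeight v c a b (fun a b => f a = f b) +
      splitOffThreeWeight v a b c (fun a b => f a = f b) := by
  obtain ⟨⟨hva, hvb, hvc⟩, ⟨hab, hac⟩, hbc⟩ :
      (v ≠ a ∧ v ≠ b ∧ v ≠ c) ∧ (a ≠ b ∧ a ≠ c) ∧ b ≠ c := by simpa using hd
  have hf' : ∀ w, f v = f w ↔ w = v := fun w => by rw [eq_comm, hf]
  have hconn : ∀ g : V → L, connWeight (fun a b => g a = g b) =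
      if ∀ w, g w = g v then 1 else 0 := by
    intro g
    rw [connWeight]
    congr 1
    exact propext ⟨fun h w => h w v, fun h w w' => (h w).trans (h w').symm⟩
  have h0 : connWeight (fun x y => f x = f y) = 0 := by
    rw [hconn, if_neg]
    intro h
    exact hva.symm ((hf a).1 (h a))
  have h1 : ∀ u, connWeight (fun x y => mergeLabel f v u x = mergeLabel f v u y) =
      if ∀ w, w ≠ v → f w = f u then 1 else 0 := by
    intro u
    rw [hconn]
    congr 1
    simp only [mergeLabel_eq_iff, hf, hf']
    grind
  have h2 : ∀ u u', connWeight (fun x y => mergeLabel (mergeLabel f v u) v u' x =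
      mergeLabel (mergeLabel f v u) v u' y) =
      if ∀ w, w ≠ v → f w = f u ∨ f w = f u' then 1 else 0 := by
    intro u u'
    rw [hconn]
    congr 1
    simp only [mergeLabel_eq_iff, hf, hf']
    grind
  have h3 : ∀ u u' u'', connWeight (fun x y =>
      mergeLabel (mergeLabel (mergeLabel f v u) v u') v u'' x =
      mergeLabel (mergeLabel (mergeLabel f v u) v u') v u'' y) =
      if ∀ w, w ≠ v → f w = f u ∨ f w = f u' ∨ f w = f u'' then 1 else 0 := by
    intro u u' u''
    rw [hconn]
    congr 1
    simp only [mergeLabel_eq_iff, hf, hf']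
    grind
  have s1 : f b = f a ↔ f a = f b := eq_comm
  have s2 : f c = f a ↔ f a = f c := eq_comm
  have s3 : f c = f b ↔ f b = f c := eq_comm
  simp only [forestSum, h0, h1, h2, h3]
  simp only [mergeLabel_eq_iff, s1, s2, s3, hf, hf', hva.symm, hvb.symm, hvc.symm, connOffWeight,
    splitOffWeight,
    splitOffThreeWeight]
  have n1 : ∀ {u u'}, u' ≠ v → f u' ≠ f u → ¬ ∀ w, w ≠ v → f w = f u :=
    fun hu h h' => h (h' _ hu)
  have n2 : ∀ {u u' u''}, u'' ≠ v → f u'' ≠ f u → f u'' ≠ f u' →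
      ¬ ∀ w, w ≠ v → f w = f u ∨ f w = f u' := fun hu h h' h'' => (h'' _ hu).elim h h'
  have o : ∀ u u', (∀ w, w ≠ v → f w = f u ∨ f w = f u') ↔
      ∀ w, w ≠ v → f w = f u' ∨ f w = f u := fun u u' => by simp only [or_comm]
  rw [o b a, o c a]
  by_cases k1 : f a = f b
  · by_cases k3 : f b = f c
    · simp [k1, k3]
      split_ifs <;> ring1
    · simp [k1, k3, n1 hvc.symm (Ne.symm k3), n1 hvb.symm k3]
      split_ifs <;> ring1
  · by_cases k2 : f a = f c
    · have k3 : ¬ f b = f c := fun h => k1 (k2.trans h.symm)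
      simp [k2, k3, s3, o c b, n1 hvc.symm (Ne.symm k3), n1 hvb.symm k3]
      split_ifs <;> ring1
    · by_cases k3 : f b = f c
      · simp [k2, k3, n1 hvc.symm (Ne.symm k2), n1 hva.symm k2]
        split_ifs <;> ring1
      · simp [k1, k2, k3, n1 hvc.symm (Ne.symm k3), n1 hvb.symm k3, n1 hvb.symm (Ne.symm k1),
          n2 hvb.symm (Ne.symm k1) k3, n2 hvc.symm (Ne.symm k2) (Ne.symm k3), n2 hva.symm k1 k2]

/-- Multiplication by four, from `ℤ/2` to `ℤ/8`. -/
def fourMul : ZMod 2 →+ ZMod 8 where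
  toFun z := 4 * z.val
  map_zero' := by decide
  map_add' := by decide

theorem fourMul_natCast (n : ℕ) : fourMul n = 4 * n := by
  induction n with
  | zero => simp
  | succ n ih =>
    have h1 : fourMul 1 = 4 := rfl
    rw [Nat.cast_succ, map_add, ih, h1]
    push_cast
    ring

theorem forestSum_append_star {V : Type*} {v a b c : V} (hd : [v, a, b, c].Nodup)
    (es : List (V × V)) (hv : ∀ e ∈ es, e.1 ≠ v ∧ e.2 ≠ v) (ys : List (ZMod 2))
    (hys : ys.length = es.length) (α β γ : ZMod 2) :
    forestSum connWeight (es ++ [(v, a), (v, b), (v, c)]) (ys ++ [α, β, γ]) id =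
      (α * β + α * γ + β * γ) * forestSum (connOffWeight v c) es ys id +
      (β + γ) * forestSum (splitOffWeight v a b c) es ys id +
      (α + γ) * forestSum (splitOffWeight v b a c) es ys id +
      (α + β) * forestSum (splitOffWeight v c a b) es ys id +
      forestSum (splitOffThreeWeight v a b c) es ys id := by
  rw [forestSum_append _ _ _ _ _ hys]
  simp only [← forestSum_smul, ← forestSum_add]
  refine forestSum_congr_of_invariant _ _ (fun f : V → V => ∀ w, f w = f v → w = v) ?_ es
    (fun f hf e he => mergeLabel_isolated hv f hf e he) ys id (by simp)
  intro f hf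
  have h : ∀ w, f w = f v ↔ w = v := fun w => ⟨hf w, fun h => h ▸ rfl⟩
  rw [forestSum_congr_label connWeight _ [α, β, γ] (fun a b => f a = f b) f ?_,
    forestSum_star hd α β γ f h]
  · rfl
  · intro a b
    simp only [funext_iff, eq_iff_iff]
    exact ⟨fun h => (h b).2 rfl, fun h c => by rw [h]⟩

/-- The number of zeros of the polynomial on the right of `forestSum_append_star`. -/
theorem cubeSum_star_eq_zero : ∀ f₀ f₁ f₂ f₃ g : ZMod 2,
    (f₀ = 0 → (f₁ + f₃) * (f₂ + f₃) = f₃) →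
    ∑ z : Fin 3 → ZMod 2, (if (z 0 * z 1 + z 0 * z 2 + z 1 * z 2) * f₀ + (z 1 + z 2) * f₁ +
      (z 0 + z 2) * f₂ + (z 0 + z 1) * f₃ + g = 0 then (1 : ZMod 8) else 0) =
      fourMul (f₀ + (f₁ + f₂ + f₃) + f₀ * (f₁ + f₂ + f₃)) := by
  decide +kernel

/-- The number of zeros modulo eight of the Kirchhoff polynomial of a graph with a vertex `v` of
degree three, listing the edges at `v` last. -/
theorem cubeSum_forestSum_eq_zero {V : Type*} [Fintype V] {v a b c : V} (hd : [v, a, b, c].Nodup)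
    (es : List (V × V)) (hv : ∀ e ∈ es, e.1 ≠ v ∧ e.2 ≠ v)
    (hnd : (es.map fun e => s(e.1, e.2)).Nodup) (hne : ∀ e ∈ es, e.1 ≠ e.2)
    (hc : ∃ w, w ≠ v ∧ w ≠ a ∧ w ≠ b ∧ w ≠ c) :
    cubeSum (es.length + 3) (fun ys =>
      if forestSum connWeight (es ++ [(v, a), (v, b), (v, c)]) ys id = 0 then (1 : ZMod 8) else 0) =
    fourMul (forestPairSum (connOffWeight v c)
      (splitOffWeight v a b c + splitOffWeight v b a c + splitOffWeight v c a b) es id id) := by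
  obtain ⟨w, hwv, hwa, hwb, hwc⟩ := hc
  have h3 : ∀ g : List (ZMod 2) → ZMod 8, cubeSum 3 g = ∑ z : Fin 3 → ZMod 2, g [z 0, z 1, z 2] :=
    fun g => by rw [cubeSum_ofFn]; simp [List.ofFn_succ]
  have hφ : ∀ φ : (V → V → Prop) → ZMod 2, φ (fun a b => a = b) = 0 →
      cubeSum es.length (fun ys => forestSum φ es ys id) = 0 := fun φ h => by
    rw [cubeSum_forestSum]; exact h
  have h0 : connOffWeight v c (fun a b => a = b) = 0 := if_neg fun h => hwc (h w hwv)
  have hs : ∀ a b c, w ≠ a → w ≠ b → splitOffWeight v a b c (fun a b => a = b) = 0 :=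
    fun a b c ha hb => if_neg fun h => (h.1 w hwv).elim ha hb
  rw [cubeSum_append, cubeSum_congr _ _ (fun ys => fourMul (
      forestSum (connOffWeight v c) es ys id +
      forestSum (splitOffWeight v a b c + splitOffWeight v b a c + splitOffWeight v c a b)
        es ys id +
      forestSum (connOffWeight v c) es ys id * forestSum
        (splitOffWeight v a b c + splitOffWeight v b a c + splitOffWeight v c a b) es ys id)),
    ← map_cubeSum, cubeSum_add, cubeSum_add, hφ _ h0, hφ, zero_add, zero_add, forestPairSum]
  · simp [hs, hwa, hwb, hwc]
  · intro ys hys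
    simp only [h3, forestSum_append_star hd es hv ys hys, forestSum_add]
    exact cubeSum_star_eq_zero _ _ _ _ _
      (forestSum_splitOffWeight_mul hd es hv hnd hne ys hys)

/-! ### The Kirchhoff polynomial as a forest sum -/

theorem eval_kirchhoff_eq_forestSum {V : Type} [Fintype V] [Nonempty V] (G : SimpleGraph V)
    (es : List (V × V)) (hG : ∀ z, z ∈ G.edgeSet ↔ z ∈ es.map fun e => s(e.1, e.2))
    (hnd : (es.map fun e => s(e.1, e.2)).Nodup) (hne : ∀ e ∈ es, e.1 ≠ e.2)
    (x : Sym2 V → ZMod 2) :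
    MvPolynomial.eval (fun e : G.edgeSet => x e)
      (MvPolynomial.map (Int.castRingHom (ZMod 2)) (kirchhoff G)) =
      forestSum connWeight es (es.map fun e => x s(e.1, e.2)) id := by
  have hF : G.edgeFinset = (es.map fun e => s(e.1, e.2)).toFinset := by
    ext z; simp only [mem_edgeFinset, hG, List.mem_toFinset]
  rw [← sum_powerset_isAcyclic_eq_forestSum _ es hnd hne x ∅ (by simp) (by simp) id
    (by simp), ← hF, kirchhoff, Finset.sum_filter, map_sum, map_sum]
  refine Finset.sum_congr rfl fun T hT => ?_
  have hT' : T ⊆ G.edgeFinset := Finset.mem_powerset.1 hT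
  have hst : IsSpanningTree G (T : Set (Sym2 V)) ↔
      (fromEdgeSet (T : Set (Sym2 V))).IsAcyclic ∧
        ∀ w w', (fromEdgeSet (T : Set (Sym2 V))).Reachable w w' := by
    refine ⟨fun h => ⟨h.2.2, h.2.1.preconnected⟩, fun h => ⟨?_, ⟨h.2⟩, h.1⟩⟩
    exact fun z hz => mem_edgeFinset.1 (hT' hz)
  rw [Set.empty_union]
  have hprod : ∏ e : G.edgeSet, (if (e : Sym2 V) ∈ T then 1 else x e) =
      ∏ e ∈ G.edgeFinset \ T, x e := by
    rw [← Finset.filter_notMem_eq_sdiff, Finset.prod_filter,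
      Finset.prod_subtype G.edgeFinset (p := (· ∈ G.edgeSet)) (fun _ => mem_edgeFinset)]
    refine Finset.prod_congr rfl fun e _ => ?_
    simp only [ite_not]
  rw [← hprod]
  by_cases h1 : (fromEdgeSet (T : Set (Sym2 V))).IsAcyclic <;>
    by_cases h2 : ∀ w w', (fromEdgeSet (T : Set (Sym2 V))).Reachable w w' <;>
    simp [hst, h1, h2, connWeight, apply_ite, map_prod]

theorem zeroCount_two_eq_cubeSum {V : Type} [Fintype V] [Nonempty V] (G : SimpleGraph V)
    (es : List (V × V)) (hG : ∀ z, z ∈ G.edgeSet ↔ z ∈ es.map fun e => s(e.1, e.2))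
    (hnd : (es.map fun e => s(e.1, e.2)).Nodup) (hne : ∀ e ∈ es, e.1 ≠ e.2) :
    (zeroCount G 2 : ZMod 8) = cubeSum es.length fun ys =>
      if forestSum connWeight es ys id = 0 then 1 else 0 := by
  have key : cubeSum (es.map fun e => s(e.1, e.2)).length (fun ys =>
      if forestSum connWeight es ys id = 0 then (1 : ZMod 8) else 0) = zeroCount G 2 := by
    let ε : Fin (es.map fun e => s(e.1, e.2)).length ≃ G.edgeSet :=
      (List.Nodup.getEquiv _ hnd).trans (Equiv.subtypeEquivRight fun z => (hG z).symm)
    rw [cubeSum_ofFn, zeroCount, Nat.card_eq_fintype_card, Fintype.card_subtype,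
      Finset.card_filter, Nat.cast_sum]
    refine Fintype.sum_equiv (Equiv.arrowCongr ε (Equiv.refl (ZMod 2))) _ _ fun y => ?_
    set x : Sym2 V → ZMod 2 := fun z => if h : z ∈ G.edgeSet then y (ε.symm ⟨z, h⟩) else 0 with hx
    have hxe : (Equiv.arrowCongr ε (Equiv.refl (ZMod 2))) y = fun e : G.edgeSet => x e := by
      funext e
      simp [hx]
    have hxl : (es.map fun e => x s(e.1, e.2)) = List.ofFn y := by
      have h : (es.map fun e => x s(e.1, e.2)) = (es.map fun e => s(e.1, e.2)).map x := by simp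
      rw [h, ← List.ofFn_getElem_eq_map]
      congr 1
      funext i
      have hi : (es.map fun e => s(e.1, e.2))[i] ∈ G.edgeSet := (hG _).2 (List.getElem_mem _)
      have h : ε i = ⟨_, hi⟩ := rfl
      have h' : ε.symm ⟨_, hi⟩ = i := by rw [← h, Equiv.symm_apply_apply]
      exact (dif_pos hi).trans (congrArg y h')
    rw [hxe, eval_kirchhoff_eq_forestSum G es hG hnd hne, hxl]
    simp
  rw [← key, List.length_map]

theorem mem_ladderEdges (m i j : ℕ) : (i, j) ∈ ladderEdges m ↔
    3 ≤ i ∧ ((j ≤ m + 5 ∧ (j = i + 1 ∨ j = i + 3)) ∨ (j = 0 ∧ (i = m + 5 ∨ i = m + 3))) := by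
  induction m generalizing i j with
  | zero => simp only [ladderEdges, List.mem_cons, List.not_mem_nil, Prod.mk.injEq, or_false]; omega
  | succ m ih =>
    simp only [ladderEdges, List.cons_append, List.nil_append, List.mem_cons, List.mem_map,
      Prod.exists, Prod.map_apply, Prod.mk.injEq, ih]
    constructor
    · rintro (h | h | ⟨a, b, h, rfl, rfl⟩)
      · omega
      · omega
      · unfold shiftVertex
        split_ifs <;> omega
    · intro h
      by_cases h3 : i = 3
      · omega
      · refine Or.inr (Or.inr ⟨i - 1, if j = 0 then 0 else j - 1, ?_, ?_, ?_⟩)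
        · split_ifs <;> omega
        · rw [shiftVertex, if_neg] <;> omega
        · unfold shiftVertex
          split_ifs <;> omega

theorem shiftVertex_injective : Function.Injective shiftVertex := by
  intro a b h
  unfold shiftVertex at h
  split_ifs at h <;> omega

theorem nodup_ladderEdges (m : ℕ) : (ladderEdges m).Nodup := by
  induction m with
  | zero => decide
  | succ m ih =>
    have h3 : ∀ j, (3, j) ∉ (ladderEdges m).map (Prod.map shiftVertex shiftVertex) := by
      intro j h
      simp only [List.mem_map, Prod.exists, Prod.map_apply, Prod.mk.injEq] at h
      obtain ⟨a, b, h, h1, -⟩ := h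
      rw [mem_ladderEdges] at h
      rw [shiftVertex, if_neg (by omega)] at h1
      omega
    simp only [ladderEdges, List.cons_append, List.nil_append, List.nodup_cons, List.mem_cons, h3,
      Prod.mk.injEq]
    exact ⟨by simp, by simp,
      ih.map (shiftVertex_injective.prodMap shiftVertex_injective)⟩

/-- Only the classes of the vertices in `S` matter if `φ` and the edges only see `S`. -/
theorem forestSum_congr_label_on {V L L' : Type*} (S : Set V) (φ : (V → V → Prop) → ZMod 2)
    (hφ : ∀ r r' : V → V → Prop, (∀ a ∈ S, ∀ b ∈ S, r a b ↔ r' a b) → φ r = φ r')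
    (es : List (V × V)) (hes : ∀ e ∈ es, e.1 ∈ S ∧ e.2 ∈ S) (ys : List (ZMod 2))
    (f : V → L) (f' : V → L') (h : ∀ a ∈ S, ∀ b ∈ S, f a = f b ↔ f' a = f' b) :
    forestSum φ es ys f = forestSum φ es ys f' := by
  induction es generalizing ys f f' with
  | nil => exact hφ _ _ h
  | cons e es ih =>
    cases ys with
    | nil => simp [forestSum]
    | cons y ys =>
      obtain ⟨h1, h2⟩ := hes e List.mem_cons_self
      have ih' := ih fun e he => hes e (List.mem_cons_of_mem _ he)
      simp only [forestSum, h _ h1 _ h2]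
      rw [ih' ys f f' h, ih' ys (mergeLabel f e.1 e.2) (mergeLabel f' e.1 e.2)]
      intro a ha b hb
      simp only [mergeLabel_eq_iff, h a ha b hb, h a ha _ h1, h a ha _ h2, h b hb _ h1,
        h b hb _ h2]

theorem treeWeight_congr (m : ℕ) (r r' : ℕ → ℕ → Prop)
    (h : ∀ i < m + 6, ∀ j < m + 6, r i j ↔ r' i j) : treeWeight m r = treeWeight m r' := by
  rw [treeWeight, treeWeight]
  congr 1
  exact propext (forall₂_congr fun i hi => h i hi 0 (by omega))

theorem twoForestWeight_congr (m : ℕ) (r r' : ℕ → ℕ → Prop)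
    (h : ∀ i < m + 6, ∀ j < m + 6, r i j ↔ r' i j) :
    twoForestWeight m r = twoForestWeight m r' := by
  have h1 := fun i hi => h i hi 1 (by omega)
  have h2 := fun i hi => h i hi 2 (by omega)
  have h5 := fun i hi => h i hi (m + 5) (by omega)
  rw [twoForestWeight, twoForestWeight, h2 1 (by omega), h5 1 (by omega), h5 2 (by omega)]
  congr 2
  exact propext (forall₂_congr fun i hi => by rw [h1 i hi, h2 i hi, h5 i hi])

/-! ### Decompleted circulant graphs -/

/-- A numbering by `0, 2, 3, …, m + 5` of the vertices of a graph that has the adjacencies of the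
decompleted circulant graph; the vertex `2` has degree three. -/
structure LadderNumbering {V : Type} (G : SimpleGraph V) (m : ℕ) (g : ℕ → V) : Prop where
  injOn : Set.InjOn g {i | i < m + 6 ∧ i ≠ 1}
  exists_eq : ∀ w, ∃ i < m + 6, i ≠ 1 ∧ g i = w
  adj_iff : ∀ i j, i < j → j < m + 6 → i ≠ 1 → j ≠ 1 →
    (G.Adj (g i) (g j) ↔ j = i + 1 ∨ j = i + 3 ∨ j = i + (m + 3) ∨ j = i + (m + 5))

namespace LadderNumbering

variable {V : Type} {G : SimpleGraph V} {m : ℕ} {g : ℕ → V}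

theorem apply_eq_iff (h : LadderNumbering G m g) {i j : ℕ} (hi : i < m + 6) (hi1 : i ≠ 1)
    (hj : j < m + 6) (hj1 : j ≠ 1) : g i = g j ↔ i = j :=
  h.injOn.eq_iff ⟨hi, hi1⟩ ⟨hj, hj1⟩

theorem exists_eq_ne (h : LadderNumbering G m g) {w : V} (hw : w ≠ g 2) :
    ∃ i < m + 6, i ≠ 1 ∧ i ≠ 2 ∧ g i = w := by
  obtain ⟨i, hi, hi1, rfl⟩ := h.exists_eq w
  exact ⟨i, hi, hi1, fun h => hw (h ▸ rfl), rfl⟩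

theorem connOffWeight_eq (h : LadderNumbering G m g) (r : V → V → Prop) (hr : Equivalence r) :
    connOffWeight (g 2) (g (m + 5)) r =
      treeWeight m fun i j => r (g (if i < 3 then 0 else i)) (g (if j < 3 then 0 else j)) := by
  rw [connOffWeight, treeWeight]
  have hm : ¬ m + 5 < 3 := by omega
  congr 1
  refine propext ⟨fun H i hi => ?_, fun H w hw => ?_⟩
  · have ne : ∀ i < m + 6, g (if i < 3 then 0 else i) ≠ g 2 := by
      intro i hi
      rw [Ne, h.apply_eq_iff] <;> (try split_ifs) <;> first | omega | simp
    exact hr.trans (H _ (ne i hi)) (hr.symm (H _ (ne 0 (by omega))))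
  · obtain ⟨i, hi, hi1, hi2, rfl⟩ := h.exists_eq_ne hw
    have H0 := H (m + 5) (by omega)
    by_cases hi3 : i < 3
    · obtain rfl : i = 0 := by omega
      simpa [hm] using hr.symm H0
    · have := H i hi
      rw [if_neg hi3] at this
      simpa [hm] using hr.trans this (hr.symm H0)

theorem splitOffWeight_eq (h : LadderNumbering G m g) (r : V → V → Prop) (hr : Equivalence r) :
    (splitOffWeight (g 2) (g 3) (g 5) (g (m + 5)) + splitOffWeight (g 2) (g 5) (g 3) (g (m + 5)) +
      splitOffWeight (g 2) (g (m + 5)) (g 3) (g 5)) r =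
      twoForestWeight m fun i j => r (g (if i = 1 then 3 else if i = 2 then 5 else i))
        (g (if j = 1 then 3 else if j = 2 then 5 else j)) := by
  have hm : m + 5 ≠ 1 ∧ m + 5 ≠ 2 := by omega
  have key : (∀ i < m + 6, r (g (if i = 1 then 3 else if i = 2 then 5 else i)) (g 3) ∨
      r (g (if i = 1 then 3 else if i = 2 then 5 else i)) (g 5) ∨
      r (g (if i = 1 then 3 else if i = 2 then 5 else i)) (g (m + 5))) ↔
      ∀ w, w ≠ g 2 → r w (g 3) ∨ r w (g 5) ∨ r w (g (m + 5)) := by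
    refine ⟨fun H w hw => ?_, fun H i hi => H _ ?_⟩
    · obtain ⟨i, hi, hi1, hi2, rfl⟩ := h.exists_eq_ne hw
      simpa [hi1, hi2] using H i hi
    · rw [Ne, h.apply_eq_iff] <;> (try split_ifs) <;> omega
  simp only [twoForestWeight, hm, if_true, if_false, key, OfNat.ofNat_ne_one]
  have ab : r (g 5) (g 3) ↔ r (g 3) (g 5) := ⟨hr.symm, hr.symm⟩
  have ac : r (g (m + 5)) (g 3) ↔ r (g 3) (g (m + 5)) := ⟨hr.symm, hr.symm⟩
  have t1 := @hr.trans (g 3) (g 5) (g (m + 5))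
  have t3 := @hr.trans (g 3) (g (m + 5)) (g 5)
  have bc : r (g (m + 5)) (g 5) ↔ r (g 5) (g (m + 5)) := ⟨hr.symm, hr.symm⟩
  simp only [Pi.add_apply, splitOffWeight, ab, ac]
  have q : ∀ {x y}, r x y → ∀ w, r w x ↔ r w y := fun h w =>
    ⟨fun h' => hr.trans h' h, fun h' => hr.trans h' (hr.symm h)⟩
  by_cases k1 : r (g 3) (g 5)
  · by_cases k2 : r (g 3) (g (m + 5))
    · simp [k1, k2]
    · have k3 : ¬ r (g 5) (g (m + 5)) := fun h => k2 (t1 k1 h)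
      simp [k1, k2, k3, q k1, or_comm]
  · by_cases k2 : r (g 3) (g (m + 5))
    · have k3 : ¬ r (g 5) (g (m + 5)) := fun h => k1 (t3 k2 (bc.2 h))
      simp [k1, k2, k3, q k2, or_comm, or_left_comm]
    · by_cases k3 : r (g 5) (g (m + 5))
      · simp [k1, k2, k3, q k3]
      · simp [k1, k2, k3]

/-- The edges of the numbered graph away from the vertex `2`. -/
def edgesOff (m : ℕ) : List (ℕ × ℕ) := (0, 3) :: ladderEdges m

theorem mem_edgesOff (m i j : ℕ) : (i, j) ∈ edgesOff m ↔ (i = 0 ∧ j = 3) ∨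
    (3 ≤ i ∧ ((j ≤ m + 5 ∧ (j = i + 1 ∨ j = i + 3)) ∨ (j = 0 ∧ (i = m + 5 ∨ i = m + 3)))) := by
  rw [edgesOff, List.mem_cons, Prod.mk.injEq, mem_ladderEdges]

/-- The edges of the numbered graph, those at the vertex `2` last. -/
def numberedEdges (m : ℕ) : List (ℕ × ℕ) := edgesOff m ++ [(2, 3), (2, 5), (2, m + 5)]

theorem mem_numberedEdges (m i j : ℕ) : (i, j) ∈ numberedEdges m ↔ (i = 0 ∧ j = 3) ∨
    (3 ≤ i ∧ ((j ≤ m + 5 ∧ (j = i + 1 ∨ j = i + 3)) ∨ (j = 0 ∧ (i = m + 5 ∨ i = m + 3)))) ∨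
    (i = 2 ∧ (j = 3 ∨ j = 5 ∨ j = m + 5)) := by
  simp only [numberedEdges, List.mem_append, mem_edgesOff, List.mem_cons, Prod.mk.injEq,
    List.not_mem_nil, or_false, or_assoc, and_or_left]

theorem nodup_numberedEdges (m : ℕ) (hm : 1 ≤ m) : (numberedEdges m).Nodup := by
  rw [numberedEdges, List.nodup_append]
  refine ⟨List.nodup_cons.2 ⟨?_, nodup_ladderEdges _⟩, by simp; omega, ?_⟩
  · rw [mem_ladderEdges]; omega
  · rintro ⟨i, j⟩ h1 ⟨k, l⟩ h2 h3
    simp only [mem_edgesOff, List.mem_cons, Prod.mk.injEq, List.not_mem_nil, or_false] at h1 h2 h3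
    omega

theorem mem_numberedEdges_or_swap (m i j : ℕ) (hm : 1 ≤ m) (hij : i < j) (hj : j < m + 6)
    (hi1 : i ≠ 1) (hj1 : j ≠ 1) :
    (i, j) ∈ numberedEdges m ∨ (j, i) ∈ numberedEdges m ↔
      j = i + 1 ∨ j = i + 3 ∨ j = i + (m + 3) ∨ j = i + (m + 5) := by
  rw [mem_numberedEdges, mem_numberedEdges]
  refine ⟨?_, fun h => by grind⟩
  rintro (h | h) <;> omega

theorem nodup_map (h : LadderNumbering G m g) (hm : 1 ≤ m) :
    (((numberedEdges m).map (Prod.map g g)).map fun e : V × V => s(e.1, e.2)).Nodup := by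
  rw [List.map_map]
  refine List.Nodup.map_on ?_ (nodup_numberedEdges m hm)
  rintro ⟨i, j⟩ h1 ⟨k, l⟩ h2 h3
  rw [mem_numberedEdges] at h1 h2
  simp only [Function.comp_apply, Prod.map_apply, Sym2.eq_iff] at h3
  rw [h.apply_eq_iff (by omega) (by omega) (by omega) (by omega),
    h.apply_eq_iff (by omega) (by omega) (by omega) (by omega),
    h.apply_eq_iff (by omega) (by omega) (by omega) (by omega),
    h.apply_eq_iff (by omega) (by omega) (by omega) (by omega)] at h3
  rw [Prod.mk.injEq]
  omega

theorem mem_edgeSet_iff (h : LadderNumbering G m g) (hm : 1 ≤ m) (z : Sym2 V) :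
    z ∈ G.edgeSet ↔
      z ∈ ((numberedEdges m).map (Prod.map g g)).map fun e : V × V => s(e.1, e.2) := by
  have adj : ∀ i j, i < m + 6 → j < m + 6 → i ≠ 1 → j ≠ 1 → (G.Adj (g i) (g j) ↔
      (i, j) ∈ numberedEdges m ∨ (j, i) ∈ numberedEdges m) := by
    intro i j hi hj hi1 hj1
    rcases lt_trichotomy i j with hij | rfl | hij
    · rw [h.adj_iff i j hij hj hi1 hj1, mem_numberedEdges_or_swap m i j hm hij hj hi1 hj1]
    · simp only [SimpleGraph.irrefl, false_iff, or_self, mem_numberedEdges]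
      omega
    · rw [G.adj_comm, h.adj_iff j i hij hi hj1 hi1, or_comm (a := _ ∈ _),
        mem_numberedEdges_or_swap m j i hm hij hi hj1 hi1]
  rw [List.map_map, List.mem_map]
  constructor
  · induction z with | _ x y
    obtain ⟨i, hi, hi1, rfl⟩ := h.exists_eq x
    obtain ⟨j, hj, hj1, rfl⟩ := h.exists_eq y
    intro hz
    rcases (adj i j hi hj hi1 hj1).1 hz with h' | h'
    · exact ⟨_, h', rfl⟩
    · exact ⟨_, h', Sym2.eq_swap⟩
  · rintro ⟨⟨i, j⟩, h', rfl⟩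
    have h2 := h'
    rw [mem_numberedEdges] at h2
    exact (adj i j (by omega) (by omega) (by omega) (by omega)).2 (Or.inl h')

theorem map_map_edgesOff (g : ℕ → V) (τ : ℕ → ℕ) (h0 : τ 0 = 0) (h3 : ∀ i, 3 ≤ i → τ i = i) :
    (edgesOff m).map (Prod.map g g) = (edgesOff m).map (Prod.map (g ∘ τ) (g ∘ τ)) := by
  refine List.map_congr_left ?_
  rintro ⟨i, j⟩ h
  rw [mem_edgesOff] at h
  have ht : ∀ i, i = 0 ∨ 3 ≤ i → τ i = i := fun i hi => hi.elim (fun hi => hi ▸ h0) (h3 i)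
  rw [Prod.map_apply, Prod.map_apply, Function.comp_apply, Function.comp_apply, ht i (by omega),
    ht j (by omega)]

theorem forestSum_eq (h : LadderNumbering G m g) (φ : (V → V → Prop) → ZMod 2)
    (ψ : (ℕ → ℕ → Prop) → ZMod 2) (τ : ℕ → ℕ) (h0 : τ 0 = 0) (h3 : ∀ i, 3 ≤ i → τ i = i)
    (h12 : ∀ i, τ i ≠ 1 ∧ (i < m + 6 → τ i < m + 6))
    (hφ : ∀ r, Equivalence r → φ r = ψ fun i j => r (g (τ i)) (g (τ j)))
    (hψ : ∀ r r' : ℕ → ℕ → Prop, (∀ i < m + 6, ∀ j < m + 6, r i j ↔ r' i j) → ψ r = ψ r')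
    (t : List ℕ) (ht : ∀ i j, listLabel t i = listLabel t j ↔ τ i = τ j) (ys : List (ZMod 2)) :
    forestSum φ ((edgesOff m).map (Prod.map g g)) ys id =
      forestSum ψ (edgesOff m) ys (listLabel t) := by
  rw [map_map_edgesOff g τ h0 h3, forestSum_map_of_invariant (g ∘ τ) φ ψ (fun _ => True)
    (fun f _ => hφ _ ⟨fun _ => rfl, Eq.symm, Eq.trans⟩) _ (fun _ _ _ _ => trivial) _ _ trivial]
  refine forestSum_congr_label_on {i | i < m + 6} ψ hψ _ ?_ _ _ _ ?_
  · rintro ⟨i, j⟩ h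
    rw [mem_edgesOff] at h
    simp only [Set.mem_ofPred_eq]
    omega
  · intro i hi j hj
    rw [ht]
    exact h.apply_eq_iff ((h12 i).2 hi) (h12 i).1 ((h12 j).2 hj) (h12 j).1

theorem listLabel_eq_tree (i : ℕ) :
    listLabel [0, 0, 0, 3, 4, 5] i = if i < 3 then 0 else i := by
  rcases lt_or_ge i 6 with h | h
  · interval_cases i <;> rfl
  · rw [listLabel, List.getD_eq_default _ _ h, if_neg (by omega)]

theorem listLabel_eq_iff_twoForest (i j : ℕ) :
    listLabel [0, 1, 2, 1, 4, 2] i = listLabel [0, 1, 2, 1, 4, 2] j ↔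
      (if i = 1 then 3 else if i = 2 then 5 else i) =
        if j = 1 then 3 else if j = 2 then 5 else j := by
  have key : ∀ i, listLabel [0, 1, 2, 1, 4, 2] i = if i = 3 then 1 else if i = 5 then 2 else i := by
    intro i
    rcases lt_or_ge i 6 with h | h
    · interval_cases i <;> rfl
    · rw [listLabel, List.getD_eq_default _ _ h, if_neg (by omega), if_neg (by omega)]
  rw [key, key]
  split_ifs <;> omega

theorem zeroCount_two [Fintype V] (h : LadderNumbering G m g) (hm : 1 ≤ m) :
    (zeroCount G 2 : ZMod 8) = 4 * m := by
  have : Nonempty V := ⟨g 0⟩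
  have ne : ∀ i j, i < m + 6 ∧ j < m + 6 ∧ i ≠ 1 ∧ j ≠ 1 ∧ i ≠ j → g i ≠ g j :=
    fun i j ⟨hi, hj, hi1, hj1, hij⟩ h' => hij ((h.apply_eq_iff hi hi1 hj hj1).1 h')
  have hG := h.mem_edgeSet_iff hm
  have hne : ∀ e ∈ (numberedEdges m).map (Prod.map g g), e.1 ≠ e.2 := fun e he =>
    G.ne_of_adj ((hG s(e.1, e.2)).2 (List.mem_map_of_mem he))
  have hnd := h.nodup_map hm
  have hmap : (numberedEdges m).map (Prod.map g g) =
      (edgesOff m).map (Prod.map g g) ++ [(g 2, g 3), (g 2, g 5), (g 2, g (m + 5))] := by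
    simp [numberedEdges]
  rw [hmap] at hne hnd hG
  have hT := h.forestSum_eq _ _ (fun i => if i < 3 then 0 else i) rfl
    (fun i hi => if_neg hi.not_gt) (fun i => by split_ifs <;> omega) h.connOffWeight_eq
    (treeWeight_congr _) [0, 0, 0, 3, 4, 5]
    (fun i j => by rw [listLabel_eq_tree, listLabel_eq_tree])
  have hF := h.forestSum_eq _ _ (fun i => if i = 1 then 3 else if i = 2 then 5 else i) rfl
    (fun i hi => by rw [if_neg, if_neg] <;> omega)
    (fun i => by split_ifs <;> omega) h.splitOffWeight_eq (twoForestWeight_congr _)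
    [0, 1, 2, 1, 4, 2] listLabel_eq_iff_twoForest
  rw [zeroCount_two_eq_cubeSum G _ hG hnd hne, List.length_append, List.length_cons,
    List.length_cons, List.length_cons, List.length_nil, cubeSum_forestSum_eq_zero]
  · simp only [forestPairSum, List.length_map, hT, hF]
    exact (congrArg fourMul (forestPairSum_ladderEdges m)).trans (fourMul_natCast _)
  · simp only [List.nodup_cons, List.mem_cons, List.not_mem_nil, or_false, not_or]
    exact ⟨⟨ne _ _ (by omega), ne _ _ (by omega), ne _ _ (by omega)⟩,
      ⟨ne _ _ (by omega), ne _ _ (by omega)⟩, ne _ _ (by omega), by simp⟩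
  · rintro e he
    obtain ⟨⟨i, j⟩, h', rfl⟩ := List.mem_map.1 he
    rw [mem_edgesOff] at h'
    exact ⟨ne _ _ (by omega), ne _ _ (by omega)⟩
  · rw [List.map_append] at hnd
    exact hnd.of_append_left
  · exact fun e he => hne e (List.mem_append_left _ he)
  · exact ⟨g 0, ne _ _ (by omega), ne _ _ (by omega), ne _ _ (by omega), ne _ _ (by omega)⟩

end LadderNumbering

/-- The vertex `i - 1` of the decompleted circulant graph, with a junk value for `i = 1`. -/
noncomputable def circulantVertex (n : ℕ) [Fact (1 < n)] (i : ℕ) : {w : ZMod n | w ≠ 0} :=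
  if h : (i : ZMod n) - 1 ≠ 0 then ⟨i - 1, h⟩ else ⟨1, one_ne_zero⟩

theorem circulantVertex_val {n : ℕ} [Fact (1 < n)] {i : ℕ} (hi : i < n) (hi1 : i ≠ 1) :
    (circulantVertex n i : ZMod n) = i - 1 := by
  have hn : 1 < n := Fact.out
  have h : (i : ZMod n) - 1 ≠ 0 := by
    rw [sub_ne_zero, ← Nat.cast_one, Ne, ZMod.natCast_eq_natCast_iff', Nat.mod_eq_of_lt hi,
      Nat.mod_eq_of_lt hn]
    exact hi1
  rw [circulantVertex, dif_pos h]

theorem ladderNumbering_circulantVertex (m : ℕ) [Fact (1 < m + 6)] :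
    LadderNumbering ((circulant (m + 6) {1, 3}).induce {w | w ≠ 0}) m
      (circulantVertex (m + 6)) where
  injOn := by
    rintro i ⟨hi, hi1⟩ j ⟨hj, hj1⟩ hij
    have h := congrArg Subtype.val hij
    rw [circulantVertex_val hi hi1, circulantVertex_val hj hj1, sub_left_inj,
      ZMod.natCast_eq_natCast_iff', Nat.mod_eq_of_lt hi, Nat.mod_eq_of_lt hj] at h
    exact h
  exists_eq := by
    rintro ⟨w, hw⟩
    have h : (((w + 1).val : ℕ) : ZMod (m + 6)) = w + 1 := ZMod.natCast_zmod_val _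
    have h1 : (w + 1).val ≠ 1 := by
      intro h1
      rw [h1, Nat.cast_one] at h
      exact hw (by simpa using h)
    refine ⟨(w + 1).val, ZMod.val_lt _, h1, Subtype.ext ?_⟩
    rw [circulantVertex_val (ZMod.val_lt _) h1, h, add_sub_cancel_right]
  adj_iff := by
    intro i j hij hj hi1 hj1
    have hi := hij.trans hj
    obtain ⟨k, rfl⟩ := Nat.exists_eq_add_of_lt hij
    have e : ∀ a b : ℕ, a < m + 6 → b < m + 6 → ((a : ZMod (m + 6)) = b ↔ a = b) := by
      intro a b ha hb
      rw [ZMod.natCast_eq_natCast_iff', Nat.mod_eq_of_lt ha, Nat.mod_eq_of_lt hb]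
    have e0 : ∀ a b : ℕ, a + b = m + 6 → (b : ZMod (m + 6)) = - a := by
      intro a b h
      rw [eq_neg_iff_add_eq_zero, ← Nat.cast_add, add_comm b, h, ZMod.natCast_self]
    have h0 : ((k + 1 : ℕ) : ZMod (m + 6)) ≠ 0 := by
      rw [← Nat.cast_zero, Ne, e _ _ (by omega) (by omega)]
      omega
    have h1 := e (k + 1) 1 (by omega) (by omega)
    have h3 := e (k + 1) 3 (by omega) (by omega)
    have h1' := e (k + 1) (m + 5) (by omega) (by omega)
    have h3' := e (k + 1) (m + 3) (by omega) (by omega)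
    rw [e0 1 (m + 5) (by omega)] at h1'
    rw [e0 3 (m + 3) (by omega)] at h3'
    have hd : (circulantVertex (m + 6) (i + k + 1) : ZMod (m + 6)) - circulantVertex (m + 6) i =
        (k + 1 : ℕ) := by
      rw [circulantVertex_val hj hj1, circulantVertex_val hi hi1]
      push_cast
      ring
    have hd' : (circulantVertex (m + 6) i : ZMod (m + 6)) - circulantVertex (m + 6) (i + k + 1) =
        -(k + 1 : ℕ) := by
      rw [← hd, neg_sub]
    have hne : (circulantVertex (m + 6) i : ZMod (m + 6)) ≠
        circulantVertex (m + 6) (i + k + 1) := by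
      intro h
      rw [h, sub_self] at hd
      exact h0 hd.symm
    rw [comap_adj, circulant, fromRel_adj]
    simp only [Function.Embedding.subtype_apply, hd, hd', Set.mem_insert_iff,
      Set.mem_singleton_iff, exists_eq_or_imp, exists_eq_left, neg_eq_iff_eq_neg]
    rw [and_iff_right hne]
    push_cast at h1 h3 h1' h3' ⊢
    rw [h1, h3, h1', h3']
    omega

/-- For the decompletion `G` of the circulant graph `C_n(1,3)` with `n ≥ 7`,
`[Ψ_G]_2 ≡ 4n (mod 8)`, i.e. `c₂^{(2)}(G) ≡ n (mod 2)`. -/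
theorem c2_two_decompleted_circulant_one_three (n : ℕ) [NeZero n] (hn : 7 ≤ n) :
    zeroCount ((circulant n {1, 3}).induce {w | w ≠ 0}) 2 ≡ 4 * n [MOD 8] := by
  obtain ⟨m, rfl⟩ := Nat.exists_eq_add_of_le' (show 6 ≤ n by omega)
  have : Fact (1 < m + 6) := ⟨by omega⟩
  rw [← ZMod.natCast_eq_natCast_iff, (ladderNumbering_circulantVertex m).zeroCount_two (by omega)]
  have h : (24 : ZMod 8) = 0 := rfl
  push_cast
  linear_combination -h
end

section
/- Let k ≥ 3 be an integer, and let G be the graph obtained from the circulant graph C_{3k}(1,3) by deleting the vertex 0 (G is a decompleted skew toroidal grid parametrized by (k,0) and (1,3)). Then the number of points x ∈ 𝔽₂^{E(G)} with Ψ_G(x) = 0 is congruent to 4k modulo 8; equivalently, c₂^{(2)}(G) ≡ k (mod 2). -/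
open SimpleGraph
open scoped Classical

namespace SkewTorus

open MvPolynomial

/-- The exponent of the squarefree monomial `∏ w ∈ S, X w`. -/
noncomputable def squarefreeExp {V : Type} (S : Finset V) : V →₀ ℕ :=
  Finsupp.indicator S fun _ _ => 1

theorem squarefreeExp_apply {V : Type} (S : Finset V) (w : V) :
    squarefreeExp S w = if w ∈ S then 1 else 0 := by
  simp [squarefreeExp, Finsupp.indicator_apply]

/-- The linear form `X u + X v` attached to the edge `s(u, v)`. -/
noncomputable def edgeForm {V : Type} (e : Sym2 V) : MvPolynomial V (ZMod 2) :=
  Sym2.lift ⟨fun u v => X u + X v, fun _ _ => add_comm _ _⟩ e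

@[simp]
theorem edgeForm_mk {V : Type} (u v : V) : edgeForm s(u, v) = X u + X v := rfl

theorem coeff_squarefreeExp_mul_X {V : Type} [DecidableEq V] (S : Finset V) (u : V)
    (P : MvPolynomial V (ZMod 2)) :
    coeff (squarefreeExp S) (P * X u) =
      if u ∈ S then coeff (squarefreeExp (S.erase u)) P else 0 := by
  rw [coeff_mul_X']
  by_cases hu : u ∈ S
  · have h : squarefreeExp S - Finsupp.single u 1 = squarefreeExp (S.erase u) := by
      ext w
      by_cases hw : w = u
      · simp [squarefreeExp_apply, hw, hu]
      · simp [squarefreeExp_apply, hw]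
    simp [squarefreeExp_apply, hu, h]
  · simp [squarefreeExp_apply, hu]

theorem isHomogeneous_prod_edgeForm {V : Type} (T : Finset (Sym2 V)) :
    (∏ e ∈ T, edgeForm e).IsHomogeneous T.card := by
  have h := IsHomogeneous.prod T (fun e => edgeForm e) (fun _ => 1) (fun e _ => by
    induction e with
    | _ u v => exact (isHomogeneous_X _ u).add (isHomogeneous_X _ v))
  simpa using h

theorem degree_squarefreeExp {V : Type} (S : Finset V) : (squarefreeExp S).degree = S.card := by
  have hsub : (squarefreeExp S).support ⊆ S := by
    intro w hw
    by_contra h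
    simp [squarefreeExp_apply, h] at hw
  rw [Finsupp.degree_apply, Finset.sum_subset hsub fun w _ hw => Finsupp.notMem_support_iff.1 hw]
  simp [squarefreeExp_apply]

theorem sum_zmod_two {M : Type} [AddCommMonoid M] (f : ZMod 2 → M) : ∑ y, f y = f 0 + f 1 :=
  Fin.sum_univ_two f

theorem sum_pow_zmod_two (d : ℕ) : ∑ a : ZMod 2, a ^ d = if d = 0 then 0 else 1 := by
  rw [sum_zmod_two]
  rcases d with _ | d
  · rfl
  · simp

theorem sum_eval_eq_coeff {V : Type} [Fintype V] (P : MvPolynomial V (ZMod 2))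
    (hP : P.totalDegree ≤ Fintype.card V) :
    ∑ x : V → ZMod 2, eval x P = coeff (squarefreeExp Finset.univ) P := by
  simp only [eval_eq' ]
  rw [Finset.sum_comm]
  have key : ∀ d ∈ P.support, ∑ x : V → ZMod 2, coeff d P * ∏ i, x i ^ d i =
      if d = squarefreeExp Finset.univ then coeff d P else 0 := by
    intro d hd
    have h1 : ∑ x : V → ZMod 2, ∏ i, x i ^ d i = ∏ i, ∑ a : ZMod 2, a ^ d i :=
      (Fintype.prod_sum fun i (a : ZMod 2) => a ^ d i).symm
    rw [← Finset.mul_sum, h1]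
    simp only [sum_pow_zmod_two]
    split_ifs with h
    · simp [h, squarefreeExp_apply]
    · obtain ⟨i, hi⟩ : ∃ i, d i = 0 := by
        by_contra! hne
        apply h
        have hle : ∑ i, d i ≤ ∑ _i : V, 1 := by
          have := le_totalDegree hd
          rw [Finsupp.sum_fintype _ _ (fun _ => rfl)] at this
          simpa using this.trans hP
        have hge : ∀ i ∈ Finset.univ, 1 ≤ d i := fun i _ => Nat.one_le_iff_ne_zero.2 (hne i)
        have heq := (Finset.sum_eq_sum_iff_of_le hge).1 (le_antisymm (Finset.sum_le_sum hge) hle)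
        ext i
        simpa [squarefreeExp_apply] using (heq i (Finset.mem_univ i)).symm
      rw [Finset.prod_eq_zero (Finset.mem_univ i) (by simp [hi]), mul_zero]
  rw [Finset.sum_congr rfl key, Finset.sum_ite_eq']
  split_ifs with h
  · rfl
  · exact (notMem_support_iff.1 h).symm

theorem eval_edgeForm {V : Type} (x : V → ZMod 2) (u v : V) :
    eval x (edgeForm s(u, v)) = x u + x v := by simp

theorem zmod_two_ne_zero_iff (a : ZMod 2) : a ≠ 0 ↔ a = 1 := by revert a; decide

theorem adj_fromEdgeSet_iff {V : Type} {T : Set (Sym2 V)} (hT : ∀ e ∈ T, ¬ e.IsDiag) {u v : V} :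
    (fromEdgeSet T).Adj u v ↔ s(u, v) ∈ T := by
  rw [fromEdgeSet_adj]
  exact ⟨fun h => h.1, fun h => ⟨h, fun huv => hT _ h (by simpa using huv)⟩⟩

/-- Modulo 2, the proper 2-colourings of a tree with prescribed colour at the root are counted by
`1`; if the graph is disconnected, there is an even number of them. -/
theorem sum_root_mul_prod_eval_edgeForm {V : Type} [Fintype V] (r : V) (T : Finset (Sym2 V))
    (hT : ∀ e ∈ T, ¬ e.IsDiag) (hcard : T.card + 1 = Fintype.card V) :
    ∑ x : V → ZMod 2, x r * ∏ e ∈ T, eval x (edgeForm e) =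
      if (fromEdgeSet (T : Set (Sym2 V))).Connected then 1 else 0 := by
  have hadj : ∀ {u v}, (fromEdgeSet (T : Set (Sym2 V))).Adj u v ↔ s(u, v) ∈ T := fun {u v} => by
    simpa using adj_fromEdgeSet_iff (T := (T : Set (Sym2 V))) (by simpa using hT) (u := u) (v := v)
  split_ifs with hc
  · have htree : (fromEdgeSet (T : Set (Sym2 V))).IsTree := by
      rw [isTree_iff_connected_and_card]
      refine ⟨hc, ?_⟩
      have hs : (fromEdgeSet (T : Set (Sym2 V))).edgeSet = T := by
        rw [edgeSet_fromEdgeSet, sdiff_eq_left, Set.disjoint_left]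
        intro e he
        simpa using hT e he
      rw [hs, Nat.card_eq_fintype_card (α := V), ← hcard]
      simp
    obtain ⟨c⟩ := htree.isAcyclic.colorable_two
    let c' : V → ZMod 2 := c
    have hc' : ∀ {u v}, s(u, v) ∈ T → c' u ≠ c' v := fun huv => c.valid (hadj.2 huv)
    let y : V → ZMod 2 := fun w => c' w + c' r + 1
    have hy : ∀ u v, s(u, v) ∈ T → y u + y v = 1 := by
      intro u v huv
      have := hc' huv
      simp only [y]
      generalize c' u = a at *
      generalize c' v = b at *
      generalize c' r = d at *
      revert a b d
      decide
    have hyr : y r = 1 := by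
      simp only [y]
      generalize c' r = d
      revert d
      decide
    rw [Finset.sum_eq_single y]
    · rw [hyr, one_mul]
      refine Finset.prod_eq_one fun e => ?_
      induction e with
      | _ u v => exact fun huv => by rw [eval_edgeForm, hy u v huv]
    · intro x _ hx
      by_contra hne
      obtain ⟨hxr, hxe⟩ := mul_ne_zero_iff.1 hne
      rw [Finset.prod_ne_zero_iff] at hxe
      apply hx
      funext w
      have hw := hc.preconnected r w
      rw [reachable_iff_reflTransGen] at hw
      induction hw with
      | refl => rw [hyr, (zmod_two_ne_zero_iff _).1 hxr]
      | tail _ huv ih =>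
        rename_i u v _
        have h1 := (zmod_two_ne_zero_iff _).1 (hxe _ (hadj.1 huv))
        rw [eval_edgeForm, ← hy u v (hadj.1 huv), ih] at h1
        exact add_left_cancel h1
    · simp
  · obtain ⟨w, hw⟩ : ∃ w, ¬ (fromEdgeSet (T : Set (Sym2 V))).Reachable r w := by
      by_contra! h
      exact hc ((connected_iff _).2 ⟨fun a b => (h a).symm.trans (h b), ⟨r⟩⟩)
    let χ : V → ZMod 2 := fun v => if (fromEdgeSet (T : Set (Sym2 V))).Reachable w v then 1 else 0
    refine Finset.sum_involution (fun x _ => x + χ) ?_ ?_ (fun _ _ => Finset.mem_univ _) ?_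
    · intro x _
      have h1 : (x + χ) r = x r := by
        simpa [χ] using fun h => hw (Reachable.symm h)
      have h2 : ∀ e ∈ T, eval (x + χ) (edgeForm e) = eval x (edgeForm e) := by
        intro e
        induction e with
        | _ u v =>
          intro huv
          have h3 : χ u = χ v := by
            have := (hadj.2 huv).reachable
            simp only [χ]
            congr 1
            exact propext ⟨fun h => h.trans this, fun h => h.trans this.symm⟩
          rw [eval_edgeForm, eval_edgeForm, Pi.add_apply, Pi.add_apply, h3, add_add_add_comm,
            CharTwo.add_self_eq_zero, add_zero]
      rw [h1, Finset.prod_congr rfl h2, CharTwo.add_self_eq_zero]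
    · intro x _ _ h
      have := congrFun h w
      simp [χ] at this
    · intro x _
      rw [add_assoc, show χ + χ = 0 from funext fun v => CharTwo.add_self_eq_zero _, add_zero]

theorem coeff_prod_edgeForm {V : Type} [Fintype V] (G : SimpleGraph V) (r : V)
    (T : Finset (Sym2 V)) (hT : (T : Set (Sym2 V)) ⊆ G.edgeSet) :
    coeff (squarefreeExp (Finset.univ.erase r)) (∏ e ∈ T, edgeForm e) =
      if IsSpanningTree G (T : Set (Sym2 V)) then 1 else 0 := by
  have hdiag : ∀ e ∈ T, ¬ e.IsDiag := fun e he => G.not_isDiag_of_mem_edgeSet (hT he)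
  have hs : (fromEdgeSet (T : Set (Sym2 V))).edgeSet = T := by
    rw [edgeSet_fromEdgeSet, sdiff_eq_left, Set.disjoint_left]
    intro e he
    simpa using hdiag e he
  have hiff : IsSpanningTree G (T : Set (Sym2 V)) ↔
      (fromEdgeSet (T : Set (Sym2 V))).Connected ∧ T.card + 1 = Fintype.card V := by
    have h := isTree_iff_connected_and_card (G := fromEdgeSet (T : Set (Sym2 V)))
    rw [isTree_iff, hs, Nat.card_eq_fintype_card (α := V)] at h
    simp only [SetLike.coe_sort_coe, Nat.card_eq_fintype_card, Fintype.card_coe] at h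
    exact ⟨fun h' => h.1 h'.2, fun h' => ⟨hT, h.2 h'⟩⟩
  by_cases hcard : T.card + 1 = Fintype.card V
  · simp only [hiff, hcard, and_true]
    rw [← sum_root_mul_prod_eval_edgeForm r T hdiag hcard]
    have hdeg : ((∏ e ∈ T, edgeForm e) * X r).totalDegree ≤ Fintype.card V := by
      rw [← hcard]
      exact ((isHomogeneous_prod_edgeForm T).mul (isHomogeneous_X _ r)).totalDegree_le
    have h := sum_eval_eq_coeff _ hdeg
    rw [coeff_squarefreeExp_mul_X, if_pos (Finset.mem_univ r)] at h
    rw [← h]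
    refine Finset.sum_congr rfl fun x _ => ?_
    rw [map_mul, eval_X, map_prod, mul_comm]
  · rw [if_neg (fun h => hcard (hiff.1 h).2)]
    refine (isHomogeneous_prod_edgeForm T).coeff_eq_zero ?_
    rw [degree_squarefreeExp, Finset.card_erase_of_mem (Finset.mem_univ r), Finset.card_univ]
    have : 0 < Fintype.card V := Fintype.card_pos_iff.2 ⟨r⟩
    omega

/-- Modulo 2, the Kirchhoff polynomial is a coefficient of a product of affine forms. -/
theorem eval_kirchhoff {V : Type} [Fintype V] (G : SimpleGraph V) (r : V)
    (x : G.edgeSet → ZMod 2) :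
    eval x (map (Int.castRingHom (ZMod 2)) (kirchhoff G)) =
      coeff (squarefreeExp (Finset.univ.erase r))
        (∏ e : G.edgeSet, (C (x e) + edgeForm (e : Sym2 V))) := by
  have hexp : ∏ e : G.edgeSet, (C (x e) + edgeForm (e : Sym2 V)) =
      ∑ T ∈ G.edgeFinset.powerset, (C (∏ e : G.edgeSet, if (e : Sym2 V) ∈ T then 1 else x e)) *
        ∏ e ∈ T, edgeForm e := by
    let y : Sym2 V → ZMod 2 := fun e => if h : e ∈ G.edgeSet then x ⟨e, h⟩ else 0
    have hy : ∀ e : G.edgeSet, x e = y e := fun e => by simp [y]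
    have hprod : ∀ {R : Type} [CommMonoid R] (f : Sym2 V → R),
        ∏ e : G.edgeSet, f e = ∏ e ∈ G.edgeFinset, f e := fun {R} _ f =>
      (Finset.prod_subtype G.edgeFinset (fun e => by simp) f).symm
    simp only [hy]
    rw [hprod (fun e => C (y e) + edgeForm e), Finset.prod_congr rfl (fun e _ => add_comm _ _),
      Finset.prod_add]
    refine Finset.sum_congr rfl fun T hT => ?_
    rw [hprod (fun e => if e ∈ T then 1 else y e), mul_comm, map_prod,
      ← Finset.prod_sdiff (Finset.mem_powerset.1 hT)]
    congr 1
    rw [Finset.prod_eq_one (s := T) (fun e he => by simp [he]), mul_one]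
    exact Finset.prod_congr rfl fun e he => by simp [(Finset.mem_sdiff.1 he).2]
  rw [hexp, kirchhoff, map_sum, map_sum, coeff_sum, Finset.sum_filter]
  refine Finset.sum_congr rfl fun T hT => ?_
  rw [coeff_C_mul, coeff_prod_edgeForm G r T (by
    rw [← coe_edgeFinset]
    exact_mod_cast Finset.mem_powerset.1 hT)]
  split_ifs with h
  · simp only [map_prod, mul_one]
    exact Finset.prod_congr rfl fun e _ => by split_ifs <;> simp
  · simp

/-- The effect of multiplying a polynomial by `y + X u + X v` on its squarefree coefficients. -/
def addEdge (y : ZMod 2) (u v : ℕ) (R : Finset ℕ → ZMod 2) : Finset ℕ → ZMod 2 := fun S =>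
  y * R S + (if u ∈ S then R (S.erase u) else 0) + if v ∈ S then R (S.erase v) else 0

/-- The sum of `Φ` over all ways of attaching weights in `𝔽₂` to the edges in a list. -/
def sumEdges {M : Type} [AddCommMonoid M] (Φ : (Finset ℕ → ZMod 2) → M) :
    List (ℕ × ℕ) → (Finset ℕ → ZMod 2) → M
  | [], R => Φ R
  | p :: l, R => ∑ y, sumEdges Φ l (addEdge y p.1 p.2 R)

theorem sumEdges_append {M : Type} [AddCommMonoid M] (Φ : (Finset ℕ → ZMod 2) → M)
    (l l' : List (ℕ × ℕ)) (R : Finset ℕ → ZMod 2) :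
    sumEdges Φ (l ++ l') R = sumEdges (sumEdges Φ l') l R := by
  induction l generalizing R with
  | nil => rfl
  | cons p l ih => simp only [List.cons_append, sumEdges, ih]

theorem sumEdges_congr {M : Type} [AddCommMonoid M] {Φ Φ' : (Finset ℕ → ZMod 2) → M}
    (p : (Finset ℕ → ZMod 2) → Prop) (hΦ : ∀ R, p R → Φ R = Φ' R) (l : List (ℕ × ℕ))
    (hl : ∀ e ∈ l, ∀ y R, p R → p (addEdge y e.1 e.2 R)) (R : Finset ℕ → ZMod 2) (hR : p R) :
    sumEdges Φ l R = sumEdges Φ' l R := by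
  induction l generalizing R with
  | nil => exact hΦ R hR
  | cons e l ih =>
    exact Finset.sum_congr rfl fun y _ => ih (fun e' he' => hl e' (List.mem_cons_of_mem _ he')) _
      (hl e List.mem_cons_self y R hR)

theorem map_sumEdges {M N : Type} [AddCommMonoid M] [AddCommMonoid N] (f : M →+ N)
    (Φ : (Finset ℕ → ZMod 2) → M) (l : List (ℕ × ℕ)) (R : Finset ℕ → ZMod 2) :
    f (sumEdges Φ l R) = sumEdges (fun R => f (Φ R)) l R := by
  induction l generalizing R with
  | nil => rfl
  | cons e l ih => simp only [sumEdges, map_sum, ih]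

/-- The squarefree coefficients of a polynomial. -/
noncomputable def squarefreeCoeffs (P : MvPolynomial ℕ (ZMod 2)) : Finset ℕ → ZMod 2 := fun S =>
  coeff (squarefreeExp S) P

theorem squarefreeCoeffs_one : squarefreeCoeffs 1 = fun S => if S = ∅ then 1 else 0 := by
  funext S
  have h : 0 = squarefreeExp S ↔ S = ∅ := by
    constructor
    · intro h
      refine Finset.eq_empty_of_forall_notMem fun w hw => ?_
      have := DFunLike.congr_fun h w
      simp [squarefreeExp_apply, hw] at this
    · rintro rfl
      ext w
      simp [squarefreeExp_apply]
  simp [squarefreeCoeffs, coeff_one, h]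

theorem squarefreeCoeffs_mul (P : MvPolynomial ℕ (ZMod 2)) (y : ZMod 2) (u v : ℕ) :
    squarefreeCoeffs (P * (C y + edgeForm s(u, v))) = addEdge y u v (squarefreeCoeffs P) := by
  funext S
  rw [squarefreeCoeffs, edgeForm_mk, mul_add, mul_add, mul_comm P (C y), coeff_add, coeff_add,
    coeff_C_mul, coeff_squarefreeExp_mul_X, coeff_squarefreeExp_mul_X, addEdge, add_assoc]
  rfl

theorem sum_squarefreeCoeffs_prod {M : Type} [AddCommMonoid M] (Φ : (Finset ℕ → ZMod 2) → M)
    (l : List (ℕ × ℕ)) (P : MvPolynomial ℕ (ZMod 2)) :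
    ∑ x : Fin l.length → ZMod 2,
        Φ (squarefreeCoeffs (P * ∏ i, (C (x i) + edgeForm s((l.get i).1, (l.get i).2)))) =
      sumEdges Φ l (squarefreeCoeffs P) := by
  induction l generalizing P with
  | nil => simp [sumEdges]
  | cons p l ih =>
    rw [sumEdges]
    refine ((Fin.consEquiv fun _ : Fin (l.length + 1) => ZMod 2).sum_comp _).symm.trans ?_
    rw [Fintype.sum_prod_type]
    refine Finset.sum_congr rfl fun y _ => ?_
    rw [← squarefreeCoeffs_mul, ← ih]
    refine Finset.sum_congr rfl fun x _ => ?_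
    rw [mul_assoc]
    congr 3
    exact Fin.prod_univ_succ _

theorem mapDomain_squarefreeExp {V : Type} {ρ : V → ℕ} (hρ : Function.Injective ρ)
    (S : Finset V) : (squarefreeExp S).mapDomain ρ = squarefreeExp (S.image ρ) := by
  ext w
  by_cases hw : w ∈ Set.range ρ
  · obtain ⟨v, rfl⟩ := hw
    rw [Finsupp.mapDomain_apply hρ, squarefreeExp_apply, squarefreeExp_apply]
    simp [hρ.eq_iff]
  · rw [Finsupp.mapDomain_of_notMem_range _ _ hw, squarefreeExp_apply, if_neg]
    intro h
    obtain ⟨v, -, rfl⟩ := Finset.mem_image.1 h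
    exact hw ⟨v, rfl⟩

theorem rename_edgeForm {V : Type} (ρ : V → ℕ) (e : Sym2 V) :
    rename ρ (edgeForm e) = edgeForm (e.map ρ) := by
  induction e with
  | _ u v => simp

/-- The point count over `𝔽₂` as an iterated sum over a list of all edges. -/
theorem zeroCount_two_eq_sumEdges {V : Type} [Fintype V] (G : SimpleGraph V) (r : V) {ρ : V → ℕ}
    (hρ : Function.Injective ρ) {S : Finset ℕ} (hS : ∀ m, m ∈ S ↔ ∃ a ≠ r, ρ a = m)
    (l : List (ℕ × ℕ)) (hl : l.Nodup)
    (hlt : ∀ p ∈ l, p.1 < p.2 ∧ p.1 ∈ Set.range ρ ∧ p.2 ∈ Set.range ρ)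
    (hadj : ∀ a b, ρ a < ρ b → (G.Adj a b ↔ (ρ a, ρ b) ∈ l)) :
    zeroCount G 2 = sumEdges (fun R => if R S = 0 then 1 else 0) l
      (fun S => if S = ∅ then 1 else 0) := by
  have himage : (Finset.univ.erase r).image ρ = S := by
    ext m
    simp [hS]
  have hex : ∀ i : Fin l.length, ∃ e : G.edgeSet,
      (e : Sym2 V).map ρ = s((l.get i).1, (l.get i).2) := by
    intro i
    have hi := l.get_mem i
    obtain ⟨h1, ⟨a, ha⟩, ⟨b, hb⟩⟩ := hlt _ hi
    have hab : G.Adj a b := (hadj a b (by rwa [ha, hb])).2 (by rwa [ha, hb])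
    exact ⟨⟨s(a, b), hab⟩, by simp [ha, hb]⟩
  choose φ hφ using hex
  have hinj : Function.Injective φ := by
    intro i j hij
    have h := hφ i
    rw [hij, hφ j, Sym2.eq_iff] at h
    have hi := (hlt _ (l.get_mem i)).1
    have hj := (hlt _ (l.get_mem j)).1
    refine (List.nodup_iff_injective_get.1 hl) (Prod.ext ?_ ?_) <;> omega
  have hsurj : Function.Surjective φ := by
    have key : ∀ a b (hab : G.Adj a b), ρ a < ρ b → ∃ i, φ i = ⟨s(a, b), hab⟩ := by
      intro a b hab hlt'
      obtain ⟨i, hi⟩ := List.get_of_mem ((hadj a b hlt').1 hab)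
      refine ⟨i, Subtype.ext (Sym2.map.injective hρ ?_)⟩
      rw [hφ, hi, Sym2.map_mk]
    rintro ⟨e, he⟩
    induction e with
    | _ a b =>
      have hab : G.Adj a b := he
      rcases lt_or_gt_of_ne (hρ.ne hab.ne) with h | h
      · exact key a b hab h
      · obtain ⟨i, hi⟩ := key b a hab.symm h
        exact ⟨i, hi.trans (Subtype.ext Sym2.eq_swap)⟩
  let ε : Fin l.length ≃ G.edgeSet := Equiv.ofBijective φ ⟨hinj, hsurj⟩
  have hsum := sum_squarefreeCoeffs_prod (fun R => if R S = 0 then 1 else 0) l 1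
  rw [squarefreeCoeffs_one] at hsum
  rw [← hsum, zeroCount, Nat.card_eq_fintype_card, Fintype.card_subtype, Finset.card_filter,
    ← (Equiv.arrowCongr ε (Equiv.refl (ZMod 2))).sum_comp]
  refine Finset.sum_congr rfl fun x _ => ?_
  rw [eval_kirchhoff G r, ← coeff_rename_mapDomain ρ hρ, mapDomain_squarefreeExp hρ, himage,
    map_prod, ← ε.prod_comp, one_mul, squarefreeCoeffs]
  have hx : ∀ i, rename ρ (C (Equiv.arrowCongr ε (Equiv.refl (ZMod 2)) x (ε i)) +
      edgeForm ((ε i : G.edgeSet) : Sym2 V)) =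
        C (x i) + edgeForm s((l.get i).1, (l.get i).2) := by
    intro i
    rw [map_add, rename_C, rename_edgeForm, show ((ε i : G.edgeSet) : Sym2 V).map ρ = _ from hφ i]
    simp [Equiv.arrowCongr_apply]
  simp only [hx]

/-- The block `B` together with some of the frontier vertices `i, i + 1, i + 2, i + 3`. -/
def block (B : Finset ℕ) (i : ℕ) (a b c d : Bool) : Finset ℕ :=
  B ∪ (if a then {i} else ∅) ∪ (if b then {i + 1} else ∅) ∪ (if c then {i + 2} else ∅) ∪
    if d then {i + 3} else ∅

/-- The values of `R` on the sets obtained from the block `B` by adding some of the frontier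
vertices `i, i + 1, i + 2`. -/
def window (R : Finset ℕ → ZMod 2) (B : Finset ℕ) (i : ℕ) (a b c : Bool) : ZMod 2 :=
  R (block B i a b c false)

/-- The effect on a window of attaching edges `{i, i + 1}` and `{i, i + 3}` of weights `y`, `z`. -/
def transfer (y z : ZMod 2) (r : Bool → Bool → Bool → ZMod 2) : Bool → Bool → Bool → ZMod 2
  | a, b, false => (y + z) * r false a b + y * z * r true a b +
      if a then r false false b + z * r true false b else 0
  | a, b, true => r false a b + y * r true a b + if a then r true false b else 0

/-- The value on the full vertex set `B ∪ {i, i + 1, i + 2}` after attaching the edges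
`{i, i + 1}`, `{i + 1, i + 2}` and `{2, i + 2}` of weights `y`, `z`, `w`. -/
def closeFull (y z w : ZMod 2) (r : Bool → Bool → Bool → ZMod 2) : ZMod 2 :=
  w * (z * (y * r true true true + r false true true + r true false true) +
      (y * r true false true + r false false true) +
      (y * r true true false + r false true false + r true false false)) +
    (z * (y * r true true false + r false true false + r true false false) +
      (y * r true false false + r false false false))

/-- As `closeFull`, for the set `B ∪ {i, i + 2}`. -/
def closeMid (y z w : ZMod 2) (r : Bool → Bool → Bool → ZMod 2) : ZMod 2 :=
  w * (z * (y * r true false true + r false false true) +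
      (y * r true false false + r false false false)) +
    z * (y * r true false false + r false false false)

/-- The sum over the weights of the three closing edges, as a polynomial in the windows. -/
def finForm (r q : Bool → Bool → Bool → ZMod 2) : ZMod 2 :=
  r true false true + r true false true * r false true true + r true true true +
      r false false true * r true true true + r true false true * r true true true +
      r true false true * q false false false +
      r true false true * r false true true * q false false false +
      r true true true * q false false false +
      r false false true * r true true true * q false false false +
      r true false true * r true true true * q false false false +
      r true false false * r false false true * q true false false +
      r true false true * q true false false +
      r false false false * r true false true * q true false false +
      r true false false * r true false true * q true false false +
      r false false true * r true false true * q true false false +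
      r false true true * q true false false +
      r false false true * r false true true * q true false false +
      r true false true * r false true true * q true false false +
      r true true true * q true false false +
      r false false true * r true true true * q true false false +
      r true false true * r true true true * q true false false +
      r true false false * r false false true * q false true false +
      r true false true * q false true false +
      r false false false * r true false true * q false true false +
      r true false false * r true false true * q false true false +
      r false false true * q true true false +
      r false false false * r false false true * q true true false +
      r true false false * r false false true * q true true false +
      r true false true * q true true false +
      r false false false * r true false true * q true true false +
      r true false false * r true false true * q true true false +
      r true false false * q false false true +
      r true false false * r false true false * q false false true +
      r true true false * q false false true +
      r false false false * r true true false * q false false true +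
      r true false false * r true true false * q false false true +
      r true false true * q false false true +
      r true false true * r false true true * q false false true +
      r true true true * q false false true +
      r false false true * r true true true * q false false true +
      r true false true * r true true true * q false false true +
      r true false false * q true false true +
      r false false false * r true false false * q true false true +
      r false true false * q true false true +
      r false false false * r false true false * q true false true +
      r true false false * r false true false * q true false true +
      r true true false * q true false true +
      r false false false * r true true false * q true false true +
      r true false false * r true true false * q true false true +
      r true false false * r false false true * q true false true +
      r false false false * r true false true * q true false true +
      r true false false * r true false true * q true false true +
      r false false true * r true false true * q true false true +
      r false true true * q true false true +
      r false false true * r false true true * q true false true +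
      r true false false * q false true true +
      r true false false * r false false true * q false true true +
      r false false false * r true false true * q false true true +
      r true false false * r true false true * q false true true +
      r true false true * r false true true * q false true true +
      r true true true * q false true true +
      r false false true * r true true true * q false true true +
      r true false true * r true true true * q false true true + q true true true +
      r false false false * q true true true + r true false false * q true true true +
      r false false true * q true true true +
      r false false false * r false false true * q true true true +
      r true false false * r false false true * q true true true +
      r true false true * q true true true +
      r false false false * r true false true * q true true true +
      r true false false * r true false true * q true true true +
      r false false true * r true false true * q true true true +
      r false true true * q true true true +
      r false false true * r false true true * q true true true +
      r true false true * r false true true * q true true true +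
      r true true true * q true true true +
      r false false true * r true true true * q true true true +
      r true false true * r true true true * q true true true

/-- The sum over an odd number of rounds and the closing edges. -/
def oddForm (r q : Bool → Bool → Bool → ZMod 2) : ZMod 2 :=
  q false false false * (r true true false + r true true false * r false true true +
      r false true false * r true true true) +
    q true false false * (r false true false + r true false false * r false true false +
        r false false false * r true true false + r false true false * r true true false +
        r false true false * r false false true + r false false false * r false true true) +
    q false true false * (r true false false + r true false false * r false true false +
        r true true false + r false false false * r true true false +
        r false true false * r true true false + r true false false * r false false true +
        r false false false * r true false true + r true true false * r false true true +
        r false true false * r true true true) +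
    q true true false * (r false false false * r true false false + r false true false +
        r false false false * r false true false + r true false false * r false true false +
        r false false false * r true true false + r false true false * r true true false +
        r false true false * r false false true + r false false false * r false true true +
        r true true false * r false true true + r false true false * r true true true) +
    q false false true * (r false true false * r true true false) +
    q true false true * (r false false false * r false true false) +
    q false true true * (r false false false * r true false false + r true true false +
        r false true false * r true true false) +
    q true true true * (r false true false + r false false false * r false true false +
        r false true false * r true true false)

/-- The sum over a positive even number of rounds and the closing edges. -/
def evenForm (r q : Bool → Bool → Bool → ZMod 2) : ZMod 2 :=
  q false false false * (r true true false * r true false true +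
      r true false true * r false true true + r true false false * r true true true +
      r false false true * r true true true) +
    q true false false * (r false false true + r true false false * r false false true +
        r false true false * r false false true + r false false false * r true false true +
        r true false false * r true false true + r true true false * r true false true +
        r false false true * r true false true + r false false false * r false true true +
        r true false true * r false true true + r true true true +
        r true false false * r true true true + r false false true * r true true true) +
    q false true false * (r true false false * r true false true +
        r false false true * r true false true) +
    q true true false * (r false false false * r false false true +
        r true false false * r true false true + r true true false * r true false true +
        r false false true * r true false true + r true false false * r true true true +
        r true false true * r true true true) +
    q false false true * (r true false false + r true false false * r false true false +
        r false false false * r true true false + r true false false * r false false true +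
        r false false false * r true false true + r true false false * r true false true +
        r true true false * r true false true + r false false true * r true false true +
        r true false true * r false true true + r true true true +
        r true false false * r true true true + r false false true * r true true true) +
    q true false true * (r true false false + r false false false * r true false false +
        r true false false * r false true false + r true true false +
        r false false false * r true true false + r false false true +
        r false false false * r false false true + r false true false * r false false true +
        r false true true + r false false false * r false true true) +
    q false true true * (r false false false * r true false false +
        r true false false * r true false true + r false false true * r true false true +
        r true false true * r false true true + r false false true * r true true true +
        r true false true * r true true true) +
    q true true true * (r true false false + r false false false * r true false false +
        r true false false * r true true false + r false false true +
        r false false false * r false false true + r true true false * r true false true +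
        r false false true * r false true true + r true false true * r false true true +
        r true false false * r true true true + r false false true * r true true true)

theorem sq_zmod_two (x : ZMod 2) : x ^ 2 = x := by revert x; decide

theorem numerals_zmod_two :
    (2 : ZMod 2) = 0 ∧ (3 : ZMod 2) = 1 ∧ (4 : ZMod 2) = 0 ∧ (5 : ZMod 2) = 1 ∧
    (6 : ZMod 2) = 0 ∧ (7 : ZMod 2) = 1 ∧ (8 : ZMod 2) = 0 ∧ (9 : ZMod 2) = 1 ∧
    (10 : ZMod 2) = 0 ∧ (11 : ZMod 2) = 1 ∧ (12 : ZMod 2) = 0 ∧ (13 : ZMod 2) = 1 ∧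
    (14 : ZMod 2) = 0 ∧ (15 : ZMod 2) = 1 ∧ (16 : ZMod 2) = 0 ∧ (17 : ZMod 2) = 1 ∧
    (18 : ZMod 2) = 0 ∧ (19 : ZMod 2) = 1 ∧ (20 : ZMod 2) = 0 ∧ (21 : ZMod 2) = 1 ∧
    (22 : ZMod 2) = 0 ∧ (23 : ZMod 2) = 1 ∧ (24 : ZMod 2) = 0 ∧ (25 : ZMod 2) = 1 ∧
    (26 : ZMod 2) = 0 ∧ (27 : ZMod 2) = 1 ∧ (28 : ZMod 2) = 0 ∧ (29 : ZMod 2) = 1 ∧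
    (30 : ZMod 2) = 0 ∧ (31 : ZMod 2) = 1 ∧ (32 : ZMod 2) = 0 ∧ (33 : ZMod 2) = 1 ∧
    (34 : ZMod 2) = 0 ∧ (35 : ZMod 2) = 1 ∧ (36 : ZMod 2) = 0 ∧ (37 : ZMod 2) = 1 ∧
    (38 : ZMod 2) = 0 ∧ (39 : ZMod 2) = 1 ∧ (40 : ZMod 2) = 0 ∧ (41 : ZMod 2) = 1 ∧
    (42 : ZMod 2) = 0 ∧ (43 : ZMod 2) = 1 ∧ (44 : ZMod 2) = 0 ∧ (45 : ZMod 2) = 1 ∧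
    (46 : ZMod 2) = 0 ∧ (47 : ZMod 2) = 1 ∧ (48 : ZMod 2) = 0 ∧ (49 : ZMod 2) = 1 ∧
    (50 : ZMod 2) = 0 ∧ (51 : ZMod 2) = 1 ∧ (52 : ZMod 2) = 0 ∧ (53 : ZMod 2) = 1 ∧
    (54 : ZMod 2) = 0 ∧ (55 : ZMod 2) = 1 ∧ (56 : ZMod 2) = 0 ∧ (57 : ZMod 2) = 1 ∧
    (58 : ZMod 2) = 0 ∧ (59 : ZMod 2) = 1 ∧ (60 : ZMod 2) = 0 ∧ (61 : ZMod 2) = 1 ∧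
    (62 : ZMod 2) = 0 ∧ (63 : ZMod 2) = 1 ∧ (64 : ZMod 2) = 0 ∧ (65 : ZMod 2) = 1 := by
  decide

set_option maxHeartbeats 4000000 in
set_option maxRecDepth 100000 in
theorem sum_close (r q : Bool → Bool → Bool → ZMod 2) :
    ∑ y, ∑ z, ∑ w, (1 + (1 + closeFull y z w r) * (1 + closeMid y z w r) *
        (1 + closeFull y z w q)) = finForm r q := by
  rw [← CharTwo.add_eq_zero]
  simp only [sum_zmod_two, closeFull, closeMid, finForm, zero_mul, one_mul, zero_add, add_zero]
  ring_nf
  simp only [numerals_zmod_two, sq_zmod_two, mul_zero, mul_one, add_zero, zero_add]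
  ring_nf
  simp only [numerals_zmod_two, mul_zero, add_zero]

set_option maxHeartbeats 4000000 in
set_option maxRecDepth 100000 in
theorem sum_finForm_transfer (r q : Bool → Bool → Bool → ZMod 2) :
    ∑ y, ∑ z, finForm (transfer y z r) (transfer y z q) = oddForm r q := by
  rw [← CharTwo.add_eq_zero]
  simp only [sum_zmod_two, finForm, oddForm, transfer, if_true, if_false, Bool.false_eq_true,
    zero_mul, one_mul, zero_add, add_zero, mul_zero]
  ring_nf
  simp only [numerals_zmod_two, sq_zmod_two, mul_zero, mul_one, add_zero, zero_add]
  ring_nf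
  simp only [numerals_zmod_two, mul_zero, add_zero]

set_option maxHeartbeats 4000000 in
set_option maxRecDepth 100000 in
theorem sum_oddForm_transfer (r q : Bool → Bool → Bool → ZMod 2) :
    ∑ y, ∑ z, oddForm (transfer y z r) (transfer y z q) = evenForm r q := by
  rw [← CharTwo.add_eq_zero]
  simp only [sum_zmod_two, oddForm, evenForm, transfer, if_true, if_false, Bool.false_eq_true,
    zero_mul, one_mul, zero_add, add_zero, mul_zero]
  ring_nf
  simp only [numerals_zmod_two, sq_zmod_two, mul_zero, mul_one, add_zero, zero_add]
  ring_nf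
  simp only [numerals_zmod_two, mul_zero, add_zero]

set_option maxHeartbeats 4000000 in
set_option maxRecDepth 100000 in
theorem sum_evenForm_transfer (r q : Bool → Bool → Bool → ZMod 2) :
    ∑ y, ∑ z, evenForm (transfer y z r) (transfer y z q) = oddForm r q := by
  rw [← CharTwo.add_eq_zero]
  simp only [sum_zmod_two, evenForm, oddForm, transfer, if_true, if_false, Bool.false_eq_true,
    zero_mul, one_mul, zero_add, add_zero, mul_zero]
  ring_nf
  simp only [numerals_zmod_two, sq_zmod_two, mul_zero, mul_one, add_zero, zero_add]
  ring_nf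
  simp only [numerals_zmod_two, mul_zero, add_zero]

theorem mem_block {B : Finset ℕ} {i : ℕ} {a b c d : Bool} {x : ℕ} :
    x ∈ block B i a b c d ↔
      x ∈ B ∨ a ∧ x = i ∨ b ∧ x = i + 1 ∨ c ∧ x = i + 2 ∨ d ∧ x = i + 3 := by
  cases a <;> cases b <;> cases c <;> cases d <;> simp [block] <;> grind

theorem addEdge_block_succ {B : Finset ℕ} {i : ℕ} (hB : ∀ x ∈ B, x < i) (y : ZMod 2)
    (R : Finset ℕ → ZMod 2) (a b c d : Bool) :
    addEdge y i (i + 1) R (block B i a b c d) = y * R (block B i a b c d) +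
      (if a then R (block B i false b c d) else 0) +
      if b then R (block B i a false c d) else 0 := by
  have ha : i ∈ block B i a b c d ↔ a := by have := hB i; grind [mem_block]
  have hb : i + 1 ∈ block B i a b c d ↔ b := by have := hB (i + 1); grind [mem_block]
  have ea : (block B i a b c d).erase i = block B i false b c d := by
    ext x; have := hB x; grind [mem_block]
  have eb : (block B i a b c d).erase (i + 1) = block B i a false c d := by
    ext x; have := hB x; grind [mem_block]
  simp only [addEdge, ha, hb, ea, eb]

theorem addEdge_block_add_three {B : Finset ℕ} {i : ℕ} (hB : ∀ x ∈ B, x < i) (y : ZMod 2)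
    (R : Finset ℕ → ZMod 2) (a b c d : Bool) :
    addEdge y i (i + 3) R (block B i a b c d) = y * R (block B i a b c d) +
      (if a then R (block B i false b c d) else 0) +
      if d then R (block B i a b c false) else 0 := by
  have ha : i ∈ block B i a b c d ↔ a := by have := hB i; grind [mem_block]
  have hd : i + 3 ∈ block B i a b c d ↔ d := by have := hB (i + 3); grind [mem_block]
  have ea : (block B i a b c d).erase i = block B i false b c d := by
    ext x; have := hB x; grind [mem_block]
  have ed : (block B i a b c d).erase (i + 3) = block B i a b c false := by
    ext x; have := hB x; grind [mem_block]
  simp only [addEdge, ha, hd, ea, ed]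

theorem addEdge_succ_block_add_two {B : Finset ℕ} {i : ℕ} (hB : ∀ x ∈ B, x < i) (y : ZMod 2)
    (R : Finset ℕ → ZMod 2) (a b c d : Bool) :
    addEdge y (i + 1) (i + 2) R (block B i a b c d) = y * R (block B i a b c d) +
      (if b then R (block B i a false c d) else 0) +
      if c then R (block B i a b false d) else 0 := by
  have hb : i + 1 ∈ block B i a b c d ↔ b := by have := hB (i + 1); grind [mem_block]
  have hc : i + 2 ∈ block B i a b c d ↔ c := by have := hB (i + 2); grind [mem_block]
  have eb : (block B i a b c d).erase (i + 1) = block B i a false c d := by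
    ext x; have := hB x; grind [mem_block]
  have ec : (block B i a b c d).erase (i + 2) = block B i a b false d := by
    ext x; have := hB x; grind [mem_block]
  simp only [addEdge, hb, hc, eb, ec]

theorem addEdge_two_block {B : Finset ℕ} {i : ℕ} (hB : ∀ x ∈ B, x < i) (hB₂ : 2 ∉ B) (hi : 3 ≤ i)
    (y : ZMod 2) (R : Finset ℕ → ZMod 2) (a b c d : Bool) :
    addEdge y 2 (i + 2) R (block B i a b c d) = y * R (block B i a b c d) +
      if c then R (block B i a b false d) else 0 := by
  have h2 : ¬ 2 ∈ block B i a b c d := by grind [mem_block]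
  have hc : i + 2 ∈ block B i a b c d ↔ c := by have := hB (i + 2); grind [mem_block]
  have ec : (block B i a b c d).erase (i + 2) = block B i a b false d := by
    ext x; have := hB x; grind [mem_block]
  simp only [addEdge, h2, hc, ec, if_false, add_zero]

/-- `R` vanishes on the sets with an element exceeding `m`. -/
def SupportedUpTo (m : ℕ) (R : Finset ℕ → ZMod 2) : Prop :=
  ∀ S, (∃ s ∈ S, m < s) → R S = 0

theorem SupportedUpTo.mono {m m' : ℕ} (h : m ≤ m') {R : Finset ℕ → ZMod 2}
    (hR : SupportedUpTo m R) : SupportedUpTo m' R :=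
  fun S ⟨s, hs, hms⟩ => hR S ⟨s, hs, h.trans_lt hms⟩

theorem SupportedUpTo.addEdge {m u v : ℕ} (hu : u ≤ m) (hv : v ≤ m) {R : Finset ℕ → ZMod 2}
    (hR : SupportedUpTo m R) (y : ZMod 2) : SupportedUpTo m (addEdge y u v R) := by
  rintro S ⟨s, hs, hms⟩
  have he : ∀ w ≤ m, R (S.erase w) = 0 := fun w hw =>
    hR _ ⟨s, Finset.mem_erase.2 ⟨by omega, hs⟩, hms⟩
  simp [SkewTorus.addEdge, hR S ⟨s, hs, hms⟩, he u hu, he v hv]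

/-- Attaching the edges `{i, i + 1}` and `{i, i + 3}` moves the window by one step. -/
theorem window_addEdge_addEdge {B : Finset ℕ} {i : ℕ} (hB : ∀ x ∈ B, x < i)
    {R : Finset ℕ → ZMod 2} (hR : SupportedUpTo (i + 2) R) (y z : ZMod 2) :
    window (addEdge z i (i + 3) (addEdge y i (i + 1) R)) (insert i B) (i + 1) =
      transfer y z (window R B i) := by
  funext a b c
  have hb : block (insert i B) (i + 1) a b c false = block B i true a b c := by
    ext x; grind [mem_block]
  have h0 : ∀ a b c, R (block B i a b c true) = 0 := fun a b c =>
    hR _ ⟨i + 3, by simp [mem_block], by omega⟩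
  rw [window, hb]
  simp only [addEdge_block_add_three hB, addEdge_block_succ hB]
  cases c <;> cases a <;> simp [transfer, window, h0] <;> ring

theorem window_Ico_addEdge_addEdge {i : ℕ} (hi : 3 ≤ i) {R : Finset ℕ → ZMod 2}
    (hR : SupportedUpTo (i + 2) R) (y z : ZMod 2) :
    window (addEdge z i (i + 3) (addEdge y i (i + 1) R)) (Finset.Ico 3 (i + 1)) (i + 1) =
      transfer y z (window R (Finset.Ico 3 i) i) := by
  have hins : insert i (Finset.Ico 3 i) = Finset.Ico 3 (i + 1) := by
    ext x; simp; omega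
  rw [← hins, window_addEdge_addEdge (fun x hx => (Finset.mem_Ico.1 hx).2) hR]

/-- The coefficients multiplied by `X 4`. -/
def mark (R : Finset ℕ → ZMod 2) : Finset ℕ → ZMod 2 := fun S =>
  if 4 ∈ S then R (S.erase 4) else 0

theorem mark_addEdge (y : ZMod 2) (u v : ℕ) (R : Finset ℕ → ZMod 2) :
    mark (addEdge y u v R) = addEdge y u v (mark R) := by
  funext S
  have h : ∀ w, (if 4 ∈ S then if w ∈ S.erase 4 then R ((S.erase 4).erase w) else 0 else 0) =
      if w ∈ S then mark R (S.erase w) else 0 := by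
    intro w
    rw [Finset.erase_right_comm]
    by_cases hw : w = 4
    · simp [hw, mark]
    · simp only [mark, Finset.mem_erase, ne_eq, hw, Ne.symm hw, not_false_eq_true, true_and]
      split_ifs <;> rfl
  rw [addEdge, ← h, ← h, mark, mark]
  by_cases h4 : 4 ∈ S
  · simp only [h4, if_true, addEdge]
  · simp only [h4, if_false, mul_zero, add_zero]

theorem SupportedUpTo.mark {m : ℕ} (hm : 4 ≤ m) {R : Finset ℕ → ZMod 2}
    (hR : SupportedUpTo m R) : SupportedUpTo m (mark R) := by
  rintro S ⟨s, hs, hms⟩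
  have he : R (S.erase 4) = 0 := hR _ ⟨s, Finset.mem_erase.2 ⟨by omega, hs⟩, hms⟩
  simp [SkewTorus.mark, he]

/-- The edges `{s, s + 1}` and `{s, s + 3}` for `i ≤ s < i + j`. -/
def rounds (i : ℕ) : ℕ → List (ℕ × ℕ)
  | 0 => []
  | j + 1 => (i, i + 1) :: (i, i + 3) :: rounds (i + 1) j

theorem mem_rounds {i j : ℕ} {p : ℕ × ℕ} :
    p ∈ rounds i j ↔ i ≤ p.1 ∧ p.1 < i + j ∧ (p.2 = p.1 + 1 ∨ p.2 = p.1 + 3) := by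
  obtain ⟨u, v⟩ := p
  induction j generalizing i with
  | zero => simp [rounds]; omega
  | succ j ih => simp only [rounds, List.mem_cons, Prod.mk.injEq, ih]; omega

theorem nodup_rounds (i j : ℕ) : (rounds i j).Nodup := by
  induction j generalizing i with
  | zero => exact List.nodup_nil
  | succ j ih => simp [rounds, mem_rounds, ih]

/-- The last edges on the vertices `2, …, m + 2`. -/
def closing (m : ℕ) : List (ℕ × ℕ) := [(m, m + 1), (m + 1, m + 2), (2, m + 2)]

/-- Whether one of the values at `S`, `S \ {c}` and `S \ {4}` is nonzero, where
`S = {3, …, m + 2}` and `c = m + 1`, as an element of `𝔽₂`. -/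
def defect (m : ℕ) (R : Finset ℕ → ZMod 2) : ZMod 2 :=
  1 + (1 + R (Finset.Ico 3 (m + 3))) * (1 + R ((Finset.Ico 3 (m + 3)).erase (m + 1))) *
    (1 + R ((Finset.Ico 3 (m + 3)).erase 4))

theorem sumEdges_closing {m : ℕ} (hm : 3 ≤ m) (R : Finset ℕ → ZMod 2) :
    sumEdges (defect m) (closing m) R =
      finForm (window R (Finset.Ico 3 m) m) (window (mark R) (Finset.Ico 3 m) m) := by
  have hB : ∀ x ∈ Finset.Ico 3 m, x < m := fun x hx => (Finset.mem_Ico.1 hx).2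
  have hB₂ : 2 ∉ Finset.Ico 3 m := by simp
  have hfull : Finset.Ico 3 (m + 3) = block (Finset.Ico 3 m) m true true true false := by
    ext x; simp [mem_block]; omega
  have hmid : (Finset.Ico 3 (m + 3)).erase (m + 1) =
      block (Finset.Ico 3 m) m true false true false := by
    ext x; simp [mem_block]; omega
  have key : ∀ (y z w : ZMod 2) (Q : Finset ℕ → ZMod 2),
      addEdge w 2 (m + 2) (addEdge z (m + 1) (m + 2) (addEdge y m (m + 1) Q))
          (Finset.Ico 3 (m + 3)) = closeFull y z w (window Q (Finset.Ico 3 m) m) := by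
    intro y z w Q
    rw [hfull]
    simp [addEdge_two_block hB hB₂ hm, addEdge_succ_block_add_two hB, addEdge_block_succ hB,
      closeFull, window]
  rw [← sum_close]
  refine Finset.sum_congr rfl fun y _ => Finset.sum_congr rfl fun z _ =>
    Finset.sum_congr rfl fun w _ => ?_
  have hdefect : ∀ Q : Finset ℕ → ZMod 2, defect m Q = 1 + (1 + Q (Finset.Ico 3 (m + 3))) *
      (1 + Q (block (Finset.Ico 3 m) m true false true false)) *
      (1 + mark Q (Finset.Ico 3 (m + 3))) := fun Q => by
    rw [mark, if_pos (Finset.mem_Ico.2 ⟨by omega, by omega⟩), defect, hmid]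
  simp only [sumEdges]
  rw [hdefect, mark_addEdge, mark_addEdge, mark_addEdge, key, key]
  simp [addEdge_two_block hB hB₂ hm, addEdge_succ_block_add_two hB, addEdge_block_succ hB,
    closeMid, window]

/-- The sum over at least one round and the closing edges. -/
theorem sumEdges_rounds_closing (j : ℕ) {i : ℕ} (hi : 3 ≤ i) {R : Finset ℕ → ZMod 2}
    (hR : SupportedUpTo (i + 2) R) :
    sumEdges (defect (i + j + 1)) (rounds i (j + 1) ++ closing (i + j + 1)) R =
      if Even j then oddForm (window R (Finset.Ico 3 i) i) (window (mark R) (Finset.Ico 3 i) i)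
      else evenForm (window R (Finset.Ico 3 i) i) (window (mark R) (Finset.Ico 3 i) i) := by
  induction j generalizing i R with
  | zero =>
    rw [if_pos Even.zero, ← sum_finForm_transfer]
    refine Finset.sum_congr rfl fun y _ => Finset.sum_congr rfl fun z _ => ?_
    rw [← window_Ico_addEdge_addEdge hi hR, ← window_Ico_addEdge_addEdge hi (hR.mark (by omega)),
      ← mark_addEdge, ← mark_addEdge]
    exact sumEdges_closing (by omega) _
  | succ j ih =>
    have step : ∀ y z : ZMod 2, SupportedUpTo (i + 1 + 2)
        (addEdge z i (i + 3) (addEdge y i (i + 1) R)) := fun y z =>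
      (((hR.mono (by omega)).addEdge (by omega) (by omega) y).addEdge (by omega) (by omega) z)
    have hsum : sumEdges (defect (i + (j + 1) + 1))
        (rounds i (j + 1 + 1) ++ closing (i + (j + 1) + 1)) R =
        ∑ y, ∑ z, if Even j then
          oddForm (transfer y z (window R (Finset.Ico 3 i) i))
            (transfer y z (window (mark R) (Finset.Ico 3 i) i))
        else evenForm (transfer y z (window R (Finset.Ico 3 i) i))
            (transfer y z (window (mark R) (Finset.Ico 3 i) i)) := by
      refine Finset.sum_congr rfl fun y _ => Finset.sum_congr rfl fun z _ => ?_
      rw [← window_Ico_addEdge_addEdge hi hR,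
        ← window_Ico_addEdge_addEdge hi (hR.mark (by omega)), ← mark_addEdge, ← mark_addEdge,
        ← ih (by omega) (step y z), show i + 1 + j + 1 = i + (j + 1) + 1 by omega]
      rfl
    rw [hsum]
    by_cases hj : Even j
    · simp only [hj, if_true, sum_oddForm_transfer, Nat.even_add_one, not_true_eq_false, if_false]
    · simp only [hj, if_false, sum_evenForm_transfer, Nat.even_add_one, not_false_eq_true, if_true]

/-- The sum over all edges not incident to the vertex `1`. -/
theorem sumEdges_defect (j : ℕ) :
    sumEdges (defect (j + 4)) ([(2, 3), (2, 5)] ++ (rounds 3 (j + 1) ++ closing (j + 4)))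
      (fun S => if S = ∅ then 1 else 0) = if Even j then 1 else 0 := by
  have h0 : SupportedUpTo 5 (fun S : Finset ℕ => if S = ∅ then (1 : ZMod 2) else 0) :=
    fun S ⟨s, hs, _⟩ => if_neg (Finset.ne_empty_of_mem hs)
  have h : ∀ y z : ZMod 2, SupportedUpTo 5
      (addEdge z 2 5 (addEdge y 2 3 fun S => if S = ∅ then 1 else 0)) := fun y z =>
    (h0.addEdge (by omega) (by omega) y).addEdge (by omega) (by omega) z
  have hsum : sumEdges (defect (j + 4))
      ([(2, 3), (2, 5)] ++ (rounds 3 (j + 1) ++ closing (j + 4)))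
      (fun S => if S = ∅ then 1 else 0) = ∑ y, ∑ z, sumEdges (defect (3 + j + 1))
        (rounds 3 (j + 1) ++ closing (3 + j + 1))
        (addEdge z 2 5 (addEdge y 2 3 fun S => if S = ∅ then 1 else 0)) := by
    rw [show 3 + j + 1 = j + 4 by omega]
    rfl
  rw [hsum]
  simp only [sumEdges_rounds_closing j le_rfl (h _ _)]
  by_cases hj : Even j
  · simp only [hj, if_true]
    decide +kernel
  · simp only [hj, if_false]
    decide +kernel

/-- The sum over the three edges incident to the vertex `1`. -/
theorem sumEdges_vertex_one {S : Finset ℕ} {c : ℕ} (h1 : 1 ∉ S) (h2 : 2 ∉ S) (h4 : 4 ∈ S)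
    (hc : c ∈ S) (hc4 : c ≠ 4) {R : Finset ℕ → ZMod 2} (hR : ∀ S, 1 ∈ S → R S = 0) :
    ((sumEdges (fun R => if R (insert 1 S) = 0 then 1 else 0) [(1, 2), (1, 4), (1, c)] R : ℕ) :
      ZMod 8) = ((4 * if R S = 0 ∧ R (S.erase c) = 0 ∧ R (S.erase 4) = 0 then 0 else 1 : ℕ) :
        ZMod 8) := by
  have hc1 : c ≠ 1 := by rintro rfl; exact h1 hc
  have hval : ∀ y₁ y₂ y₃ : ZMod 2,
      addEdge y₃ 1 c (addEdge y₂ 1 4 (addEdge y₁ 1 2 R)) (insert 1 S) =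
        (y₁ * y₂ + y₁ * y₃ + y₂ * y₃) * R S + (y₁ + y₃) * R (S.erase 4) +
          (y₁ + y₂) * R (S.erase c) + R ((S.erase c).erase 4) := by
    intro y₁ y₂ y₃
    have e1 : (insert 1 S).erase 1 = S := Finset.erase_insert h1
    have ec : (insert 1 S).erase c = insert 1 (S.erase c) := by grind
    have e4 : ∀ T : Finset ℕ, (insert 1 T).erase 4 = insert 1 (T.erase 4) := by grind
    have e1' : ∀ T ⊆ S, (insert 1 T).erase 1 = T := fun T hT =>
      Finset.erase_insert fun h => h1 (hT h)
    have hsub : (S.erase c).erase 4 ⊆ S := by grind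
    simp [addEdge, e1, ec, e4, h1, h2, h4, hc, hc4.symm, hc1, hc1.symm, hR,
      e1' _ (S.erase_subset c), e1' _ (S.erase_subset 4), e1' _ hsub]
    ring
  simp only [sumEdges, hval]
  generalize R S = f
  generalize R (S.erase 4) = g
  generalize R (S.erase c) = g'
  generalize R ((S.erase c).erase 4) = h
  revert f g g' h
  decide +kernel

theorem natCast_ite_eq_defect (m : ℕ) (R : Finset ℕ → ZMod 2) :
    ((if R (Finset.Ico 3 (m + 3)) = 0 ∧ R ((Finset.Ico 3 (m + 3)).erase (m + 1)) = 0 ∧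
      R ((Finset.Ico 3 (m + 3)).erase 4) = 0 then 0 else 1 : ℕ) : ZMod 2) = defect m R := by
  rw [defect]
  generalize R (Finset.Ico 3 (m + 3)) = f
  generalize R ((Finset.Ico 3 (m + 3)).erase (m + 1)) = g
  generalize R ((Finset.Ico 3 (m + 3)).erase 4) = g'
  revert f g g'
  decide

/-- The edges `(u, v)`, `u < v`, of the decompletion of `C_{j + 7}(1, 3)`. -/
def edges (j : ℕ) : List (ℕ × ℕ) :=
  ([(2, 3), (2, 5)] ++ (rounds 3 (j + 1) ++ closing (j + 4))) ++ [(1, 2), (1, 4), (1, j + 5)]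

theorem sumEdges_edges_modEq {j : ℕ} :
    sumEdges (fun R => if R (insert 1 (Finset.Ico 3 (j + 7))) = 0 then 1 else 0) (edges j)
      (fun S => if S = ∅ then 1 else 0) ≡ 4 * (j + 1) [MOD 8] := by
  rw [edges, sumEdges_append]
  set l := [(2, 3), (2, 5)] ++ (rounds 3 (j + 1) ++ closing (j + 4)) with hl
  set S := Finset.Ico 3 (j + 7) with hS
  set M := sumEdges (fun R => if R S = 0 ∧ R (S.erase (j + 5)) = 0 ∧ R (S.erase 4) = 0
    then 0 else 1) l (fun S => if S = ∅ then 1 else 0) with hM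
  have hM2 : (M : ZMod 2) = if Even j then 1 else 0 := by
    rw [hM, ← Nat.coe_castAddMonoidHom, map_sumEdges, ← sumEdges_defect j]
    congr 1
    funext R
    exact natCast_ite_eq_defect (j + 4) R
  have hne : ∀ e ∈ l, e.1 ≠ 1 ∧ e.2 ≠ 1 := by
    rintro ⟨u, v⟩ he
    simp only [hl, closing, List.mem_append, List.mem_cons, Prod.mk.injEq, mem_rounds,
      List.not_mem_nil, or_false] at he
    omega
  have h8 : ((sumEdges (sumEdges (fun R => if R (insert 1 S) = 0 then 1 else 0)
      [(1, 2), (1, 4), (1, j + 5)]) l (fun S => if S = ∅ then 1 else 0) : ℕ) : ZMod 8) =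
        ((4 * M : ℕ) : ZMod 8) := by
    have hM4 : ((4 * M : ℕ) : ZMod 8) =
        ((Nat.castAddMonoidHom (ZMod 8)).comp (AddMonoidHom.mulLeft 4)) M := rfl
    rw [hM4, hM, ← Nat.coe_castAddMonoidHom, map_sumEdges, map_sumEdges]
    refine sumEdges_congr (fun R => ∀ S, 1 ∈ S → R S = 0)
      (fun R hR => sumEdges_vertex_one (by simp [hS]) (by simp [hS]) (by simp [hS]) (by simp [hS])
        (by omega) hR) _ ?_ _ ?_
    · intro e he y R hR T hT
      have := hne e he
      simp [addEdge, hR, hT, Ne.symm this.1, Ne.symm this.2]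
    · intro T hT
      exact if_neg (Finset.ne_empty_of_mem hT)
  have hMj : M ≡ j + 1 [MOD 2] := by
    rw [← ZMod.natCast_eq_natCast_iff, hM2, eq_comm]
    split_ifs with hj
    · exact ZMod.natCast_eq_one_iff_odd.2 hj.add_one
    · exact (ZMod.natCast_eq_zero_iff_even).2 (Nat.not_even_iff_odd.1 hj).add_one
  exact ((ZMod.natCast_eq_natCast_iff _ _ 8).1 h8).trans (hMj.mul_left' 4)

theorem nodup_edges (j : ℕ) : (edges j).Nodup := by
  simp only [edges, closing, List.nodup_append, nodup_rounds, List.mem_append, List.mem_cons,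
    List.nodup_cons, Prod.forall, Prod.mk.injEq, mem_rounds, List.not_mem_nil, or_false, not_or,
    ne_eq, List.nodup_nil, not_false_eq_true, and_true, true_and]
  and_intros <;> intros <;> omega

theorem mem_edges_iff {j u v : ℕ} (hu : 1 ≤ u) (huv : u < v) (hv : v < j + 7) :
    (u, v) ∈ edges j ↔ v = u + 1 ∨ v = u + 3 ∨ v = u + (j + 4) := by
  simp only [edges, closing, List.mem_append, List.mem_cons, Prod.mk.injEq, mem_rounds,
    List.not_mem_nil, or_false]
  omega

theorem bounds_of_mem_edges {j : ℕ} {p : ℕ × ℕ} (hp : p ∈ edges j) :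
    1 ≤ p.1 ∧ p.1 < p.2 ∧ p.2 < j + 7 := by
  obtain ⟨u, v⟩ := p
  simp only [edges, closing, List.mem_append, List.mem_cons, Prod.mk.injEq, mem_rounds,
    List.not_mem_nil, or_false] at hp
  omega

theorem circulant_adj_iff {n : ℕ} [NeZero n] (hn : 4 ≤ n) {a b : ZMod n} (ha : a ≠ 0)
    (hab : a.val < b.val) :
    (circulant n {1, 3}).Adj a b ↔
      b.val = a.val + 1 ∨ b.val = a.val + 3 ∨ b.val = a.val + (n - 3) := by
  have ha1 : 1 ≤ a.val := Nat.one_le_iff_ne_zero.2 ((ZMod.val_ne_zero a).2 ha)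
  have hb := ZMod.val_lt b
  have hcast : ∀ (x y : ZMod n) (s : ℤ),
      x - y = (s : ZMod n) ↔ (n : ℤ) ∣ (x.val : ℤ) - y.val - s := by
    intro x y s
    rw [← ZMod.intCast_zmod_eq_zero_iff_dvd]
    push_cast
    rw [ZMod.natCast_zmod_val, ZMod.natCast_zmod_val, sub_eq_zero]
  have hne : a ≠ b := by rintro rfl; exact hab.false
  simp only [circulant, SimpleGraph.fromRel_adj, Set.mem_insert_iff, Set.mem_singleton_iff,
    exists_eq_or_imp, exists_eq_left, hcast]
  have hpos : ∀ x : ℤ, -n < x → x < n → ((n : ℤ) ∣ x ↔ x = 0) := fun x h1 h2 =>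
    ⟨fun h => Int.eq_zero_of_abs_lt_dvd h (abs_lt.2 ⟨h1, h2⟩), fun h => h ▸ dvd_zero _⟩
  have hneg : ∀ x : ℤ, -2 * n < x → x < 0 → ((n : ℤ) ∣ x ↔ x = -n) := fun x h1 h2 => by
    rw [← dvd_add_self_right, hpos _ (by omega) (by omega)]
    omega
  rw [and_iff_right hne, hneg _ (by omega) (by omega), hneg _ (by omega) (by omega), hpos _ (by omega) (by omega),
    hpos _ (by omega) (by omega)]
  omega

/-- The point count for the decompletion of `C_n(1, 3)`. -/
theorem zeroCount_two_circulant {n : ℕ} [NeZero n] (hn : 7 ≤ n) :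
    zeroCount ((circulant n {1, 3}).induce {w | w ≠ 0}) 2 ≡ 4 * n [MOD 8] := by
  obtain ⟨j, rfl⟩ := Nat.exists_eq_add_of_le' hn
  have hval : ∀ m < j + 7, (m : ZMod (j + 7)).val = m := fun m hm => ZMod.val_natCast_of_lt hm
  have hsub : ∀ m, 1 ≤ m → m < j + 7 → (m : ZMod (j + 7)) ≠ 0 := fun m h1 hm h0 => by
    have := hval m hm
    rw [h0, ZMod.val_zero] at this
    omega
  let ρ : ({w | w ≠ 0} : Set (ZMod (j + 7))) → ℕ := fun w => (w : ZMod (j + 7)).val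
  have hρ : Function.Injective ρ := fun a b h => Subtype.ext (ZMod.val_injective _ h)
  have hrange : ∀ m, 1 ≤ m → m < j + 7 → m ∈ Set.range ρ := fun m h1 hm =>
    ⟨⟨m, hsub m h1 hm⟩, hval m hm⟩
  have hρ1 : ∀ a, 1 ≤ ρ a := fun a => Nat.one_le_iff_ne_zero.2 ((ZMod.val_ne_zero _).2 a.2)
  have hρn : ∀ a, ρ a < j + 7 := fun a => ZMod.val_lt _
  obtain ⟨r, hr⟩ := hrange 2 (by omega) (by omega)
  have hS : ∀ m, m ∈ insert 1 (Finset.Ico 3 (j + 7)) ↔ ∃ a ≠ r, ρ a = m := by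
    intro m
    rw [Finset.mem_insert, Finset.mem_Ico]
    constructor
    · intro hm
      obtain ⟨a, ha⟩ := hrange m (by omega) (by omega)
      exact ⟨a, by rintro rfl; omega, ha⟩
    · rintro ⟨a, har, rfl⟩
      have h2 : ρ a ≠ 2 := fun h => har (hρ (h.trans hr.symm))
      have := hρ1 a
      have := hρn a
      omega
  rw [zeroCount_two_eq_sumEdges _ r hρ hS (edges j) (nodup_edges j)]
  · exact sumEdges_edges_modEq.trans (by unfold Nat.ModEq; omega)
  · intro p hp
    obtain ⟨h1, h2, h3⟩ := bounds_of_mem_edges hp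
    exact ⟨h2, hrange _ h1 (by omega), hrange _ (by omega) h3⟩
  · intro a b hab
    rw [mem_edges_iff (hρ1 a) hab (hρn b), SimpleGraph.comap_adj]
    exact circulant_adj_iff (by omega) a.2 hab

end SkewTorus

/-- For the decompletion `G` of the circulant graph `C_{3k}(1,3)` with `k ≥ 3`
(a decompleted skew toroidal grid parametrized by `(k,0)` and `(1,3)`),
`[Ψ_G]_2 ≡ 4k (mod 8)`, i.e. `c₂^{(2)}(G) ≡ k (mod 2)`. -/
theorem c2_two_decompleted_skew_torus (k : ℕ) [NeZero (3 * k)] (hk : 3 ≤ k) :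
    zeroCount ((circulant (3 * k) {1, 3}).induce {w | w ≠ 0}) 2 ≡ 4 * k [MOD 8] :=
  (SkewTorus.zeroCount_two_circulant (by omega)).trans (by unfold Nat.ModEq; omega)
end

section
/- Let p be a prime, N ≥ 1 an integer, and F a polynomial in N variables x₁, …, x_N with integer coefficients and total degree at most N. Then the number of points x ∈ 𝔽_p^N at which (the reduction mod p of) F vanishes is congruent, modulo p, to (−1)^{N+1} times the coefficient of the monomial x₁^{p−1} x₂^{p−1} ⋯ x_N^{p−1} in the polynomial F^{p−1}. -/
/-- The power sum of exponent `q - 1` over a finite field with `q` elements is `-1`. -/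
theorem FiniteField.sum_pow_card_sub_one {K : Type*} [Field K] [Fintype K] :
    ∑ a : K, a ^ (Fintype.card K - 1) = -1 := by
  classical
  have hq : Fintype.card K - 1 ≠ 0 := by
    have := Fintype.one_lt_card (α := K)
    omega
  have h (a : K) : a ^ (Fintype.card K - 1) = 1 - if a = 0 then 1 else 0 := by
    split_ifs with ha
    · simp [ha, hq]
    · simp [FiniteField.pow_card_sub_one_eq_one a ha]
  simp [h]

/-- The boundary case of `MvPolynomial.sum_eval_eq_zero`: if `f` has total degree at most
`(q - 1) * |σ|`, the sum of its values is, up to sign, its coefficient at `∏ i, X i ^ (q - 1)`. -/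
theorem MvPolynomial.sum_eval_eq_coeff {K σ : Type*} [Field K] [Fintype K] [Fintype σ]
    [DecidableEq σ] (f : MvPolynomial σ K)
    (h : f.totalDegree ≤ (Fintype.card K - 1) * Fintype.card σ) :
    ∑ x : σ → K, eval x f = (-1) ^ Fintype.card σ *
      f.coeff (Finsupp.equivFunOnFinite.symm fun _ => Fintype.card K - 1) := by
  set m : σ →₀ ℕ := Finsupp.equivFunOnFinite.symm fun _ => Fintype.card K - 1
  have hsum (d : σ →₀ ℕ) : ∑ x : σ → K, ∏ i, x i ^ d i = ∏ i, ∑ a : K, a ^ d i := by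
    rw [Finset.prod_univ_sum, Fintype.piFinset_univ]
  simp only [eval_eq']
  rw [Finset.sum_comm]
  simp only [← Finset.mul_sum, hsum]
  rw [Finset.sum_eq_single m]
  · simp [m, FiniteField.sum_pow_card_sub_one, mul_comm]
  · intro d hd hdm
    obtain ⟨i, hi⟩ : ∃ i, d i < Fintype.card K - 1 := by
      by_contra! hge
      have hdeg : ∑ i, d i ≤ ∑ _i : σ, (Fintype.card K - 1) := by
        rw [← Finsupp.sum_fintype d (fun _ e => e) fun _ => rfl]
        simpa [mul_comm] using (le_totalDegree hd).trans h
      have heq := (Finset.sum_eq_sum_iff_of_le fun i _ => hge i).1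
        (le_antisymm (Finset.sum_le_sum fun i _ => hge i) hdeg)
      exact hdm (Finsupp.ext fun i => (heq i (Finset.mem_univ i)).symm)
    rw [Finset.prod_eq_zero (Finset.mem_univ i) (FiniteField.sum_pow_lt_card_sub_one K _ hi),
      mul_zero]
  · intro hm
    simp [notMem_support_iff.1 hm]

/-- Ax's lemma from the proof of the Chevalley–Warning theorem: if `F` is an integer
polynomial in `N ≥ 1` variables of total degree at most `N`, then the number of zeros of
`F` over `𝔽_p` is congruent modulo `p` to `(-1)^(N+1)` times the coefficient of
`x₁^(p-1) ⋯ x_N^(p-1)` in `F^(p-1)`. -/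
theorem count_zeros_eq_coeff_pow (p : ℕ) (hp : p.Prime) (N : ℕ) (hN : 1 ≤ N)
    (F : MvPolynomial (Fin N) ℤ) (hdeg : F.totalDegree ≤ N) :
    (Nat.card {x : Fin N → ZMod p //
        MvPolynomial.eval x (MvPolynomial.map (Int.castRingHom (ZMod p)) F) = 0} : ZMod p)
      = (-1) ^ (N + 1) *
        ((MvPolynomial.coeff (Finsupp.equivFunOnFinite.symm fun _ : Fin N => p - 1)
          (F ^ (p - 1)) : ℤ) : ZMod p) := by
  have : Fact p.Prime := ⟨hp⟩
  set f := MvPolynomial.map (Int.castRingHom (ZMod p)) F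
  have hf : (f ^ (p - 1)).totalDegree ≤ (Fintype.card (ZMod p) - 1) * Fintype.card (Fin N) := by
    rw [ZMod.card, Fintype.card_fin]
    exact (MvPolynomial.totalDegree_pow _ _).trans
      (Nat.mul_le_mul_left _ ((Finset.sup_mono (MvPolynomial.support_map_subset _ _)).trans hdeg))
  have hsum := MvPolynomial.sum_eval_eq_coeff _ hf
  have hind (x : Fin N → ZMod p) :
      (if MvPolynomial.eval x f = 0 then 1 else 0 : ZMod p) =
        1 - MvPolynomial.eval x (f ^ (p - 1)) := by
    rw [map_pow]
    split_ifs with hx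
    · simp [hx, Nat.sub_ne_zero_of_lt hp.one_lt]
    · simp [ZMod.pow_card_sub_one_eq_one hx]
  have hcoeff (d : Fin N →₀ ℕ) :
      (f ^ (p - 1)).coeff d = (((F ^ (p - 1)).coeff d : ℤ) : ZMod p) := by
    rw [← map_pow, MvPolynomial.coeff_map, eq_intCast]
  rw [Nat.card_eq_fintype_card, Fintype.card_subtype, ← Finset.sum_boole]
  simp only [hind]
  rw [Finset.sum_sub_distrib, hsum, hcoeff]
  simp [ZMod.card, Nat.one_le_iff_ne_zero.1 hN, pow_succ]
end

section
/- Let G be a finite connected simple graph with n vertices and m edges, with a chosen orientation of its edges and a chosen vertex v₀. Let E be the (n−1) × m signed incidence matrix of G with the row corresponding to v₀ removed (entry +1 if the vertex is the head of the edge, −1 if it is the tail, 0 otherwise), let Λ be the m × m diagonal matrix whose diagonal entries are the edge variables α_e, and let M be the (m+n−1) × (m+n−1) block matrix [[Λ, Eᵀ], [−E, 0]]. Then det M = Ψ_G, the Kirchhoff polynomial of G. -/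
open SimpleGraph
open scoped Classical

/-- The signed incidence matrix of `G` (with respect to the orientation given by
`head` and `tail`) with the row of `v₀` removed: the entry at `(v, e)` is `+1` if `v` is
the head of `e`, `-1` if `v` is the tail of `e`, and `0` otherwise. -/
noncomputable def reducedIncidence {V : Type} [Fintype V] (G : SimpleGraph V) (v₀ : V)
    (head tail : G.edgeSet → V) :
    Matrix {v : V // v ≠ v₀} G.edgeSet (MvPolynomial G.edgeSet ℤ) :=
  Matrix.of fun v e => if head e = (v : V) then 1 else if tail e = (v : V) then -1 else 0

namespace Matrix

/-- Expansion of the determinant of a diagonal perturbation into principal minors. -/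
theorem det_diagonal_add {n R : Type*} [Fintype n] [DecidableEq n] [CommRing R]
    (d : n → R) (A : Matrix n n R) :
    (diagonal d + A).det =
      ∑ S : Finset n, (∏ i ∈ Sᶜ, d i) * (A.submatrix ((↑) : S → n) ((↑) : S → n)).det := by
  have expand := (detRowAlternating (n := n) (R := R)).toMultilinearMap.map_add_univ
    A (diagonal d)
  change det (A + diagonal d) = _ at expand
  rw [add_comm, expand]
  refine Finset.sum_congr rfl fun S _ => ?_
  change det (of (S.piecewise A (diagonal d))) = _
  rw [twoBlockTriangular_det _ (· ∈ S), mul_comm]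
  · congr 1
    · have h : toSquareBlockProp (of (S.piecewise A (diagonal d))) (fun i => ¬ i ∈ S) =
          diagonal fun i : {i // i ∉ S} => d i := by
        ext i j
        simp [toSquareBlockProp, toBlock_apply, Finset.piecewise, i.2, diagonal_apply,
          Subtype.ext_iff]
      rw [h, det_diagonal]
      exact (Finset.prod_subtype _ (by simp) _).symm
    · have h : toSquareBlockProp (of (S.piecewise A (diagonal d))) (· ∈ S) =
          A.submatrix ((↑) : S → n) ((↑) : S → n) := by
        ext i j
        simp [toSquareBlockProp, toBlock_apply, Finset.piecewise]
      rw [h]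
      convert! rfl
  · intro i hi j hj
    have : i ≠ j := by rintro rfl; exact hi hj
    simp [Finset.piecewise, hi, this]

/-- Expansion of the determinant of a block matrix with diagonal upper left block and zero lower
right block. -/
theorem det_fromBlocks_diagonal_zero {κ ι R : Type*} [Fintype κ] [DecidableEq κ] [Fintype ι]
    [DecidableEq ι] [CommRing R] (d : κ → R) (B : Matrix κ ι R) (C : Matrix ι κ R) :
    (fromBlocks (diagonal d) B C 0).det =
      ∑ S : Finset κ, (∏ i ∈ Sᶜ, d i) *
        (fromBlocks (0 : Matrix S S R) (B.submatrix (↑) id) (C.submatrix id (↑)) 0).det := by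
  have h : fromBlocks (diagonal d) B C 0 =
      diagonal (Sum.elim d 0) + fromBlocks 0 B C 0 := by
    rw [← fromBlocks_diagonal, fromBlocks_add]
    simp
  rw [h, det_diagonal_add]
  symm
  refine Finset.sum_of_injOn (fun S => S.disjSum Finset.univ) ?_ (by simp) ?_ ?_
  · intro S _ T _ hST
    simpa using congrArg Finset.toLeft hST
  · intro T _ hT
    have : ∃ j : ι, Sum.inr j ∉ T := by
      by_contra! hall
      refine hT ⟨T.toLeft, by simp, ?_⟩
      ext (i | j) <;> simp [hall]
    obtain ⟨j, hj⟩ := this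
    rw [Finset.prod_eq_zero (i := Sum.inr j) (by simpa using hj) (by simp), zero_mul]
  · intro S _
    congr 1
    · have : (S.disjSum (Finset.univ : Finset ι))ᶜ = Sᶜ.disjSum ∅ := by
        ext (i | j) <;> simp
      rw [this, Finset.prod_disjSum]
      simp
    · let e : S ⊕ ι ≃ (S.disjSum (Finset.univ : Finset ι) : Finset (κ ⊕ ι)) :=
        { toFun := Sum.elim (fun i => ⟨Sum.inl i, by simp⟩) (fun j => ⟨Sum.inr j, by simp⟩)
          invFun := fun x => match x with
            | ⟨Sum.inl i, h⟩ => Sum.inl ⟨i, by simpa using h⟩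
            | ⟨Sum.inr j, _⟩ => Sum.inr j
          left_inv := by rintro (i | j) <;> rfl
          right_inv := by rintro ⟨i | j, h⟩ <;> rfl }
      rw [← det_submatrix_equiv_self e]
      congr 1
      ext (i | i) (j | j) <;> rfl

theorem det_fromBlocks_zero_transpose_neg_zero {ι R : Type*} [Fintype ι] [DecidableEq ι]
    [CommRing R] (A : Matrix ι ι R) :
    (fromBlocks 0 Aᵀ (-A) 0).det = A.det ^ 2 := by
  have h : fromBlocks 0 Aᵀ (-A) 0 = fromBlocks Aᵀ 0 0 A *
      (fromBlocks 1 1 0 1 * fromBlocks 1 0 (-1) 1 * fromBlocks 1 1 0 1) := by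
    simp [fromBlocks_multiply]
  rw [h]
  simp [sq]

theorem det_fromBlocks_zero_of_card_lt {κ ι R : Type*} [Fintype κ] [DecidableEq κ] [Fintype ι]
    [DecidableEq ι] [CommRing R] (B : Matrix κ ι R) (C : Matrix ι κ R) (D : Matrix ι ι R)
    (h : Fintype.card ι < Fintype.card κ) :
    (fromBlocks 0 B C D).det = 0 := by
  rw [det_apply']
  refine Finset.sum_eq_zero fun σ _ => ?_
  have : ∃ i k : κ, σ (Sum.inl i) = Sum.inl k := by
    by_contra! hσ
    have hr : ∀ i : κ, ∃ j : ι, σ (Sum.inl i) = Sum.inr j := by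
      intro i
      rcases hi : σ (Sum.inl i) with k | j
      · exact (hσ i k hi).elim
      · exact ⟨j, rfl⟩
    choose f hf using hr
    refine h.not_ge (Fintype.card_le_of_injective f fun a b hab => ?_)
    exact Sum.inl_injective (σ.injective (by rw [hf, hf, hab]))
  obtain ⟨i, k, hik⟩ := this
  rw [Finset.prod_eq_zero (Finset.mem_univ (Sum.inl i)) (by simp [hik]), mul_zero]

theorem det_fromBlocks_eq_one_of_mul_eq_one {κ ι : Type*} [Fintype κ] [DecidableEq κ] [Fintype ι]
    [DecidableEq ι] (A : Matrix ι κ ℤ) (B : Matrix κ ι ℤ) (hAB : A * B = 1)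
    (h : Fintype.card κ = Fintype.card ι) :
    (fromBlocks 0 Aᵀ (-A) 0).det = 1 := by
  let e : ι ≃ κ := (Fintype.equivOfCardEq h).symm
  have hinv : A.submatrix id e * B.submatrix e id = 1 := by
    rw [submatrix_mul_equiv, hAB, submatrix_id_id]
  have hunit : IsUnit (A.submatrix id e).det :=
    IsUnit.of_mul_eq_one _ (by rw [← det_mul, hinv, det_one])
  rw [← det_submatrix_equiv_self (e.sumCongr (Equiv.refl ι))]
  have hblocks : (fromBlocks 0 Aᵀ (-A) 0).submatrix (e.sumCongr (Equiv.refl ι))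
      (e.sumCongr (Equiv.refl ι)) =
      fromBlocks 0 (A.submatrix id e)ᵀ (-(A.submatrix id e)) 0 := by
    ext (i | i) (j | j) <;> rfl
  rw [hblocks, det_fromBlocks_zero_transpose_neg_zero]
  rcases Int.isUnit_iff.mp hunit with h | h <;> simp [h]

theorem det_fromBlocks_eq_zero_of_mulVec_eq_zero {κ ι : Type*} [Fintype κ] [DecidableEq κ]
    [Fintype ι] [DecidableEq ι] (B : Matrix κ ι ℤ) (C : Matrix ι κ ℤ) (u : ι → ℤ) (hu : u ≠ 0)
    (hB : B *ᵥ u = 0) :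
    (fromBlocks 0 B C 0).det = 0 := by
  refine exists_mulVec_eq_zero_iff.mp ⟨Sum.elim 0 u, ?_, ?_⟩
  · intro h
    exact hu (funext fun i => congrFun h (Sum.inr i))
  · rw [fromBlocks_mulVec]
    ext (i | i) <;> simp [hB]

end Matrix

/-- The signed incidence matrix of a family of directed edges, with the row of `v₀` removed. -/
noncomputable def directedIncidence {V κ : Type*} (v₀ : V) (head tail : κ → V) :
    Matrix {v : V // v ≠ v₀} κ ℤ :=
  Matrix.of fun v e => if head e = (v : V) then 1 else if tail e = (v : V) then -1 else 0

theorem exists_sum_eq_of_reachable {V κ : Type*} [Fintype κ] {H : SimpleGraph V}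
    {head tail : κ → V} (hH : ∀ u v, H.Adj u v → ∃ e, s(head e, tail e) = s(u, v)) {u v : V}
    (h : H.Reachable u v) :
    ∃ y : κ → ℤ, ∀ w, ∑ e, (if head e = w then 1 else if tail e = w then -1 else 0) * y e =
      (if u = w then 1 else 0) - (if v = w then 1 else 0) := by
  obtain ⟨p⟩ := h
  induction p with
  | nil => exact ⟨0, by simp⟩
  | @cons u x v hux p ih =>
    obtain ⟨y, hy⟩ := ih
    obtain ⟨e, he⟩ := hH u x hux
    have hne := hux.ne
    rcases Sym2.eq_iff.mp he with ⟨rfl, rfl⟩ | ⟨rfl, rfl⟩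
    · refine ⟨y + Pi.single e 1, fun w => ?_⟩
      simp only [Pi.add_apply, mul_add, Finset.sum_add_distrib, hy, Pi.single_apply, mul_ite,
        mul_one, mul_zero, Finset.sum_ite_eq', Finset.mem_univ, if_true]
      grind
    · refine ⟨y - Pi.single e 1, fun w => ?_⟩
      simp only [Pi.sub_apply, mul_sub, Finset.sum_sub_distrib, hy, Pi.single_apply, mul_ite,
        mul_one, mul_zero, Finset.sum_ite_eq', Finset.mem_univ, if_true]
      grind

theorem directedIncidence_exists_mul_eq_one {V κ : Type*} [Fintype κ] {H : SimpleGraph V} (v₀ : V)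
    {head tail : κ → V} (hH : ∀ u v, H.Adj u v → ∃ e, s(head e, tail e) = s(u, v))
    (hconn : H.Connected) :
    ∃ B : Matrix κ {v : V // v ≠ v₀} ℤ, directedIncidence v₀ head tail * B = 1 := by
  choose y hy using fun v : {v : V // v ≠ v₀} =>
    exists_sum_eq_of_reachable hH (hconn.preconnected (v : V) v₀)
  refine ⟨Matrix.of fun e v => y v e, ?_⟩
  ext w v
  have := hy v w
  rw [if_neg (Ne.symm w.2), sub_zero] at this
  simpa [Matrix.mul_apply, directedIncidence, Matrix.one_apply, Subtype.ext_iff, eq_comm] using this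

theorem directedIncidence_exists_mulVec_eq_zero {V κ : Type*} [Fintype V] {H : SimpleGraph V}
    (v₀ : V) {head tail : κ → V} (hH : ∀ e, H.Adj (head e) (tail e)) (hconn : ¬ H.Connected) :
    ∃ u : {v : V // v ≠ v₀} → ℤ,
      u ≠ 0 ∧ (directedIncidence v₀ head tail).transpose.mulVec u = 0 := by
  let c : V → ℤ := fun v => if H.Reachable v v₀ then 0 else 1
  have hc₀ : c v₀ = 0 := by simp [c]
  refine ⟨fun v => c v, fun hzero => hconn ?_, ?_⟩
  · have hreach : ∀ v, H.Reachable v v₀ := by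
      intro v
      by_cases hv : v = v₀
      · rw [hv]
      · simpa [c] using congrFun hzero ⟨v, hv⟩
    exact { preconnected := fun a b => (hreach a).trans (hreach b).symm, nonempty := ⟨v₀⟩ }
  · ext e
    have hc : c (head e) = c (tail e) := by
      have : H.Reachable (head e) v₀ ↔ H.Reachable (tail e) v₀ :=
        ⟨(hH e).reachable.symm.trans, (hH e).reachable.trans⟩
      simp [c, this]
    have hne := (hH e).ne
    have hterm : ∀ v, (if head e = v then 1 else if tail e = v then -1 else 0) * c v =
        (if head e = v then c v else 0) - (if tail e = v then c v else 0) := by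
      grind
    have hsum : ∑ v, (if head e = v then 1 else if tail e = v then -1 else 0) * c v = 0 := by
      simp [hterm, Finset.sum_sub_distrib, hc]
    have hc₁ : ∀ v : {v : V // ¬ v ≠ v₀}, c v = 0 := by
      intro v
      rw [not_ne_iff.mp v.2, hc₀]
    rw [← Fintype.sum_subtype_add_sum_subtype (· ≠ v₀)] at hsum
    simp only [hc₁, mul_zero, Finset.sum_const_zero, add_zero] at hsum
    simpa [Matrix.mulVec, dotProduct, directedIncidence] using hsum

/-- The block determinant attached to a set of directed edges detects spanning trees. -/
theorem det_fromBlocks_directedIncidence {V κ : Type*} [Fintype V] [Fintype κ] [DecidableEq κ]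
    {H : SimpleGraph V} (v₀ : V) {head tail : κ → V}
    (hAdj : ∀ u v, H.Adj u v → ∃ e, s(head e, tail e) = s(u, v))
    (hH : ∀ e, H.Adj (head e) (tail e)) (hcard : Nat.card H.edgeSet = Fintype.card κ) :
    (Matrix.fromBlocks 0 (directedIncidence v₀ head tail).transpose
      (-(directedIncidence v₀ head tail)) 0).det = if H.Connected ∧ H.IsAcyclic then 1 else 0 := by
  have hV : Fintype.card {v : V // v ≠ v₀} + 1 = Fintype.card V := by
    have := Fintype.card_pos_iff.mpr ⟨v₀⟩
    simp only [ne_eq, Fintype.card_subtype_compl, Fintype.card_subtype_eq]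
    omega
  have htree : (H.Connected ∧ H.IsAcyclic) ↔
      H.Connected ∧ Fintype.card κ = Fintype.card {v : V // v ≠ v₀} := by
    rw [← SimpleGraph.isTree_iff, SimpleGraph.isTree_iff_connected_and_card, hcard,
      Nat.card_eq_fintype_card, ← hV, Nat.add_right_cancel_iff]
  rw [if_congr htree rfl rfl]
  by_cases hconn : H.Connected
  · obtain ⟨B, hB⟩ := directedIncidence_exists_mul_eq_one v₀ hAdj hconn
    by_cases hk : Fintype.card κ = Fintype.card {v : V // v ≠ v₀}
    · rw [if_pos ⟨hconn, hk⟩, Matrix.det_fromBlocks_eq_one_of_mul_eq_one _ B hB hk]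
    · rw [if_neg (fun h => hk h.2)]
      have := hconn.card_vert_le_card_edgeSet_add_one
      rw [hcard, Nat.card_eq_fintype_card] at this
      exact Matrix.det_fromBlocks_zero_of_card_lt _ _ _ (by omega)
  · obtain ⟨u, hu, hzero⟩ := directedIncidence_exists_mulVec_eq_zero v₀ hH hconn
    rw [if_neg (fun h => hconn h.1)]
    exact Matrix.det_fromBlocks_eq_zero_of_mulVec_eq_zero _ _ u hu hzero

/-- The matrix-tree theorem in the block-matrix form `det [[Λ, Eᵀ], [-E, 0]] = Ψ_G`. -/
theorem det_blocks_eq_kirchhoff {V : Type} [Fintype V] (G : SimpleGraph V)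
    (hG : G.Connected) (v₀ : V) (head tail : G.edgeSet → V)
    (ho : ∀ e : G.edgeSet, (e : Sym2 V) = s(head e, tail e)) :
    (Matrix.fromBlocks
        (Matrix.diagonal fun e : G.edgeSet => (MvPolynomial.X e : MvPolynomial G.edgeSet ℤ))
        (reducedIncidence G v₀ head tail).transpose
        (-(reducedIncidence G v₀ head tail)) 0).det = kirchhoff G := by
  rw [Matrix.det_fromBlocks_diagonal_zero]
  have hdet : ∀ S : Finset G.edgeSet,
      (Matrix.fromBlocks (0 : Matrix S S (MvPolynomial G.edgeSet ℤ))
        ((reducedIncidence G v₀ head tail).transpose.submatrix (↑) id)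
        ((-(reducedIncidence G v₀ head tail)).submatrix id (↑)) 0).det =
      if IsSpanningTree G ((S.map (Function.Embedding.subtype _) : Finset (Sym2 V)) : Set (Sym2 V))
        then 1 else 0 := by
    intro S
    set T : Set (Sym2 V) :=
      ((S.map (Function.Embedding.subtype _) : Finset (Sym2 V)) : Set (Sym2 V)) with hT
    have hTG : T ⊆ G.edgeSet := by
      intro x hx
      simp [hT] at hx
      exact hx.1
    have hedge : (SimpleGraph.fromEdgeSet T).edgeSet = T := by
      rw [SimpleGraph.edgeSet_fromEdgeSet, sdiff_eq_left, ← Set.subset_compl_iff_disjoint_right]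
      exact hTG.trans G.edgeSet_subset_compl_diagSet
    have hmem : ∀ e : S, s(head e, tail e) ∈ T := by
      intro e
      rw [← ho]
      simp [hT]
    have key := det_fromBlocks_directedIncidence (H := SimpleGraph.fromEdgeSet T) v₀
      (head := fun e : S => head e) (tail := fun e : S => tail e)
      (fun u v huv => by
        obtain ⟨e, he, heq⟩ := Finset.mem_map.mp (Finset.mem_coe.mp
          ((SimpleGraph.fromEdgeSet_adj T).mp huv).1)
        exact ⟨⟨e, he⟩, by rw [← ho]; exact heq⟩)
      (fun e => by rw [← SimpleGraph.mem_edgeSet, hedge]; exact hmem e)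
      (by rw [hedge, hT, Nat.card_coe_set_eq, Set.ncard_coe_finset, Finset.card_map,
        Fintype.card_coe])
    have hmap : Matrix.fromBlocks (0 : Matrix S S (MvPolynomial G.edgeSet ℤ))
        ((reducedIncidence G v₀ head tail).transpose.submatrix (↑) id)
        ((-(reducedIncidence G v₀ head tail)).submatrix id (↑)) 0 =
        (Int.castRingHom (MvPolynomial G.edgeSet ℤ)).mapMatrix (Matrix.fromBlocks 0
          (directedIncidence v₀ (fun e : S => head e) (fun e : S => tail e)).transpose
          (-(directedIncidence v₀ (fun e : S => head e) (fun e : S => tail e))) 0) := by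
      ext1 (i | i) (j | j) <;>
        simp [directedIncidence, reducedIncidence, apply_ite (Int.cast : ℤ → MvPolynomial _ ℤ)]
    have hiff : IsSpanningTree G T ↔
        (SimpleGraph.fromEdgeSet T).Connected ∧ (SimpleGraph.fromEdgeSet T).IsAcyclic :=
      ⟨fun h => h.2, fun h => ⟨hTG, h⟩⟩
    rw [hmap, ← RingHom.map_det, key, if_congr hiff rfl rfl]
    split_ifs <;> simp
  simp_rw [hdet, mul_ite, mul_one, mul_zero]
  rw [← Finset.sum_filter, kirchhoff]
  refine Finset.sum_bij (fun S _ => S.map (Function.Embedding.subtype _)) ?_ ?_ ?_ ?_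
  · intro S hS
    rw [Finset.mem_filter] at hS ⊢
    exact ⟨Finset.mem_powerset.mpr fun x hx =>
      SimpleGraph.mem_edgeFinset.mpr (hS.2.1 (Finset.mem_coe.mpr hx)), hS.2⟩
  · intro S _ S' _ h
    exact Finset.map_injective _ h
  · intro T hT
    rw [Finset.mem_filter] at hT
    have hmap : (T.subtype (· ∈ G.edgeSet)).map (Function.Embedding.subtype _) = T :=
      Finset.subtype_map_of_mem fun x hx => hT.2.1 (Finset.mem_coe.mpr hx)
    exact ⟨T.subtype (· ∈ G.edgeSet), Finset.mem_filter.mpr ⟨Finset.mem_univ _, by rw [hmap]; exact hT.2⟩, hmap⟩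
  · intro S _
    simp [Finset.prod_ite, Finset.compl_eq_univ_sdiff, Finset.sdiff_eq_filter]
end
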